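/- arXiv:q-alg/9704004 — 2 statements merged into one kernel-verified Lean document; each statement's English description precedes it below -/
import Mathlib

section
/- Let f be a modular unit such that for some rational number s, f(z)·exp(−2πisz) = 1 + Σ_{n≥1} c_n·exp(2πinz) for all z ∈ ℍ with non-negative integer coefficients c_n. Then f is a finite product of integral, though not necessarily positive, powers of the functions [r]_l: there exist finitely many pairs (r_i, l_i) of integers with l_i ≥ 1 and l_i ∤ r_i, and integers m_i, such that f = ∏_i [r_i]_{l_i}^{m_i}. -/
open Complex Filter Topology UpperHalfPlane Matrix MatrixGroups
open scoped Real Manifold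

noncomputable section

/-- `B(x) = y² − y + 1/6` where `y` is the fractional part of `x`. -/
def bern (x : ℝ) : ℝ := Int.fract x ^ 2 - Int.fract x + 1 / 6

/-- The modular unit `[r]_l`. -/
def rl (l r : ℤ) : UpperHalfPlane → ℂ := fun z =>
  Complex.exp (2 * (π : ℂ) * Complex.I *
      ((-((l : ℝ) * bern ((r : ℝ) / (l : ℝ)) / 2) : ℝ) : ℂ) * (z : ℂ)) *
    (∏' n : {n : ℤ // 0 < n ∧ n ≡ r [ZMOD l]},
      (1 - Complex.exp (2 * (π : ℂ) * Complex.I * ((n : ℤ) : ℂ) * (z : ℂ)))⁻¹) *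
    (∏' n : {n : ℤ // 0 < n ∧ n ≡ -r [ZMOD l]},
      (1 - Complex.exp (2 * (π : ℂ) * Complex.I * ((n : ℤ) : ℂ) * (z : ℂ)))⁻¹)

/-- A modular unit: holomorphic, nowhere vanishing on `ℍ`, invariant under some principal
congruence subgroup, and meromorphic at all cusps. -/
def IsModularUnit (f : UpperHalfPlane → ℂ) : Prop :=
  MDifferentiable 𝓘(ℂ) 𝓘(ℂ) f ∧
  (∀ z, f z ≠ 0) ∧
  (∃ N : ℕ, 0 < N ∧ ∀ A ∈ CongruenceSubgroup.Gamma N, ∀ z : UpperHalfPlane, f (A • z) = f z) ∧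
  (∀ A : SL(2, ℤ), ∃ (α : ℝ) (κ : ℂ), κ ≠ 0 ∧
    Filter.Tendsto
      (fun z : UpperHalfPlane =>
        f (A • z) * Complex.exp (-(2 * (π : ℂ) * Complex.I * (α : ℂ) * (z : ℂ))))
      UpperHalfPlane.atImInfty (nhds κ))




def qp (x : ℂ) (n : ℕ) : ℂ := ∏ i ∈ Finset.range n, (1 - x ^ (i + 1))

lemma qp_succ (x : ℂ) (n : ℕ) : qp x (n+1) = qp x n * (1 - x ^ (n+1)) := by
  simp [qp, Finset.prod_range_succ]

lemma one_sub_pow_ne {x : ℂ} (hx : ‖x‖ < 1) (n : ℕ) : 1 - x ^ (n+1) ≠ 0 := by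
  intro h
  have h1 : x ^ (n+1) = 1 := (sub_eq_zero.mp h).symm
  have h2 : ‖x‖ ^ (n+1) = 1 := by rw [← norm_pow, h1, norm_one]
  have h3 : ‖x‖ ^ (n+1) < 1 := pow_lt_one₀ (norm_nonneg _) hx (by omega)
  linarith

lemma qp_ne {x : ℂ} (hx : ‖x‖ < 1) (n : ℕ) : qp x n ≠ 0 :=
  Finset.prod_ne_zero_iff.mpr fun i _ => one_sub_pow_ne hx i

lemma rothe {x : ℂ} (hx : ‖x‖ < 1) (y : ℂ) (m : ℕ) :
    ∏ i ∈ Finset.range m, (1 + x ^ i * y) =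
      ∑ k ∈ Finset.range (m+1), qp x m / (qp x k * qp x (m - k)) * x ^ (k * (k-1) / 2) * y ^ k := by
  induction m with
  | zero => simp [qp]
  | succ m ih =>
    rw [Finset.prod_range_succ, ih, mul_add, mul_one, Finset.sum_range_succ' _ (m+1)]
    rw [Finset.sum_mul]
    have e0 : ∑ k ∈ Finset.range (m+1), qp x m / (qp x k * qp x (m - k)) * x ^ (k * (k-1) / 2) * y ^ k
       = ∑ k ∈ Finset.range (m+1), (if k + 1 ≤ m then qp x m / (qp x (k+1) * qp x (m - (k+1))) * x ^ ((k+1) * (k+1-1) / 2) * y ^ (k+1) else 0) + 1 := by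
      rw [Finset.sum_range_succ', Finset.sum_range_succ]
      have : qp x m / (qp x 0 * qp x (m - 0)) * x ^ (0 * (0-1) / 2) * y ^ 0 = 1 := by
        have := qp_ne hx m
        simp [qp] at this ⊢
        exact this
      rw [this]
      simp only [show ¬ (m + 1 ≤ m) by omega, if_false, add_zero]
      congr 1
      apply Finset.sum_congr rfl
      intro k hk
      rw [if_pos (by simpa using hk)]
    rw [e0]
    have e1 : qp x (m + 1) / (qp x 0 * qp x (m + 1 - 0)) * x ^ (0 * (0 - 1) / 2) * y ^ 0 = 1 := by
      have := qp_ne hx (m+1)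
      simp only [qp] at this ⊢
      simp [div_self this]
    rw [e1, add_right_comm, ← Finset.sum_add_distrib]
    congr 1
    apply Finset.sum_congr rfl
    intro k hk
    have hk' : k ≤ m := by simpa [Nat.lt_succ_iff] using hk
    have ht : (k+1) * (k+1-1)/2 = k*(k-1)/2 + k := by
      have := Nat.triangle_succ k
      exact this
    obtain ⟨j, rfl⟩ := Nat.exists_eq_add_of_le hk'
    rw [ht]
    have h1 := qp_ne hx k
    have h2 := qp_ne hx j
    have h4 := one_sub_pow_ne hx k
    rw [show k + j + 1 - (k+1) = j by omega, show k + j - k = j by omega, qp_succ x (k+j), qp_succ x k]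
    rcases Nat.eq_zero_or_pos j with rfl | hj
    · rw [if_neg (by omega)]
      have h3 := qp_ne hx 0
      have h5 := one_sub_pow_ne hx k
      simp only [add_zero] at *
      field_simp
      ring
    · obtain ⟨i, rfl⟩ : ∃ i, j = i + 1 := ⟨j - 1, by omega⟩
      rw [if_pos (by omega), show k + (i+1) - (k+1) = i by omega, qp_succ x i]
      have h3 := qp_ne hx i
      have h5 := one_sub_pow_ne hx i
      field_simp
      ring

lemma finite_tp {p w : ℂ} (hp : ‖p‖ < 1) (hp0 : p ≠ 0) (hw : w ≠ 0) (n : ℕ) :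
    (∏ i ∈ Finset.range n, (1 + p ^ (2*i+1) * w)) * (∏ i ∈ Finset.range n, (1 + p ^ (2*i+1) * w⁻¹)) =
      ∑ k ∈ Finset.range (2*n+1), qp (p^2) (2*n) / (qp (p^2) k * qp (p^2) (2*n - k)) *
        (p ^ (((k:ℤ) - n)^2).toNat * w ^ ((k:ℤ)-n)) := by
  have hx : ‖p^2‖ < 1 := by
    rw [norm_pow]; exact pow_lt_one₀ (norm_nonneg _) hp (by norm_num)
  have h := rothe hx (w * p ^ (1 - 2 * (n:ℤ))) (2*n)
  have hL : ∏ i ∈ Finset.range (2*n), (1 + (p^2) ^ i * (w * p ^ (1 - 2 * (n:ℤ)))) =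
      p ^ (-((n:ℤ)^2)) * w ^ n * ((∏ i ∈ Finset.range n, (1 + p ^ (2*i+1) * w)) * (∏ i ∈ Finset.range n, (1 + p ^ (2*i+1) * w⁻¹))) := by
    rw [two_mul, Finset.prod_range_add, ← Finset.prod_range_reflect]
    have e1 : ∀ i ∈ Finset.range n, (1 + (p^2) ^ (n - 1 - i) * (w * p ^ (1 - 2 * (n:ℤ)))) =
        (p ^ (-(2*(i:ℤ)+1)) * w) * (1 + p ^ (2*i+1) * w⁻¹) := by
      intro i hi
      have hi := Finset.mem_range.mp hi
      obtain ⟨j, rfl⟩ : ∃ j, n = j + 1 + i := ⟨n - 1 - i, by omega⟩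
      rw [show j + 1 + i - 1 - i = j by omega, mul_add, mul_one]
      have : p ^ (-(2*(i:ℤ)+1)) * w * (p ^ (2*i+1) * w⁻¹) = 1 := by
        rw [_root_.zpow_neg, show (2*(i:ℤ)+1) = ((2*i+1 : ℕ):ℤ) by push_cast; ring, zpow_natCast]
        field_simp
      rw [this, add_comm]
      congr 1
      rw [← pow_mul, ← zpow_natCast p (2*j), mul_left_comm, ← zpow_add₀ hp0, mul_comm]
      congr 2
      push_cast; ring
    have e2 : ∀ i ∈ Finset.range n, (1 + (p^2) ^ (n + i) * (w * p ^ (1 - 2 * (n:ℤ)))) =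
        1 + p ^ (2*i+1) * w := by
      intro i hi
      rw [← pow_mul, ← zpow_natCast p (2*(n+i)), mul_left_comm, ← zpow_add₀ hp0, mul_comm w,
        ← zpow_natCast p (2*i+1)]
      congr 3
      push_cast; ring
    rw [Finset.prod_congr rfl e1, Finset.prod_congr rfl e2, Finset.prod_mul_distrib, Finset.prod_mul_distrib]
    have e3 : ∀ m : ℕ, ∏ i ∈ Finset.range m, p ^ (-(2*(i:ℤ)+1)) = p ^ (-((m:ℤ)^2)) := by
      intro m
      induction m with
      | zero => simp
      | succ m ih => 
        rw [Finset.prod_range_succ, ih, ← zpow_add₀ hp0]; congr 1; push_cast; ring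
    rw [e3, Finset.prod_const, Finset.card_range]
    ring
  rw [hL] at h
  have hne : p ^ (-((n:ℤ)^2)) * w ^ n ≠ 0 := mul_ne_zero (zpow_ne_zero _ hp0) (pow_ne_zero _ hw)
  apply mul_left_cancel₀ hne
  rw [h, Finset.mul_sum]
  apply Finset.sum_congr rfl
  intro k hk
  have : (p^2) ^ (k*(k-1)/2) = p ^ ((k:ℤ)^2 - k) := by
    rw [← pow_mul, Nat.mul_div_cancel' (Nat.even_mul_pred_self k).two_dvd, ← zpow_natCast]
    congr 1
    rcases k with _ | k
    · simp
    · push_cast; ring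
  rw [this]
  have h3 : p ^ (((k:ℤ) - n)^2).toNat = p ^ (((k:ℤ) - n)^2) := by
    rw [← zpow_natCast, Int.toNat_of_nonneg (sq_nonneg _)]
  rw [h3, mul_pow, ← zpow_natCast (p ^ _) k, ← _root_.zpow_mul, ← zpow_natCast w k, ← zpow_natCast w n]
  have e5 : w ^ (k:ℤ) = w ^ (n:ℤ) * w ^ ((k:ℤ) - n) := by rw [← zpow_add₀ hw]; congr 1; ring
  have e6 : p ^ ((k:ℤ)^2 - k) * p ^ ((1 - 2 * (n:ℤ)) * k) = p ^ (-((n:ℤ)^2)) * p ^ (((k:ℤ) - n)^2) := by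
    rw [← zpow_add₀ hp0, ← zpow_add₀ hp0]; congr 1; ring
  rw [e5]
  linear_combination (qp (p ^ 2) (2 * n) / (qp (p ^ 2) k * qp (p ^ 2) (2 * n - k)) * (w ^ (n:ℤ) * w ^ ((k:ℤ) - n))) * e6

lemma summable_pow_odd {p : ℂ} (hp : ‖p‖ < 1) (w : ℂ) : Summable fun i : ℕ => ‖p ^ (2*i+1) * w‖ := by
  simp_rw [norm_mul, norm_pow]
  apply Summable.mul_right
  have := summable_geometric_of_lt_one (sq_nonneg ‖p‖) (pow_lt_one₀ (norm_nonneg _) hp two_ne_zero)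
  refine (this.mul_right ‖p‖).congr ?_
  intro i; rw [← pow_mul]; ring

lemma summable_theta {p w : ℂ} (hp : ‖p‖ < 1) (hp0 : p ≠ 0) (hw : w ≠ 0) :
    Summable fun j : ℤ => ‖p ^ (j^2).toNat * w ^ j‖ := by
  obtain ⟨τ, hτ⟩ : ∃ τ : ℂ, cexp (π * Complex.I * τ) = p := by
    refine ⟨Complex.log p / (π * Complex.I), ?_⟩
    rw [mul_div_cancel₀ _ (by simp [Real.pi_ne_zero]), Complex.exp_log hp0]
  obtain ⟨z, hz⟩ : ∃ z : ℂ, cexp (2 * π * Complex.I * z) = w := by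
    refine ⟨Complex.log w / (2 * π * Complex.I), ?_⟩
    rw [mul_div_cancel₀ _ (by simp [Real.pi_ne_zero]), Complex.exp_log hw]
  have him : 0 < τ.im := by
    have : ‖p‖ = Real.exp (-π * τ.im) := by
      rw [← hτ, Complex.norm_exp]; simp
    rw [this, Real.exp_lt_one_iff] at hp
    have := Real.pi_pos
    nlinarith
  have := (summable_jacobiTheta₂_term_iff z τ).mpr him
  refine this.norm.congr ?_
  intro j
  congr 1
  rw [jacobiTheta₂_term, ← hτ, ← hz, ← zpow_natCast (cexp _), Int.toNat_of_nonneg (sq_nonneg _), ← Complex.exp_int_mul, ← Complex.exp_int_mul,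
    ← Complex.exp_add]
  congr 1; push_cast; ring

lemma triple_product {p w : ℂ} (hp : ‖p‖ < 1) (hp0 : p ≠ 0) (hw : w ≠ 0) :
    (∏' i : ℕ, (1 - (p^2) ^ (i+1))) * ((∏' i : ℕ, (1 + p ^ (2*i+1) * w)) * (∏' i : ℕ, (1 + p ^ (2*i+1) * w⁻¹))) =
      ∑' j : ℤ, p ^ (j^2).toNat * w ^ j := by
  have hx : ‖p^2‖ < 1 := by
    rw [norm_pow]; exact pow_lt_one₀ (norm_nonneg _) hp (by norm_num)
  set Q := ∏' i : ℕ, (1 - (p^2) ^ (i+1)) with hQ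
  have hlimQ : Tendsto (fun n => qp (p^2) n) atTop (𝓝 Q) :=
    (ModularForm.multipliable_one_sub_pow hx).hasProd.tendsto_prod_nat
  have hQ0 : Q ≠ 0 := by
    have := tprod_one_add_ne_zero_of_summable (f := fun n : ℕ ↦ -(p^2) ^ (n+1)) (fun i => by
      simpa [sub_eq_add_neg] using one_sub_pow_ne hx i) (by
      simpa using (summable_nat_add_iff 1).mpr (summable_geometric_of_lt_one (norm_nonneg _) hx))
    simpa [hQ, sub_eq_add_neg] using this
  have m1 : Multipliable fun i : ℕ => (1 + p ^ (2*i+1) * w) :=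
    multipliable_one_add_of_summable (summable_pow_odd hp w)
  have m2 : Multipliable fun i : ℕ => (1 + p ^ (2*i+1) * w⁻¹) :=
    multipliable_one_add_of_summable (summable_pow_odd hp w⁻¹)
  have hL := m1.hasProd.tendsto_prod_nat.mul m2.hasProd.tendsto_prod_nat
  have hR : Tendsto (fun n : ℕ => ∑ k ∈ Finset.range (2*n+1), qp (p^2) (2*n) / (qp (p^2) k * qp (p^2) (2*n - k)) *
        (p ^ (((k:ℤ) - n)^2).toNat * w ^ ((k:ℤ)-n))) atTop (𝓝 (∑' j : ℤ, Q⁻¹ * (p ^ (j^2).toNat * w ^ j))) := by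
    set F : ℕ → ℤ → ℂ := fun n j => if |j| ≤ n then qp (p^2) (2*n) / (qp (p^2) (n + j).toNat * qp (p^2) (n - j).toNat) *
        (p ^ (j^2).toNat * w ^ j) else 0 with hF
    have hsum : ∀ n : ℕ, ∑ k ∈ Finset.range (2*n+1), qp (p^2) (2*n) / (qp (p^2) k * qp (p^2) (2*n - k)) *
        (p ^ (((k:ℤ) - n)^2).toNat * w ^ ((k:ℤ)-n)) = ∑' j, F n j := by
      intro n
      rw [tsum_eq_sum (s := Finset.Icc (-(n:ℤ)) n)]
      · refine Finset.sum_bij (fun k _ => (k:ℤ) - n) ?_ ?_ ?_ ?_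
        · intro k hk; simp at hk ⊢; omega
        · intro a _ b _ h; simpa using h
        · intro b hb
          simp at hb
          refine ⟨(b + n).toNat, ?_, ?_⟩
          · simp; omega
          · rw [Int.toNat_of_nonneg (by omega)]; ring
        · intro k hk
          simp at hk
          simp only [hF]
          rw [if_pos (by rw [abs_le]; constructor <;> omega)]
          rw [show ((n:ℤ) + (k - n)).toNat = k by omega, show ((n:ℤ) - (k - n)).toNat = 2*n-k by omega]
      · intro b hb
        simp only [hF]
        rw [if_neg]
        rw [abs_le]; simpa using hb
    simp_rw [hsum]
    obtain ⟨C, hC⟩ := (hlimQ.norm.bddAbove_range)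
    have hinv := (hlimQ.inv₀ hQ0)
    obtain ⟨D, hD⟩ := hinv.norm.bddAbove_range
    have hC' : ∀ n, ‖qp (p^2) n‖ ≤ C := fun n => hC ⟨n, rfl⟩
    have hD' : ∀ n, ‖(qp (p^2) n)⁻¹‖ ≤ D := fun n => hD ⟨n, rfl⟩
    have hC0 : 0 ≤ C := (norm_nonneg _).trans (hC' 0)
    have hD0 : 0 ≤ D := (norm_nonneg _).trans (hD' 0)
    apply tendsto_tsum_of_dominated_convergence (bound := fun j : ℤ => C * (D * D) * ‖p ^ (j^2).toNat * w ^ j‖)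
    · exact (summable_theta hp hp0 hw).mul_left _
    · intro j
      have t1 : Tendsto (fun n : ℕ => 2 * n) atTop atTop := tendsto_id.const_mul_atTop' (by norm_num)
      have t2 : Tendsto (fun n : ℕ => ((n:ℤ) + j).toNat) atTop atTop := by
        apply tendsto_atTop_mono (f := fun n : ℕ => n - j.natAbs)
        · intro n; omega
        · exact tendsto_sub_atTop_nat _
      have t3 : Tendsto (fun n : ℕ => ((n:ℤ) - j).toNat) atTop atTop := by
        apply tendsto_atTop_mono (f := fun n : ℕ => n - j.natAbs)
        · intro n; omega
        · exact tendsto_sub_atTop_nat _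
      have := ((hlimQ.comp t1).div ((hlimQ.comp t2).mul (hlimQ.comp t3)) (mul_ne_zero hQ0 hQ0)).mul_const (p ^ (j^2).toNat * w ^ j)
      rw [show Q / (Q * Q) = Q⁻¹ by field_simp] at this
      refine this.congr' ?_
      filter_upwards [eventually_ge_atTop j.natAbs] with n hn
      simp only [hF]
      rw [if_pos (by rw [abs_le]; constructor <;> omega)]
      rfl
    · refine Eventually.of_forall fun n j => ?_
      simp only [hF]
      split_ifs
      · rw [norm_mul]
        apply mul_le_mul_of_nonneg_right _ (norm_nonneg _)
        rw [div_eq_mul_inv, mul_inv, norm_mul, norm_mul]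
        gcongr
        · exact hC' _
        · exact hD' _
        · exact hD' _
      · rw [norm_zero]; positivity
  have heq := tendsto_nhds_unique (hL.congr (fun n => finite_tp hp hp0 hw n)) hR
  rw [heq, tsum_mul_left, mul_inv_cancel_left₀ hQ0]

def QQ (N ρ : ℕ) (ζ : ℂ) (t : ℂ) : ℂ := ∏' n : ℕ, (1 - ζ * t ^ (ρ + N * n))

structure LD (F : ℂ → ℂ) (b : ℕ → ℂ) : Prop where
  diff : DifferentiableOn ℂ F (Metric.ball 0 1)
  ne : ∀ t ∈ Metric.ball (0:ℂ) 1, F t ≠ 0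
  zero : F 0 = 1
  hs : ∀ t ∈ Metric.ball (0:ℂ) 1, HasSum (fun n => b n * t ^ n) (-t * logDeriv F t)

lemma LD.diffAt {F b} (h : LD F b) {t : ℂ} (ht : t ∈ Metric.ball (0:ℂ) 1) : DifferentiableAt ℂ F t :=
  (h.diff t ht).differentiableAt (Metric.isOpen_ball.mem_nhds ht)

lemma LD.one : LD (fun _ => 1) (fun _ => 0) where
  diff := by fun_prop
  ne := by simp
  zero := rfl
  hs := by
    intro t ht
    have : logDeriv (fun _ : ℂ => (1:ℂ)) t = 0 := by simp [logDeriv_apply]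
    simp only [this, mul_zero, zero_mul]
    exact hasSum_zero

lemma LD.mul {F G b c} (hF : LD F b) (hG : LD G c) : LD (fun t => F t * G t) (fun n => b n + c n) where
  diff := hF.diff.mul hG.diff
  ne := fun t ht => mul_ne_zero (hF.ne t ht) (hG.ne t ht)
  zero := by rw [hF.zero, hG.zero, mul_one]
  hs := by
    intro t ht
    rw [logDeriv_mul t (hF.ne t ht) (hG.ne t ht) (hF.diffAt ht) (hG.diffAt ht)]
    have := (hF.hs t ht).add (hG.hs t ht)
    rw [mul_add]
    refine this.congr_fun ?_
    intro n; ring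

lemma LD.zpow {F b} (hF : LD F b) (m : ℤ) : LD (fun t => F t ^ m) (fun n => m * b n) where
  diff := fun t ht => (hF.diff t ht).zpow (Or.inl (hF.ne t ht))
  ne := fun t ht => zpow_ne_zero _ (hF.ne t ht)
  zero := by simp [hF.zero]
  hs := by
    intro t ht
    rw [logDeriv_fun_zpow (hF.diffAt ht)]
    have := (hF.hs t ht).mul_left (m:ℂ)
    rw [mul_left_comm]
    refine this.congr_fun ?_
    intro n; ring

lemma LD.prod {ι : Type*} (s : Finset ι) {F : ι → ℂ → ℂ} {b : ι → ℕ → ℂ} (h : ∀ i ∈ s, LD (F i) (b i)) :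
    LD (fun t => ∏ i ∈ s, F i t) (fun n => ∑ i ∈ s, b i n) := by
  classical
  induction s using Finset.induction_on with
  | empty => simpa using LD.one
  | insert i s hi ih =>
    have := (h i (by simp)).mul (ih fun j hj => h j (by simp [hj]))
    simpa [Finset.prod_insert hi, Finset.sum_insert hi] using this

lemma psum_unique {b b' : ℕ → ℂ} {g : ℂ → ℂ}
    (h : ∀ t ∈ Metric.ball (0:ℂ) 1, HasSum (fun n => b n * t ^ n) (g t))
    (h' : ∀ t ∈ Metric.ball (0:ℂ) 1, HasSum (fun n => b' n * t ^ n) (g t)) : b = b' := by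
  have key : ∀ b : ℕ → ℂ, (∀ t ∈ Metric.ball (0:ℂ) 1, HasSum (fun n => b n * t ^ n) (g t)) →
      HasFPowerSeriesAt g (FormalMultilinearSeries.ofScalars ℂ b) 0 := by
    intro b hb
    rw [hasFPowerSeriesAt_iff]
    filter_upwards [Metric.ball_mem_nhds (0:ℂ) one_pos] with z hz
    simpa [FormalMultilinearSeries.coeff_ofScalars, mul_comm] using hb z hz
  have := (key b h).eq_formalMultilinearSeries (key b' h')
  funext n
  have := congrArg (fun p => FormalMultilinearSeries.coeff p n) this
  simpa [FormalMultilinearSeries.coeff_ofScalars] using this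

lemma LD.congr {F G b} (hF : LD F b) (h : ∀ t ∈ Metric.ball (0:ℂ) 1, F t = G t) : LD G b where
  diff := hF.diff.congr fun t ht => (h t ht).symm
  ne := fun t ht => by rw [← h t ht]; exact hF.ne t ht
  zero := by rw [← h 0 (by simp)]; exact hF.zero
  hs := by
    intro t ht
    have e : F =ᶠ[𝓝 t] G := by
      filter_upwards [Metric.isOpen_ball.mem_nhds ht] with x hx using h x hx
    have : logDeriv F t = logDeriv G t := by
      rw [logDeriv_apply, logDeriv_apply, e.deriv_eq, h t ht]
    rw [← this]; exact hF.hs t ht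

lemma LD.unique {F b b'} (h : LD F b) (h' : LD F b') : b = b' := psum_unique h.hs h'.hs

lemma LD.eq {F G b} (hF : LD F b) (hG : LD G b) : ∀ t ∈ Metric.ball (0:ℂ) 1, F t = G t := by
  set H : ℂ → ℂ := fun t => F t / G t with hH
  have hd : DifferentiableOn ℂ H (Metric.ball 0 1) := hF.diff.div hG.diff hG.ne
  have hdH : ∀ t ∈ Metric.ball (0:ℂ) 1, t ≠ 0 → deriv H t = 0 := by
    intro t ht h0
    have e := (hF.hs t ht).unique (hG.hs t ht)
    have e2 : logDeriv F t = logDeriv G t := mul_left_cancel₀ (neg_ne_zero.mpr h0) e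
    have h3 : logDeriv H t = 0 := by
      rw [hH, logDeriv_div t (hF.ne t ht) (hG.ne t ht) (hF.diffAt ht) (hG.diffAt ht), e2, sub_self]
    rw [logDeriv_apply, div_eq_zero_iff] at h3
    rcases h3 with h3 | h3
    · exact h3
    · exact absurd h3 (div_ne_zero (hF.ne t ht) (hG.ne t ht))
  have h0 : deriv H 0 = 0 := by
    have hc : ContinuousAt (deriv H) 0 :=
      ((hd.deriv Metric.isOpen_ball) 0 (by simp)).differentiableAt (Metric.isOpen_ball.mem_nhds (by simp)) |>.continuousAt
    have t1 : Tendsto (deriv H) (𝓝[≠] 0) (𝓝 (deriv H 0)) := hc.tendsto.mono_left nhdsWithin_le_nhds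
    have t2 : Tendsto (deriv H) (𝓝[≠] 0) (𝓝 0) := by
      refine tendsto_const_nhds.congr' ?_
      filter_upwards [self_mem_nhdsWithin, nhdsWithin_le_nhds (Metric.ball_mem_nhds (0:ℂ) one_pos)] with x hx hx2
      exact (hdH x hx2 hx).symm
    exact tendsto_nhds_unique t1 t2
  have hz : Set.EqOn (deriv H) 0 (Metric.ball 0 1) := by
    intro t ht
    by_cases h : t = 0
    · rw [h]; exact h0
    · exact hdH t ht h
  intro t ht
  have hconst := Metric.isOpen_ball.is_const_of_deriv_eq_zero (convex_ball (0:ℂ) 1).isPreconnected hd hz ht (by simp : (0:ℂ) ∈ Metric.ball (0:ℂ) 1)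
  simp only [hH, hF.zero, hG.zero, div_one] at hconst
  exact (div_eq_one_iff_eq (hG.ne t ht)).mp hconst

lemma LD.exists {F : ℂ → ℂ} (hd : DifferentiableOn ℂ F (Metric.ball 0 1)) (hn : ∀ t ∈ Metric.ball (0:ℂ) 1, F t ≠ 0)
    (h0 : F 0 = 1) : ∃ b, LD F b := by
  have hg : DifferentiableOn ℂ (fun t => -t * logDeriv F t) (Metric.ball 0 1) := by
    have : DifferentiableOn ℂ (logDeriv F) (Metric.ball 0 1) := (hd.deriv Metric.isOpen_ball).div hd hn
    exact differentiableOn_id.neg.mul this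
  refine ⟨fun n => (n.factorial : ℂ)⁻¹ * iteratedDeriv n (fun t => -t * logDeriv F t) 0, hd, hn, h0, fun t ht => ?_⟩
  have := Complex.hasSum_taylorSeries_on_ball hg ht
  refine this.congr_fun (g := fun n => ((n.factorial : ℂ)⁻¹ * iteratedDeriv n (fun t => -t * logDeriv F t) 0) * t ^ n) ?_
  intro n
  simp [smul_eq_mul]; ring

lemma QQ_sum {N ρ : ℕ} (hN : 0 < N) {r : ℝ} (h0 : 0 ≤ r) (hr : r < 1) : Summable fun n : ℕ => r ^ (ρ + N * n) := by
  have hinj : Function.Injective fun n : ℕ => ρ + N * n := by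
    intro a b h; simpa [hN.ne'] using h
  exact (summable_geometric_of_lt_one h0 hr).comp_injective hinj

lemma QQ_mlu {N ρ : ℕ} (hN : 0 < N) {ζ : ℂ} (hζ : ‖ζ‖ ≤ 1) :
    MultipliableLocallyUniformlyOn (fun (n : ℕ) t ↦ 1 - ζ * t ^ (ρ + N * n)) (Metric.ball (0 : ℂ) 1) := by
  use fun t ↦ ∏' n : ℕ, (1 - ζ * t ^ (ρ + N * n))
  simp_rw [sub_eq_add_neg]
  apply hasProdLocallyUniformlyOn_of_forall_compact Metric.isOpen_ball
  intro K hK hcK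
  rcases K.eq_empty_or_nonempty with hN' | hN'
  · simpa [hasProdUniformlyOn_iff_tendstoUniformlyOn, hN'] using tendstoUniformlyOn_empty
  · obtain ⟨q₀, hq₀, _, HB⟩ := hcK.exists_sSup_image_eq_and_ge hN'
      (show ContinuousOn (fun q : ℂ ↦ ‖q‖) K by fun_prop)
    refine (QQ_sum hN (ρ := ρ) (norm_nonneg q₀)
      (by simpa [Metric.mem_ball, dist_zero_right] using hK hq₀)).hasProdUniformlyOn_nat_one_add
      hcK (.of_forall fun n x hx ↦ ?_) (fun _ ↦ by fun_prop)
    rw [norm_neg, norm_mul, norm_pow]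
    calc _ ≤ 1 * ‖q₀‖ ^ (ρ + N * n) := by
          gcongr
          exact HB x hx
      _ = _ := one_mul _

lemma QQ_factor_ne {ζ t : ℂ} (hζ : ‖ζ‖ ≤ 1) (ht : ‖t‖ < 1) {m : ℕ} (hm : 0 < m) : 1 - ζ * t ^ m ≠ 0 := by
  intro h
  have h1 : ‖ζ * t ^ m‖ = 1 := by rw [← sub_eq_zero.mp h, norm_one]
  rw [norm_mul, norm_pow] at h1
  have h3 : ‖t‖ ^ m < 1 := pow_lt_one₀ (norm_nonneg _) ht hm.ne'
  have : ‖ζ‖ * ‖t‖ ^ m ≤ 1 * ‖t‖ ^ m := by gcongr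
  linarith

lemma QQ_mult {N ρ : ℕ} (hN : 0 < N) {ζ t : ℂ} (hζ : ‖ζ‖ ≤ 1) (ht : ‖t‖ < 1) : Multipliable fun n : ℕ => (1 - ζ * t ^ (ρ + N * n)) :=
  (QQ_mlu hN hζ).multipliable (by simpa using ht)

def qcoef (N : ℕ) (ρ : ZMod N) (ζ : ℂ) (k : ℕ) : ℂ :=
  ∑ x ∈ k.divisorsAntidiagonal, if (x.1 : ZMod N) = ρ then (x.1 : ℂ) * ζ ^ x.2 else 0

lemma QQ_LD {N ρ : ℕ} (hρ : 0 < ρ) (hρN : ρ ≤ N) {ζ : ℂ} (hζ : ‖ζ‖ ≤ 1) : LD (QQ N ρ ζ) (qcoef N ρ ζ) := by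
  have hN : 0 < N := by omega
  have hne : ∀ t ∈ Metric.ball (0:ℂ) 1, QQ N ρ ζ t ≠ 0 := by
    intro t ht
    have ht' : ‖t‖ < 1 := by simpa using ht
    have := tprod_one_add_ne_zero_of_summable (f := fun n : ℕ ↦ -(ζ * t ^ (ρ + N * n))) (fun i => by
      simpa [sub_eq_add_neg] using QQ_factor_ne hζ ht' (m := ρ + N * i) (by omega)) (by
        apply Summable.of_nonneg_of_le (fun _ => norm_nonneg _) _ (QQ_sum hN (ρ := ρ) (norm_nonneg t) ht')
        intro n
        rw [norm_neg, norm_mul, norm_pow]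
        exact mul_le_of_le_one_left (by positivity) hζ)
    simpa [QQ, sub_eq_add_neg] using this
  refine ⟨?_, hne, ?_, ?_⟩
  · exact (QQ_mlu hN hζ).hasProdLocallyUniformlyOn.differentiableOn
      (.of_forall fun _ ↦ by simpa [Finset.prod_fn] using
        DifferentiableOn.finsetProd (fun _ _ ↦ by fun_prop)) Metric.isOpen_ball
  · have : ∀ n : ℕ, (1 - ζ * (0:ℂ) ^ (ρ + N * n)) = 1 := by
      intro n; rw [zero_pow (by omega)]; ring
    simp [QQ, this]
  · intro t ht
    have ht' : ‖t‖ < 1 := by simpa using ht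
    set G : ℕ × ℕ → ℂ := fun x => ((ρ + N * x.1 : ℕ) : ℂ) * ζ ^ (x.2+1) * t ^ ((ρ + N * x.1) * (x.2 + 1)) with hG
    have hGs : Summable G := by
      have hinj : Function.Injective fun n : ℕ => ρ + N * n := by
        intro a b h; simpa [hN.ne'] using h
      have s1 : Summable fun n : ℕ => ((ρ + N * n : ℕ) : ℝ) * ‖t‖ ^ (ρ + N * n) := by
        have := summable_pow_mul_geometric_of_norm_lt_one 1 (r := ‖t‖) (by simpa using ht')
        simp only [pow_one] at this
        exact this.comp_injective hinj
      have s2 := summable_geometric_of_lt_one (norm_nonneg t) ht'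
      have s3 := Summable.mul_of_nonneg s1 s2 (fun n => by positivity) (fun n => by positivity)
      apply Summable.of_norm_bounded s3
      rintro ⟨n, j⟩
      simp only [hG]
      rw [norm_mul, norm_mul, norm_pow, norm_pow, Complex.norm_natCast, mul_assoc, mul_assoc]
      apply mul_le_mul_of_nonneg_left _ (by positivity)
      rw [← pow_add]
      calc ‖ζ‖ ^ (j+1) * ‖t‖ ^ ((ρ + N * n) * (j+1)) ≤ 1 * ‖t‖ ^ ((ρ + N * n) * (j+1)) := by
            gcongr
            exact pow_le_one₀ (norm_nonneg _) hζ
        _ ≤ ‖t‖ ^ (ρ + N * n + j) := by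
            rw [one_mul]
            apply pow_le_pow_of_le_one (norm_nonneg _) ht'.le
            have : 1 ≤ ρ + N * n := by omega
            nlinarith
    have hlog : ∀ n : ℕ, logDeriv (fun t : ℂ => 1 - ζ * t ^ (ρ + N * n)) t = -((ρ + N * n : ℕ) : ℂ) * ζ * t ^ (ρ + N * n - 1) / (1 - ζ * t ^ (ρ + N * n)) := by
      intro n
      rw [logDeriv_apply]
      congr 1
      have : HasDerivAt (fun t : ℂ => 1 - ζ * t ^ (ρ + N * n)) (-(ζ * (((ρ + N * n : ℕ) : ℂ) * t ^ (ρ + N * n - 1)))) t := by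
        have := ((hasDerivAt_pow (ρ + N * n) t).const_mul ζ).const_sub 1
        simpa using this
      rw [this.deriv]; ring
    have hinner : ∀ n : ℕ, HasSum (fun j => G (n, j)) (-t * logDeriv (fun t : ℂ => 1 - ζ * t ^ (ρ + N * n)) t) := by
      intro n
      rw [hlog]
      set m := ρ + N * n with hm
      have hm0 : 0 < m := by omega
      have hlt : ‖ζ * t ^ m‖ < 1 := by
        rw [norm_mul, norm_pow]
        have h3 : ‖t‖ ^ m < 1 := pow_lt_one₀ (norm_nonneg _) ht' hm0.ne'
        have : ‖ζ‖ * ‖t‖ ^ m ≤ 1 * ‖t‖ ^ m := by gcongr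
        linarith
      have := (hasSum_geometric_of_norm_lt_one hlt).mul_left ((m:ℂ) * (ζ * t ^ m))
      have e : -t * (-(m:ℂ) * ζ * t ^ (m - 1) / (1 - ζ * t ^ m)) = (m:ℂ) * (ζ * t ^ m) * (1 - ζ * t ^ m)⁻¹ := by
        obtain ⟨i, hi⟩ : ∃ i, m = i + 1 := ⟨m - 1, by omega⟩
        rw [hi, Nat.add_sub_cancel, pow_succ]
        field_simp
      rw [e]
      refine this.congr_fun ?_
      intro j
      simp only [hG, ← hm]
      rw [pow_mul t, mul_pow, pow_succ, pow_succ]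
      ring
    have hsum : HasSum G (-t * logDeriv (QQ N ρ ζ) t) := by
      by_cases t0 : t = 0
      · subst t0
        have : G = fun _ => 0 := by
          funext x
          simp only [hG]
          rw [zero_pow (Nat.mul_ne_zero (by omega) (by omega)), mul_zero]
        rw [this]; simpa using hasSum_zero
      have hs1 : HasSum (fun n : ℕ => -t * logDeriv (fun t : ℂ => 1 - ζ * t ^ (ρ + N * n)) t) (∑' x, G x) :=
        hGs.hasSum.prod_fiberwise hinner
      have hs2 : Summable (fun n : ℕ => logDeriv (fun t : ℂ => 1 - ζ * t ^ (ρ + N * n)) t) := by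
        have := hs1.summable.mul_left (-t)⁻¹
        refine this.congr ?_
        intro n; rw [inv_mul_cancel_left₀ (neg_ne_zero.mpr t0)]
      have := logDeriv_tprod_eq_tsum Metric.isOpen_ball ht (f := fun (n : ℕ) (t : ℂ) ↦ 1 - ζ * t ^ (ρ + N * n))
        (fun i => QQ_factor_ne hζ ht' (by omega)) (fun i => by fun_prop) hs2 (QQ_mlu hN hζ) (hne t ht)
      have e : logDeriv (QQ N ρ ζ) t = ∑' n : ℕ, logDeriv (fun t : ℂ => 1 - ζ * t ^ (ρ + N * n)) t := this
      rw [e, ← tsum_mul_left, hs1.tsum_eq]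
      exact hGs.hasSum
    set G' : ℕ × ℕ → ℂ := fun x => if (x.1 : ZMod N) = (ρ : ZMod N) ∧ 0 < x.1 ∧ 0 < x.2 then (x.1 : ℂ) * ζ ^ x.2 * t ^ (x.1 * x.2) else 0 with hG'
    have hinj : Function.Injective (fun x : ℕ × ℕ => ((ρ + N * x.1, x.2 + 1) : ℕ × ℕ)) := by
      rintro ⟨a, b⟩ ⟨c, d⟩ h
      simp [hN.ne'] at h ⊢
      exact h
    have hsum' : HasSum G' (-t * logDeriv (QQ N ρ ζ) t) := by
      rw [← hinj.hasSum_iff]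
      · refine hsum.congr_fun ?_
        rintro ⟨a, b⟩
        simp only [hG, hG', Function.comp]
        rw [if_pos]
        refine ⟨by simp, by omega, by omega⟩
      · rintro ⟨d, e⟩ hx
        simp only [hG']
        rw [if_neg]
        rintro ⟨h1, h2, h3⟩
        apply hx
        have h4 : d ≡ ρ [MOD N] := (ZMod.natCast_eq_natCast_iff _ _ _).mp h1
        have h5 : ρ ≤ d := by
          by_contra hlt
          push Not at hlt
          have := (Nat.modEq_iff_dvd' hlt.le).mp h4
          have := Nat.le_of_dvd (by omega) this
          omega
        obtain ⟨c, hc⟩ := (Nat.modEq_iff_dvd' h5).mp h4.symm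
        refine ⟨(c, e - 1), ?_⟩
        simp only [Prod.mk.injEq]
        omega
    have hf := hsum'.tsum_fiberwise (fun x : ℕ × ℕ => x.1 * x.2)
    refine hf.congr_fun ?_
    intro k
    rw [qcoef]
    rcases Nat.eq_zero_or_pos k with rfl | hk
    · simp only [Nat.divisorsAntidiagonal_zero, Finset.sum_empty, zero_mul]
      symm
      convert tsum_zero with x
      obtain ⟨⟨d, e⟩, hx⟩ := x
      simp only [hG']
      rw [if_neg]
      rintro ⟨_, h2, h3⟩
      simp at hx
      omega
    · have hset : ((fun x : ℕ × ℕ => x.1 * x.2) ⁻¹' {k}) = (k.divisorsAntidiagonal : Set (ℕ × ℕ)) := by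
        ext x; simp [hk.ne']
      rw [hset, Finset.tsum_subtype' , Finset.sum_mul]
      apply Finset.sum_congr rfl
      rintro ⟨d, e⟩ hx
      obtain ⟨hx1, hx2⟩ := Nat.mem_divisorsAntidiagonal.mp hx
      simp only at hx1
      have hd : 0 < d := Nat.pos_of_ne_zero (by rintro rfl; simp at hx1; omega)
      have he : 0 < e := Nat.pos_of_ne_zero (by rintro rfl; simp at hx1; omega)
      simp only [hG', hd, he, and_true]
      split_ifs
      · rw [hx1]
      · simp

lemma LD.comp_pow {F b} (h : LD F b) {N : ℕ} (hN : 0 < N) :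
    LD (fun t => F (t ^ N)) (fun k => if N ∣ k then (N : ℂ) * b (k / N) else 0) := by
  have hm : ∀ t ∈ Metric.ball (0:ℂ) 1, t ^ N ∈ Metric.ball (0:ℂ) 1 := by
    intro t ht
    have ht' : ‖t‖ < 1 := by simpa using ht
    simpa using pow_lt_one₀ (norm_nonneg _) ht' hN.ne'
  refine ⟨h.diff.comp (by fun_prop) hm, fun t ht => h.ne _ (hm t ht), by simpa [hN.ne'] using h.zero, ?_⟩
  intro t ht
  have e : -t * logDeriv (fun t => F (t ^ N)) t = N * (-(t^N) * logDeriv F (t ^ N)) := by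
    have h1 : HasDerivAt (fun t => F (t ^ N)) (deriv F (t^N) * (N * t ^ (N-1))) t :=
      (h.diffAt (hm t ht)).hasDerivAt.comp t (hasDerivAt_pow N t)
    rw [logDeriv_apply, logDeriv_apply, h1.deriv]
    obtain ⟨i, rfl⟩ : ∃ i, N = i + 1 := ⟨N - 1, by omega⟩
    rw [Nat.add_sub_cancel, pow_succ]
    ring
  rw [e]
  have h2 := (h.hs _ (hm t ht)).mul_left (N:ℂ)
  have hinj : Function.Injective fun n : ℕ => N * n := by
    intro a b h; simpa [hN.ne'] using h
  rw [← hinj.hasSum_iff]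
  · refine h2.congr_fun ?_
    intro n
    simp only [Function.comp]
    rw [if_pos (dvd_mul_right _ _), Nat.mul_div_cancel_left _ hN, pow_mul]
    ring
  · intro x hx
    rw [if_neg, zero_mul]
    rintro ⟨c, rfl⟩
    exact hx ⟨c, rfl⟩

lemma zmod_gcd_unit {N : ℕ} [NeZero N] (m : ℕ) : ∃ u : (ZMod N)ˣ, (m : ZMod N) = u * ((m.gcd N : ℕ) : ZMod N) := by
  obtain ⟨d, hd, u, hu, h⟩ := (m : ZMod N).eq_unit_mul_divisor
  obtain ⟨v, rfl⟩ := hu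
  refine ⟨v, ?_⟩
  have hv : ((v : ZMod N).val).Coprime N := ZMod.val_coe_unit_coprime v
  have h2 : ((m : ℕ) : ZMod N) = (((v : ZMod N).val * d : ℕ) : ZMod N) := by
    rw [h]; push_cast; rw [ZMod.natCast_zmod_val]
  have h3 := ((ZMod.natCast_eq_natCast_iff _ _ _).mp h2).gcd_eq
  rw [Nat.Coprime.gcd_mul_left_cancel _ hv, Nat.gcd_eq_left hd] at h3
  rw [h3]; exact h

lemma sum_divisors_mul_prime {M : Type*} [AddCommMonoid M] (F : ℕ → M) {n p : ℕ} (hn : 0 < n) (hp : p.Prime) (hpn : n < p) :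
    ∑ d ∈ (n * p).divisors, F d = ∑ d ∈ n.divisors, F d + ∑ d ∈ n.divisors, F (d * p) := by
  have hinj : Function.Injective (fun d => d * p) := fun a b h => Nat.eq_of_mul_eq_mul_right hp.pos h
  have : (n * p).divisors = n.divisors ∪ n.divisors.image (fun d => d * p) := by
    ext d
    simp only [Nat.mem_divisors, Finset.mem_union, Finset.mem_image]
    constructor
    · rintro ⟨h, -⟩
      by_cases hpd : p ∣ d
      · obtain ⟨e, rfl⟩ := hpd
        right
        refine ⟨e, ⟨?_, hn.ne'⟩, mul_comm _ _⟩
        rw [mul_comm p] at h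
        exact Nat.dvd_of_mul_dvd_mul_right hp.pos h
      · left
        refine ⟨Nat.Coprime.dvd_of_dvd_mul_right ?_ h, hn.ne'⟩
        exact ((Nat.Prime.coprime_iff_not_dvd hp).mpr hpd).symm
    · rintro (⟨h, _⟩ | ⟨e, ⟨h, _⟩, rfl⟩)
      · exact ⟨h.mul_right _, (Nat.mul_pos hn hp.pos).ne'⟩
      · exact ⟨Nat.mul_dvd_mul_right h _, (Nat.mul_pos hn hp.pos).ne'⟩
  rw [this, Finset.sum_union, Finset.sum_image (fun a _ b _ h => hinj h)]
  rw [Finset.disjoint_left]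
  intro d hd hd'
  obtain ⟨e, he, rfl⟩ := Finset.mem_image.mp hd'
  have h1 := Nat.le_of_dvd hn (Nat.dvd_of_mem_divisors hd)
  have h2 : 0 < e := Nat.pos_of_mem_divisors he
  nlinarith

lemma NT_unit {N : ℕ} [NeZero N] (c : ZMod N → ZMod N → ℂ) (A : ℕ → ℤ)
    (h : ∀ n : ℕ, n > 0 → ∑ d ∈ n.divisors, (d:ℂ) * A d = ∑ d ∈ n.divisors, (d:ℂ) * c d ((n / d : ℕ) : ZMod N))
    (w : (ZMod N)ˣ) {n : ℕ} (hn : 0 < n) :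
    ∑ d ∈ n.divisors, (d:ℂ) * A d = ∑ d ∈ n.divisors, (d:ℂ) * c d (w * ((n / d : ℕ) : ZMod N)) := by
  set b := ∑ d ∈ n.divisors, (d:ℂ) * A d with hb
  set X' := ∑ d ∈ n.divisors, (d:ℂ) * c d (w * ((n / d : ℕ) : ZMod N)) with hX
  set Y := ∑ d ∈ n.divisors, (d:ℂ) * c (d * w) ((n / d : ℕ) : ZMod N) with hY
  have key : ∀ p : ℕ, p.Prime → n < p → (p : ZMod N) = w → ∃ i : ℤ, X' - b = p * (i - Y) := by
    intro p hp hnp hpw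
    have h1 := h (n * p) (Nat.mul_pos hn hp.pos)
    rw [sum_divisors_mul_prime _ hn hp hnp, sum_divisors_mul_prime _ hn hp hnp] at h1
    refine ⟨∑ d ∈ n.divisors, d * A (d * p), ?_⟩
    have e1 : ∑ d ∈ n.divisors, (d:ℂ) * c d ((n * p / d : ℕ) : ZMod N) = X' := by
      apply Finset.sum_congr rfl
      intro d hd
      have := Nat.dvd_of_mem_divisors hd
      rw [Nat.mul_div_right_comm this]; push_cast; rw [hpw, mul_comm (w : ZMod N)]
    have e2 : ∑ d ∈ n.divisors, ((d * p : ℕ):ℂ) * c ((d * p : ℕ)) ((n * p / (d * p) : ℕ) : ZMod N) = p * Y := by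
      rw [hY, Finset.mul_sum]
      apply Finset.sum_congr rfl
      intro d hd
      rw [Nat.mul_div_mul_right _ _ hp.pos]; push_cast; rw [hpw]; ring
    have e3 : ∑ d ∈ n.divisors, ((d * p : ℕ):ℂ) * (A (d * p) : ℂ) = p * ((∑ d ∈ n.divisors, d * A (d * p) : ℤ) : ℂ) := by
      push_cast
      rw [Finset.mul_sum]
      apply Finset.sum_congr rfl
      intro d hd
      ring
    rw [e1, e2, e3] at h1
    linear_combination -h1
  by_contra hne
  set X := X' - b with hXX
  have hX0 : X ≠ 0 := sub_ne_zero.mpr (Ne.symm hne)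
  obtain ⟨k, hk⟩ := exists_nat_gt (2 * ‖X‖)
  obtain ⟨p, hp1, hp2, hp3⟩ := Nat.forall_exists_prime_gt_and_eq_mod (w.isUnit) (n + k)
  obtain ⟨p', hp1', hp2', hp3'⟩ := Nat.forall_exists_prime_gt_and_eq_mod (w.isUnit) (n + k + p)
  obtain ⟨i, hi⟩ := key p hp2 (by omega) hp3
  obtain ⟨i', hi'⟩ := key p' hp2' (by omega) hp3'
  have q0 : (p : ℂ) ≠ 0 := by exact_mod_cast hp2.ne_zero
  have q0' : (p' : ℂ) ≠ 0 := by exact_mod_cast hp2'.ne_zero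
  have hdiff : ((i - i' : ℤ) : ℂ) = X / p - X / p' := by
    rw [hi]
    nth_rewrite 2 [← hi]
    rw [hi']
    field_simp
    push_cast
    ring
  have hb1 : ∀ r : ℕ, k < r → ‖X / r‖ < 1 / 2 := by
    intro r hr
    have hr0 : (0:ℝ) < r := by exact_mod_cast (by omega : 0 < r)
    rw [norm_div, Complex.norm_natCast, div_lt_iff₀ hr0]
    have : (k:ℝ) < r := by exact_mod_cast hr
    linarith
  have hlt : ‖((i - i' : ℤ) : ℂ)‖ < 1 := by
    rw [hdiff]
    refine (norm_sub_le _ _).trans_lt ?_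
    have := hb1 p (by omega)
    have := hb1 p' (by omega)
    linarith
  rw [Complex.norm_intCast] at hlt
  have hz : i - i' = 0 := by
    rw [← Int.abs_lt_one_iff]; exact_mod_cast hlt
  rw [hz] at hdiff
  have : X / p = X / p' := by
    rw [← sub_eq_zero, ← hdiff]; simp
  rw [div_eq_div_iff q0 q0'] at this
  have := mul_left_cancel₀ hX0 this
  have : p' = p := by exact_mod_cast this
  omega

lemma div_sum_unique {A A' : ℕ → ℂ} (h : ∀ n : ℕ, n > 0 → ∑ d ∈ n.divisors, (d:ℂ) * A d = ∑ d ∈ n.divisors, (d:ℂ) * A' d) :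
    ∀ n : ℕ, n > 0 → A n = A' n := by
  intro n
  induction n using Nat.strong_induction_on with
  | _ n ih =>
    intro hn
    have h1 := h n hn
    rw [← Nat.insert_self_properDivisors hn.ne', Finset.sum_insert Nat.self_notMem_properDivisors, Finset.sum_insert Nat.self_notMem_properDivisors] at h1
    have : ∑ d ∈ n.properDivisors, (d:ℂ) * A d = ∑ d ∈ n.properDivisors, (d:ℂ) * A' d := by
      apply Finset.sum_congr rfl
      intro d hd
      rw [ih d (Nat.mem_properDivisors.mp hd).2 (Nat.pos_of_mem_properDivisors hd)]
    rw [this] at h1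
    have hn' : (n:ℂ) ≠ 0 := by exact_mod_cast hn.ne'
    exact mul_left_cancel₀ hn' (add_right_cancel h1)

lemma NT_main {N : ℕ} [NeZero N] (c : ZMod N → ZMod N → ℂ) (A : ℕ → ℤ)
    (h : ∀ n : ℕ, n > 0 → ∑ d ∈ n.divisors, (d:ℂ) * A d = ∑ d ∈ n.divisors, (d:ℂ) * c d ((n / d : ℕ) : ZMod N))
    (hev : ∀ d e, c (-d) (-e) = c d e) (hz : ∑ e, c 0 e = 0) :
    (∀ n : ℕ, n > 0 → ∀ n' : ℕ, n' > 0 → N ^ 2 ∣ n + n' → A n = A n') ∧ (∀ n : ℕ, n > 0 → N ^ 2 ∣ n → A n = 0) := by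
  have hN : 0 < N := Nat.pos_of_ne_zero (NeZero.ne N)
  set K : ℂ := (Fintype.card (ZMod N)ˣ : ℂ) with hK
  have hK0 : K ≠ 0 := by
    rw [hK]; exact_mod_cast Fintype.card_ne_zero
  set C : ZMod N → ZMod N → ℂ := fun d e => K⁻¹ * ∑ w : (ZMod N)ˣ, c d (w * e) with hC
  have hCu : ∀ d e (u : (ZMod N)ˣ), C d (u * e) = C d e := by
    intro d e u
    simp only [hC]
    congr 1
    rw [← Equiv.sum_comp (Equiv.mulRight u) (fun w : (ZMod N)ˣ => c d (w * e))]
    apply Finset.sum_congr rfl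
    intro w _
    simp [mul_assoc]
  have hCev : ∀ d e, C (-d) e = C d e := by
    intro d e
    rw [← hCu d e (-1)]
    simp only [hC]
    congr 1
    apply Finset.sum_congr rfl
    intro w _
    rw [← hev d]
    simp
  have hCz : ∑ e, C 0 e = 0 := by
    simp only [hC]
    rw [← Finset.mul_sum, Finset.sum_comm]
    have : ∀ w : (ZMod N)ˣ, ∑ e, c 0 (w * e) = 0 := by
      intro w
      rw [← hz, ← Equiv.sum_comp w.mulLeft (fun e => c 0 e)]
      rfl
    simp [this]
  have hCgcd : ∀ d (m : ℕ), C d (m : ZMod N) = C d ((m.gcd N : ℕ) : ZMod N) := by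
    intro d m
    obtain ⟨u, hu⟩ := zmod_gcd_unit (N := N) m
    rw [hu, hCu]
  have hb : ∀ n : ℕ, n > 0 → ∑ d ∈ n.divisors, (d:ℂ) * A d = ∑ d ∈ n.divisors, (d:ℂ) * C d ((n / d : ℕ) : ZMod N) := by
    intro n hn
    have h1 : ∑ w : (ZMod N)ˣ, ∑ d ∈ n.divisors, (d:ℂ) * A d = ∑ w : (ZMod N)ˣ, ∑ d ∈ n.divisors, (d:ℂ) * c d (w * ((n / d : ℕ) : ZMod N)) :=
      Finset.sum_congr rfl fun w _ => NT_unit c A h w hn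
    rw [Finset.sum_const, Finset.card_univ, nsmul_eq_mul, ← hK] at h1
    rw [← inv_mul_cancel_left₀ hK0 (∑ d ∈ n.divisors, (d:ℂ) * A d), h1, Finset.sum_comm, Finset.mul_sum]
    apply Finset.sum_congr rfl
    intro d _
    simp only [hC, Finset.mul_sum]
    apply Finset.sum_congr rfl
    intro w _
    ring
  set g : ZMod N → ℕ → ℂ := fun d n => ∑ x ∈ n.divisorsAntidiagonal, (ArithmeticFunction.moebius x.1 : ℂ) * C d (x.2 : ZMod N) with hg
  have hgs : ∀ d, ∀ n : ℕ, n > 0 → ∑ i ∈ n.divisors, g d i = C d (n : ZMod N) := by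
    intro d
    exact (ArithmeticFunction.sum_eq_iff_sum_mul_moebius_eq (f := g d) (g := fun n => C d (n : ZMod N))).mpr (fun n hn => rfl)
  have hgev : ∀ d n, g (-d) n = g d n := by
    intro d n; simp only [hg, hCev]
  have hgs2 : ∀ d, ∀ n : ℕ, n > 0 → C d (n : ZMod N) = ∑ k ∈ N.divisors, if k ∣ n then g d k else 0 := by
    intro d n hn
    rw [hCgcd, ← hgs d _ (Nat.gcd_pos_of_pos_left _ hn), ← Finset.sum_filter]
    apply Finset.sum_congr _ (fun _ _ => rfl)
    ext k
    simp only [Nat.mem_divisors, Finset.mem_filter, Nat.dvd_gcd_iff]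
    constructor
    · rintro ⟨⟨h1, h2⟩, _⟩; exact ⟨⟨h2, hN.ne'⟩, h1⟩
    · rintro ⟨⟨h2, _⟩, h1⟩; exact ⟨⟨h1, h2⟩, (Nat.gcd_pos_of_pos_left _ hn).ne'⟩
  set A' : ℕ → ℂ := fun m => ∑ k ∈ N.divisors, if k ∣ m then g ((m / k : ℕ) : ZMod N) k / k else 0 with hA'
  have hAA : ∀ n : ℕ, n > 0 → (A n : ℂ) = A' n := by
    apply div_sum_unique (A := fun n => (A n : ℂ))
    intro n hn
    rw [hb n hn]
    have e1 : ∑ d ∈ n.divisors, (d:ℂ) * C d ((n / d : ℕ) : ZMod N) = ∑ k ∈ N.divisors, ∑ d ∈ n.divisors, if k ∣ n / d then (d:ℂ) * g d k else 0 := by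
      rw [Finset.sum_comm]
      apply Finset.sum_congr rfl
      intro d hd
      rw [hgs2 _ _ (Nat.div_pos (Nat.divisor_le hd) (Nat.pos_of_mem_divisors hd)), Finset.mul_sum]
      apply Finset.sum_congr rfl
      intro k _
      split_ifs <;> simp
    have e2 : ∑ d ∈ n.divisors, (d:ℂ) * A' d = ∑ k ∈ N.divisors, ∑ d ∈ n.divisors, if k ∣ d then (d:ℂ) * (g ((d / k : ℕ) : ZMod N) k / k) else 0 := by
      rw [Finset.sum_comm]
      apply Finset.sum_congr rfl
      intro d hd
      simp only [hA', Finset.mul_sum]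
      apply Finset.sum_congr rfl
      intro k _
      split_ifs <;> simp
    rw [e1, e2]
    apply Finset.sum_congr rfl
    intro k hk
    have hk0 := Nat.pos_of_mem_divisors hk
    rw [← Finset.sum_filter, ← Finset.sum_filter]
    apply Finset.sum_bij (fun d _ => d * k)
    · intro d hd
      simp only [Finset.mem_filter, Nat.mem_divisors] at hd ⊢
      obtain ⟨⟨⟨e, rfl⟩, h2⟩, h3⟩ := hd
      have hd0 : 0 < d := by
        rcases Nat.eq_zero_or_pos d with rfl | h
        · simp at hn
        · exact h
      rw [Nat.mul_div_cancel_left _ hd0] at h3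
      exact ⟨⟨Nat.mul_dvd_mul_left _ h3, h2⟩, dvd_mul_left _ _⟩
    · intro a _ b _ hab
      exact Nat.eq_of_mul_eq_mul_right hk0 hab
    · intro d hd
      simp only [Finset.mem_filter, Nat.mem_divisors] at hd
      obtain ⟨⟨h1, h2⟩, ⟨e, rfl⟩⟩ := hd
      refine ⟨e, ?_, mul_comm _ _⟩
      simp only [Finset.mem_filter, Nat.mem_divisors]
      obtain ⟨f, rfl⟩ := h1
      have he0 : 0 < e := by
        rcases Nat.eq_zero_or_pos e with rfl | h
        · simp at hn
        · exact h
      refine ⟨⟨⟨k * f, by ring⟩, h2⟩, ?_⟩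
      rw [show k * e * f = e * (k * f) by ring, Nat.mul_div_cancel_left _ he0]
      exact dvd_mul_right _ _
    · intro d hd
      rw [Nat.mul_div_cancel _ hk0]
      have : (k:ℂ) ≠ 0 := by exact_mod_cast hk0.ne'
      push_cast
      field_simp
  constructor
  · intro n hn n' hn' hd
    have : (A n : ℂ) = A n' := by
      rw [hAA n hn, hAA n' hn']
      simp only [hA']
      apply Finset.sum_congr rfl
      intro k hk
      have hkN := Nat.dvd_of_mem_divisors hk
      have hk0 := Nat.pos_of_mem_divisors hk
      have hks : k ∣ n + n' := (hkN.trans (dvd_pow_self N two_ne_zero)).trans hd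
      by_cases h1 : k ∣ n
      · have h2 : k ∣ n' := (Nat.dvd_add_right h1).mp hks
        rw [if_pos h1, if_pos h2]
        congr 1
        rw [← hgev]
        congr 1
        obtain ⟨a, rfl⟩ := h1
        obtain ⟨a', rfl⟩ := h2
        rw [Nat.mul_div_cancel_left _ hk0, Nat.mul_div_cancel_left _ hk0]
        have h3 : N ∣ a + a' := by
          have : k * N ∣ k * (a + a') := by
            rw [mul_add]
            refine dvd_trans ?_ hd
            rw [pow_two]; exact Nat.mul_dvd_mul_right hkN _
          exact Nat.dvd_of_mul_dvd_mul_left hk0 this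
        have h4 : ((a + a' : ℕ) : ZMod N) = 0 := (ZMod.natCast_eq_zero_iff _ _).mpr h3
        push_cast at h4
        exact neg_eq_of_add_eq_zero_right h4
      · have h2 : ¬ k ∣ n' := fun h2 => h1 ((Nat.dvd_add_left h2).mp hks)
        rw [if_neg h1, if_neg h2]
    exact_mod_cast this
  · intro n hn hd
    have h0 : ∑ k ∈ N.divisors, g 0 k / k = 0 := by
      have e : ∑ e, C 0 e = N * ∑ k ∈ N.divisors, g 0 k / k := by
        have : ∑ e, C 0 e = ∑ i ∈ Finset.range N, C 0 ((i + 1 : ℕ) : ZMod N) := by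
          rw [← Equiv.sum_comp (Equiv.addRight (1 : ZMod N))]
          refine (Finset.sum_nbij' (fun i : ℕ => (i : ZMod N)) (fun e => e.val) ?_ ?_ ?_ ?_ ?_).symm
          · simp
          · intro e _; simpa using ZMod.val_lt e
          · intro i hi; exact ZMod.val_natCast_of_lt (by simpa using hi)
          · intro e _; exact ZMod.natCast_zmod_val e
          · intro i _; simp
        rw [this]
        have : ∀ i ∈ Finset.range N, C 0 ((i + 1 : ℕ) : ZMod N) = ∑ k ∈ N.divisors, if k ∣ i + 1 then g 0 k else 0 :=
          fun i _ => hgs2 0 (i+1) (by omega)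
        rw [Finset.sum_congr rfl this, Finset.sum_comm, Finset.mul_sum]
        apply Finset.sum_congr rfl
        intro k hk
        have hkN := Nat.dvd_of_mem_divisors hk
        have hk0 := Nat.pos_of_mem_divisors hk
        rw [← Finset.sum_filter, Finset.sum_const, Nat.card_multiples, nsmul_eq_mul, Nat.cast_div hkN (by exact_mod_cast hk0.ne')]
        ring
      rw [hCz] at e
      have hN' : (N:ℂ) ≠ 0 := by exact_mod_cast hN.ne'
      exact (mul_eq_zero.mp e.symm).resolve_left hN'
    have : (A n : ℂ) = 0 := by
      rw [hAA n hn, ← h0]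
      simp only [hA']
      apply Finset.sum_congr rfl
      intro k hk
      have hkN := Nat.dvd_of_mem_divisors hk
      have hk0 := Nat.pos_of_mem_divisors hk
      have hkn : k ∣ n := (hkN.trans (dvd_pow_self N two_ne_zero)).trans hd
      rw [if_pos hkn]
      congr 2
      obtain ⟨a, rfl⟩ := hkn
      rw [Nat.mul_div_cancel_left _ hk0]
      refine (ZMod.natCast_eq_zero_iff _ _).mpr ?_
      have : k * N ∣ k * a := by
        refine dvd_trans ?_ hd
        rw [pow_two]; exact Nat.mul_dvd_mul_right hkN _
      exact Nat.dvd_of_mul_dvd_mul_left hk0 this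
    exact_mod_cast this

def beta (N : ℕ) (x : ZMod N) : ℚ := ((x.val : ℚ) / N) ^ 2 - (x.val : ℚ) / N + 1 / 6

def dotp {N : ℕ} (a v : ZMod N × ZMod N) : ZMod N := a.1 * v.1 + a.2 * v.2

def cosN (N : ℕ) [NeZero N] (x : ZMod N) : ℝ := (ZMod.stdAddChar x : ℂ).re

lemma stdAC_norm {N : ℕ} [NeZero N] (x : ZMod N) : ‖(ZMod.stdAddChar x : ℂ)‖ = 1 := by
  rw [ZMod.stdAddChar_apply]; exact Circle.norm_coe _

lemma stdAC_neg {N : ℕ} [NeZero N] (x : ZMod N) : (ZMod.stdAddChar (-x) : ℂ) = (starRingEnd ℂ) (ZMod.stdAddChar x) := by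
  rw [AddChar.map_neg_eq_inv, Complex.inv_def, Complex.normSq_eq_norm_sq, stdAC_norm]
  simp

lemma cosN_mul {N : ℕ} [NeZero N] (x y : ZMod N) : cosN N x * cosN N y = (cosN N (x - y) + cosN N (x + y)) / 2 := by
  simp only [cosN]
  rw [sub_eq_add_neg, AddChar.map_add_eq_mul, AddChar.map_add_eq_mul, stdAC_neg]
  simp

lemma cosN_abs {N : ℕ} [NeZero N] (x : ZMod N) : |cosN N x| ≤ 1 := by
  rw [← stdAC_norm x]; exact Complex.abs_re_le_norm _

lemma cosN_nat {N : ℕ} [NeZero N] (n : ℕ) (x : ZMod N) : cosN N (n * x) = Real.cos (2 * π * n * (x.val / N)) := by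
  have : ((n : ZMod N) * x) = ((n * x.val : ℤ) : ZMod N) := by push_cast; rw [ZMod.natCast_zmod_val]
  rw [cosN, this, ZMod.stdAddChar_coe, ← Complex.exp_ofReal_mul_I_re]
  congr 2
  push_cast
  ring

lemma cosN_sum {N : ℕ} [NeZero N] (w : ZMod N × ZMod N) : ∑ a : ZMod N × ZMod N, cosN N (dotp a w) = if w = 0 then (N:ℝ)^2 else 0 := by
  have h : ∑ a : ZMod N × ZMod N, (ZMod.stdAddChar (dotp a w) : ℂ) = if w = 0 then (N:ℂ)^2 else 0 := by
    simp only [dotp, AddChar.map_add_eq_mul]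
    rw [Fintype.sum_prod_type]
    simp only []
    rw [← Fintype.sum_mul_sum (fun i : ZMod N => (ZMod.stdAddChar (i * w.1) : ℂ)) (fun j : ZMod N => (ZMod.stdAddChar (j * w.2) : ℂ))]
    rw [AddChar.sum_mulShift _ (ZMod.isPrimitive_stdAddChar N), AddChar.sum_mulShift _ (ZMod.isPrimitive_stdAddChar N)]
    simp only [Prod.ext_iff, ZMod.card, Prod.fst_zero, Prod.snd_zero]
    split_ifs <;> simp_all
    ring
  have := congrArg Complex.re h
  rw [Complex.re_sum] at this
  simp only [cosN]
  rw [this]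
  split_ifs
  · norm_cast
  · simp

lemma beta_hasSum {N : ℕ} [NeZero N] (x : ZMod N) :
    HasSum (fun n : ℕ => 1 / (n : ℝ) ^ 2 * cosN N (n * x)) (π ^ 2 * (beta N x : ℝ)) := by
  have hN : (0:ℝ) < N := by exact_mod_cast Nat.pos_of_ne_zero (NeZero.ne N)
  have hx : (x.val / N : ℝ) ∈ Set.Icc (0:ℝ) 1 := by
    constructor
    · positivity
    · rw [div_le_one hN]; exact_mod_cast (ZMod.val_lt x).le
  have := hasSum_one_div_nat_pow_mul_cos (k := 1) one_ne_zero hx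
  have e : (-1 : ℝ) ^ (1 + 1) * (2 * π) ^ (2 * 1) / 2 / (2 * 1).factorial *
        (Polynomial.map (algebraMap ℚ ℝ) (Polynomial.bernoulli (2 * 1))).eval (x.val / N : ℝ) = π ^ 2 * (beta N x : ℝ) := by
    have h2 := bernoulliFun_two (x.val / N : ℝ)
    rw [bernoulliFun] at h2
    rw [mul_one, h2, beta]
    have h3 : ((2 : ℕ).factorial : ℝ) = 2 := by norm_num [Nat.factorial]
    rw [h3]
    push_cast
    ring
  rw [e] at this
  refine this.congr_fun ?_
  intro n
  rw [cosN_nat]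

lemma dotp_neg {N : ℕ} (a v : ZMod N × ZMod N) : dotp a (-v) = - dotp a v := by simp [dotp]; ring

lemma LA_core {N : ℕ} [NeZero N] (ψ : ZMod N × ZMod N → ℝ) (h : ∀ a, ∑ v, ψ v * (beta N (dotp a v) : ℝ) = 0) :
    ∀ v, ψ v + ψ (-v) = 0 := by
  set H : ZMod N × ZMod N → ℝ := fun a => ∑ v, ψ v * cosN N (dotp a v) with hH
  have hs : ∀ a : ZMod N × ZMod N, HasSum (fun n : ℕ => 1 / (n : ℝ) ^ 2 * H ((n : ZMod N) * a.1, (n : ZMod N) * a.2)) 0 := by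
    intro a
    have h1 : HasSum (fun n : ℕ => ∑ v, ψ v * (1 / (n : ℝ) ^ 2 * cosN N (n * dotp a v))) (∑ v, ψ v * (π ^ 2 * (beta N (dotp a v) : ℝ))) :=
      hasSum_sum fun v _ => (beta_hasSum _).mul_left _
    have h2 : (∑ v, ψ v * (π ^ 2 * (beta N (dotp a v) : ℝ))) = 0 := by
      have := congrArg (fun x => π ^ 2 * x) (h a)
      simp only [Finset.mul_sum, mul_zero] at this
      rw [← this]
      apply Finset.sum_congr rfl; intros; ring
    rw [h2] at h1
    refine h1.congr_fun ?_
    intro n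
    simp only [hH, Finset.mul_sum]
    apply Finset.sum_congr rfl
    intro v _
    have : dotp ((n : ZMod N) * a.1, (n : ZMod N) * a.2) v = n * dotp a v := by simp [dotp]; ring
    rw [this]; ring
  have hH0 : ∀ a, H a = 0 := by
    obtain ⟨a0, ha0⟩ := Finite.exists_max (fun a => |H a|)
    have hz := hasSum_zeta_two
    have h1 := hs a0
    rw [← hasSum_nat_add_iff' 2] at h1 hz
    simp [Finset.sum_range_succ] at h1 hz
    have h2 := hz.mul_left |H a0|
    have h3 : |-H a0| ≤ |H a0| * (π ^ 2 / 6 - 1) := by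
      refine h1.norm_le_of_bounded h2 ?_
      intro n
      rw [norm_mul, mul_comm, Real.norm_eq_abs, Real.norm_eq_abs, abs_of_nonneg (a := (((n:ℝ) + 2) ^ 2)⁻¹) (by positivity)]
      exact mul_le_mul_of_nonneg_right (ha0 _) (by positivity)
    rw [abs_neg] at h3
    have hpi : π ^ 2 / 6 - 1 < 1 := by
      have := Real.pi_lt_d2
      have := Real.pi_pos
      nlinarith
    have h4 : |H a0| ≤ 0 := by
      have := abs_nonneg (H a0)
      nlinarith
    intro a
    exact abs_nonpos_iff.mp ((ha0 a).trans h4)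
  intro v0
  have h1 : ∑ a, H a * cosN N (dotp a v0) = (N:ℝ)^2 / 2 * (ψ v0 + ψ (-v0)) := by
    have : ∀ a, H a * cosN N (dotp a v0) = ∑ v, ψ v * ((cosN N (dotp a (v - v0)) + cosN N (dotp a (v + v0))) / 2) := by
      intro a
      simp only [hH, Finset.sum_mul]
      apply Finset.sum_congr rfl
      intro v _
      have e1 : dotp a (v - v0) = dotp a v - dotp a v0 := by simp [dotp]; ring
      have e2 : dotp a (v + v0) = dotp a v + dotp a v0 := by simp [dotp]; ring
      rw [mul_assoc, cosN_mul, e1, e2]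
    rw [Finset.sum_congr rfl fun a _ => this a, Finset.sum_comm]
    have : ∀ v, ∑ a, ψ v * ((cosN N (dotp a (v - v0)) + cosN N (dotp a (v + v0))) / 2) = (N:ℝ)^2/2 * ((if v = v0 then ψ v else 0) + (if v = -v0 then ψ v else 0)) := by
      intro v
      rw [← Finset.mul_sum, ← Finset.sum_div, Finset.sum_add_distrib, cosN_sum, cosN_sum]
      simp only [sub_eq_zero, add_eq_zero_iff_eq_neg]
      split_ifs <;> ring
    rw [Finset.sum_congr rfl fun a _ => this a, ← Finset.mul_sum, Finset.sum_add_distrib]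
    simp
  simp only [hH0, zero_mul, Finset.sum_const_zero] at h1
  have hN : (N:ℝ)^2 / 2 ≠ 0 := by
    have : (N:ℝ) ≠ 0 := by exact_mod_cast NeZero.ne N
    positivity
  exact (mul_eq_zero.mp h1.symm).resolve_left hN

lemma LA {N : ℕ} [NeZero N] (φ : ZMod N × ZMod N → ℚ) (hφ : ∀ v, φ (-v) = φ v) :
    ∃ m : ZMod N × ZMod N → ℚ, ∀ v, φ v = ∑ a, m a * beta N (dotp a v) := by
  classical
  have hmem : φ ∈ Submodule.span ℚ (Set.range fun (a : ZMod N × ZMod N) => (fun v => beta N (dotp a v) : ZMod N × ZMod N → ℚ)) := by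
    by_contra hnot
    obtain ⟨f, hf, hker⟩ := Submodule.exists_le_ker_of_notMem hnot
    set ψ : ZMod N × ZMod N → ℚ := fun v => f (Pi.single v 1) with hψ
    have hf' : ∀ g, f g = ∑ v, ψ v * g v := by
      intro g
      rw [LinearMap.pi_apply_eq_sum_univ f g]
      apply Finset.sum_congr rfl
      intro v _
      rw [smul_eq_mul, mul_comm]
      congr 2
      funext w
      simp [Pi.single_apply, eq_comm]
    have h1 := LA_core (fun v => (ψ v : ℝ)) (by
      intro a
      have := hker (Submodule.subset_span ⟨a, rfl⟩)
      rw [LinearMap.mem_ker, hf'] at this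
      exact_mod_cast this)
    apply hf
    rw [hf']
    have h2 : ∑ v, ψ v * φ v = ∑ v, ψ (-v) * φ v := by
      rw [← Equiv.sum_comp (Equiv.neg _)]
      simp [hφ]
    have h3 : ∑ v, ψ v * φ v + ∑ v, ψ (-v) * φ v = 0 := by
      rw [← Finset.sum_add_distrib]
      apply Finset.sum_eq_zero
      intro v _
      have : ψ v + ψ (-v) = 0 := by exact_mod_cast h1 v
      rw [← add_mul, this, zero_mul]
    rw [← h2] at h3
    linarith
  obtain ⟨m, hm⟩ := (Submodule.mem_span_range_iff_exists_fun ℚ).mp hmem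
  refine ⟨m, fun v => ?_⟩
  rw [← hm]
  simp

def FLD (P b : PowerSeries ℤ) : Prop :=
  PowerSeries.constantCoeff P = 1 ∧ PowerSeries.X * PowerSeries.derivative ℤ P = - b * P

def DDn (n : ℕ) : PowerSeries ℤ := PowerSeries.mk fun m => if n ∣ m ∧ 0 < m then (n:ℤ) else 0

lemma FLD.one : FLD 1 0 := by
  refine ⟨by simp, ?_⟩
  rw [show (1 : PowerSeries ℤ) = ((1:ℕ) : PowerSeries ℤ) by simp, Derivation.map_natCast]
  simp

lemma FLD.mul {P Q b c} (h : FLD P b) (h' : FLD Q c) : FLD (P * Q) (b + c) := by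
  refine ⟨by rw [map_mul, h.1, h'.1, mul_one], ?_⟩
  rw [Derivation.leibniz, smul_eq_mul, smul_eq_mul]
  linear_combination Q * h.2 + P * h'.2

lemma FLD.inv {P b} (h : FLD P b) : ∃ R, FLD R (-b) := by
  have hu : IsUnit P := by rw [PowerSeries.isUnit_iff_constantCoeff, h.1]; exact isUnit_one
  obtain ⟨R, hR⟩ := hu.exists_right_inv
  have h0 : PowerSeries.constantCoeff R = 1 := by
    have := congrArg PowerSeries.constantCoeff hR
    rwa [map_mul, h.1, one_mul, map_one] at this
  refine ⟨R, h0, ?_⟩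
  have h1 := congrArg (PowerSeries.derivative ℤ) hR
  have e1 : PowerSeries.derivative ℤ (1 : PowerSeries ℤ) = 0 := by
    rw [show (1 : PowerSeries ℤ) = ((1:ℕ) : PowerSeries ℤ) by simp, Derivation.map_natCast]
  rw [Derivation.leibniz, smul_eq_mul, smul_eq_mul, e1] at h1
  apply hu.mul_left_cancel
  linear_combination PowerSeries.X * h1 - R * h.2

lemma FLD.pow {P b} (h : FLD P b) (n : ℕ) : FLD (P ^ n) (n • b) := by
  induction n with
  | zero => simpa using FLD.one
  | succ n ih => rw [pow_succ, succ_nsmul]; exact ih.mul h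

lemma FLD.zsmul {P b} (h : FLD P b) (a : ℤ) : ∃ R, FLD R (a • b) := by
  obtain ⟨n, rfl | rfl⟩ := a.eq_nat_or_neg
  · exact ⟨_, by simpa using h.pow n⟩
  · obtain ⟨R, hR⟩ := h.inv
    exact ⟨_, by simpa using hR.pow n⟩

lemma FLD.base {n : ℕ} (hn : 0 < n) : FLD (1 - PowerSeries.X ^ n) (DDn n) := by
  refine ⟨by simp [hn.ne'], ?_⟩
  have e1 : PowerSeries.derivative ℤ (1 : PowerSeries ℤ) = 0 := by
    rw [show (1 : PowerSeries ℤ) = ((1:ℕ) : PowerSeries ℤ) by simp, Derivation.map_natCast]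
  have e2 : DDn n * (1 - PowerSeries.X ^ n) = (n : PowerSeries ℤ) * PowerSeries.X ^ n := by
    ext m
    rw [mul_sub, mul_one, map_sub, PowerSeries.coeff_mul_X_pow', ← nsmul_eq_mul, map_nsmul, PowerSeries.coeff_X_pow]
    simp only [DDn, PowerSeries.coeff_mk]
    by_cases hm : n ≤ m
    · rw [if_pos hm]
      obtain ⟨k, rfl⟩ : ∃ k, m = n + k := ⟨m - n, by omega⟩
      simp only [Nat.add_sub_cancel_left]
      rcases Nat.eq_zero_or_pos k with rfl | hk
      · simp [hn]
      · have h1 : (n ∣ n + k) ↔ n ∣ k := (Nat.dvd_add_right (dvd_refl n))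
        simp only [h1, hk, and_true]
        rw [if_neg (by omega : ¬ n + k = n)]
        by_cases h : n ∣ k <;> simp [h, hn, hk]
    · rw [if_neg hm, if_neg, if_neg (by omega)]
      · simp
      · rintro ⟨h1, h2⟩
        exact hm (Nat.le_of_dvd h2 h1)
  rw [map_sub, e1, PowerSeries.derivative_pow, neg_mul, e2, PowerSeries.derivative_X]
  obtain ⟨k, rfl⟩ : ∃ k, n = k + 1 := ⟨n - 1, by omega⟩
  rw [Nat.add_sub_cancel, pow_succ]
  ring

lemma FLD.dvd {P b} (h : FLD P b) {n : ℕ} (hb : ∀ j ≤ n, PowerSeries.coeff j b = 0) :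
    ((n + 1 : ℕ) : ℤ) ∣ PowerSeries.coeff (n + 1) b := by
  have h1 := congrArg (PowerSeries.coeff (n+1)) h.2
  rw [PowerSeries.coeff_succ_X_mul, PowerSeries.coeff_derivative, PowerSeries.coeff_mul, Finset.sum_eq_single (n+1, 0)] at h1
  · have h2 : PowerSeries.coeff 0 P = 1 := by rw [PowerSeries.coeff_zero_eq_constantCoeff]; exact h.1
    rw [h2] at h1
    refine ⟨- PowerSeries.coeff (n+1) P, ?_⟩
    push_cast
    simp only [map_neg, mul_one] at h1
    linear_combination h1
  · rintro ⟨i, j⟩ hij hne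
    have := Finset.HasAntidiagonal.mem_antidiagonal.mp hij
    simp only at this
    rw [map_neg, hb i (by
      by_contra hc
      apply hne
      rw [Prod.mk.injEq]; omega)]
    simp
  · simp

lemma int_exp {c : PowerSeries ℤ} {b : PowerSeries ℤ} (h : FLD c b) :
    ∃ a : ℕ → ℤ, ∀ n : ℕ, 0 < n → PowerSeries.coeff n b = ∑ d ∈ n.divisors, (d:ℤ) * a d := by
  set e : ℕ → ℤ := fun n => ∑ x ∈ n.divisorsAntidiagonal, (ArithmeticFunction.moebius x.1 : ℤ) * PowerSeries.coeff x.2 b with he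
  have hes : ∀ n : ℕ, n > 0 → ∑ i ∈ n.divisors, e i = PowerSeries.coeff n b :=
    (ArithmeticFunction.sum_eq_iff_sum_mul_moebius_eq (f := e) (g := fun n => PowerSeries.coeff n b)).mpr (fun n hn => rfl)
  have hb0 : PowerSeries.coeff 0 b = 0 := by
    have h1 := congrArg (PowerSeries.coeff 0) h.2
    simp [h.1] at h1
    simpa using h1
  have key : ∀ n : ℕ, (∀ d, 1 ≤ d → d ≤ n → (d:ℤ) ∣ e d) ∧ ∃ P, FLD P (b - ∑ d ∈ Finset.Icc 1 n, (e d / d) • DDn d) := by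
    intro n
    induction n with
    | zero => exact ⟨by intro d h1 h2; omega, c, by simpa using h⟩
    | succ n ih =>
      obtain ⟨ih1, P, ih2⟩ := ih
      have hco : ∀ m, 0 < m → PowerSeries.coeff m (b - ∑ d ∈ Finset.Icc 1 n, (e d / d) • DDn d) = ∑ d ∈ m.divisors with n < d, e d := by
        intro m hm
        rw [map_sub, map_sum, ← hes m hm, ← Finset.sum_filter_add_sum_filter_not m.divisors (fun d => n < d) e]
        rw [add_sub_assoc, add_eq_left, sub_eq_zero]
        have : ∀ d ∈ Finset.Icc 1 n, PowerSeries.coeff m ((e d / d) • DDn d) = if d ∣ m then e d else 0 := by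
          intro d hd
          obtain ⟨h1, h2⟩ := Finset.mem_Icc.mp hd
          rw [map_zsmul, DDn, PowerSeries.coeff_mk]
          by_cases hdm : d ∣ m
          · rw [if_pos ⟨hdm, hm⟩, if_pos hdm, smul_eq_mul, Int.ediv_mul_cancel (ih1 d h1 h2)]
          · rw [if_neg (fun h => hdm h.1), if_neg hdm, smul_zero]
        rw [Finset.sum_congr rfl this, ← Finset.sum_filter]
        apply Finset.sum_congr _ (fun _ _ => rfl)
        ext d
        simp only [Finset.mem_filter, Finset.mem_Icc, Nat.mem_divisors]
        constructor
        · rintro ⟨⟨h1, h2⟩, h3⟩; exact ⟨⟨Nat.pos_of_dvd_of_pos h1 hm, by omega⟩, h1⟩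
        · rintro ⟨⟨h1, h2⟩, h3⟩; exact ⟨⟨h3, hm.ne'⟩, by omega⟩
      have hdv := ih2.dvd (n := n) (by
        intro j hj
        rcases Nat.eq_zero_or_pos j with rfl | hj0
        · rw [map_sub, hb0, map_sum, Finset.sum_eq_zero, sub_zero]
          intro d _
          simp [DDn]
        · rw [hco j hj0]
          apply Finset.sum_eq_zero
          intro d hd
          obtain ⟨h1, h2⟩ := Finset.mem_filter.mp hd
          have := Nat.divisor_le h1
          omega)
      have hE : PowerSeries.coeff (n+1) (b - ∑ d ∈ Finset.Icc 1 n, (e d / d) • DDn d) = e (n+1) := by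
        rw [hco _ (by omega)]
        have : (n+1).divisors.filter (fun d => n < d) = {n+1} := by
          ext d
          simp only [Finset.mem_filter, Nat.mem_divisors, Finset.mem_singleton]
          constructor
          · rintro ⟨⟨h1, _⟩, h2⟩
            have := Nat.le_of_dvd (by omega) h1
            omega
          · rintro rfl; exact ⟨⟨dvd_refl _, by omega⟩, by omega⟩
        rw [this, Finset.sum_singleton]
      rw [hE] at hdv
      refine ⟨?_, ?_⟩
      · intro d h1 h2
        rcases Nat.lt_or_ge n d with h3 | h3
        · obtain rfl : d = n + 1 := by omega
          exact hdv
        · exact ih1 d h1 h3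
      · obtain ⟨R, hR⟩ := (FLD.base (n := n+1) (by omega)).zsmul (-(e (n+1) / ((n+1 : ℕ) : ℤ)))
        refine ⟨P * R, ?_⟩
        · have := ih2.mul hR
          rw [Finset.sum_Icc_succ_top (by omega)]
          convert this using 1
          simp only [zsmul_eq_mul]
          rw [Int.cast_neg]
          ring
  refine ⟨fun d => e d / d, fun n hn => ?_⟩
  rw [← hes n hn]
  apply Finset.sum_congr rfl
  intro d hd
  rw [Int.mul_ediv_cancel' ((key d).1 d (Nat.pos_of_mem_divisors hd) le_rfl)]

lemma int_exp' (c : ℕ → ℤ) (hc : c 0 = 1) (b : ℕ → ℂ)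
    (h : ∀ n : ℕ, -((n:ℂ) * c n) = ∑ x ∈ Finset.HasAntidiagonal.antidiagonal n, b x.1 * c x.2) :
    ∃ a : ℕ → ℤ, ∀ n : ℕ, 0 < n → b n = ∑ d ∈ n.divisors, (d:ℂ) * a d := by
  set P : PowerSeries ℤ := PowerSeries.mk c with hP
  have hP0 : PowerSeries.constantCoeff P = 1 := by
    rw [← PowerSeries.coeff_zero_eq_constantCoeff_apply, hP, PowerSeries.coeff_mk, hc]
  have hu : IsUnit P := by rw [PowerSeries.isUnit_iff_constantCoeff, hP0]; exact isUnit_one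
  obtain ⟨R, hR⟩ := hu.exists_right_inv
  set β : PowerSeries ℤ := - (PowerSeries.X * PowerSeries.derivative ℤ P) * R with hβ
  have hF : FLD P β := ⟨hP0, by rw [hβ]; linear_combination -(PowerSeries.X * PowerSeries.derivative ℤ P) * hR⟩
  have hXd : ∀ n, PowerSeries.coeff n (PowerSeries.X * PowerSeries.derivative ℤ P) = n * c n := by
    intro n
    cases n with
    | zero => simp
    | succ n =>
      rw [PowerSeries.coeff_succ_X_mul, PowerSeries.coeff_derivative, hP, PowerSeries.coeff_mk]
      push_cast; ring
  have hb : PowerSeries.mk b = PowerSeries.map (Int.castRingHom ℂ) β := by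
    have hPC : PowerSeries.map (Int.castRingHom ℂ) P ≠ 0 := by
      intro h0
      have := congrArg PowerSeries.constantCoeff h0
      rw [← PowerSeries.coeff_zero_eq_constantCoeff_apply, PowerSeries.coeff_map, PowerSeries.coeff_zero_eq_constantCoeff_apply, hP0] at this
      simp at this
    apply mul_right_cancel₀ hPC
    rw [← map_mul]
    have : β * P = -(PowerSeries.X * PowerSeries.derivative ℤ P) := by rw [hF.2]; ring
    rw [this]
    ext n
    rw [PowerSeries.coeff_mul, PowerSeries.coeff_map, map_neg, hXd]
    simp only [PowerSeries.coeff_mk, PowerSeries.coeff_map, hP]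
    simp only [eq_intCast]
    rw [← h n]
    push_cast; ring
  obtain ⟨a, ha⟩ := int_exp hF
  refine ⟨a, fun n hn => ?_⟩
  have := congrArg (PowerSeries.coeff n) hb
  rw [PowerSeries.coeff_mk, PowerSeries.coeff_map, ha n hn] at this
  rw [this]; simp

lemma LD.int_exp {F : ℂ → ℂ} {b : ℕ → ℂ} (hF : LD F b) (c : ℕ → ℤ)
    (h : ∀ t ∈ Metric.ball (0:ℂ) 1, HasSum (fun n => (c n : ℂ) * t ^ n) (F t)) :
    ∃ a : ℕ → ℤ, ∀ n : ℕ, 0 < n → b n = ∑ d ∈ n.divisors, (d:ℂ) * a d := by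
  have hc : c 0 = 1 := by
    have h1 := h 0 (by simp)
    rw [hF.zero] at h1
    have h2 : HasSum (fun n => (c n : ℂ) * (0:ℂ) ^ n) (c 0) := by
      convert hasSum_single 0 _ using 1
      · simp
      · intro n hn; simp [hn]
    exact_mod_cast h2.unique h1
  apply int_exp' c hc
  have tay : ∀ {G : ℂ → ℂ}, DifferentiableOn ℂ G (Metric.ball 0 1) → ∀ t ∈ Metric.ball (0:ℂ) 1,
      HasSum (fun n => ((n.factorial : ℂ)⁻¹ * iteratedDeriv n G 0) * t ^ n) (G t) := by
    intro G hG t ht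
    have := Complex.hasSum_taylorSeries_on_ball hG ht
    refine this.congr_fun ?_
    intro n
    simp [smul_eq_mul]; ring
  have e1 := psum_unique h (tay hF.diff)
  have hd := tay (hF.diff.deriv Metric.isOpen_ball)
  have hd2 : ∀ t ∈ Metric.ball (0:ℂ) 1, HasSum (fun n : ℕ => (-((n:ℂ) * c n)) * t ^ n) (-t * deriv F t) := by
    intro t ht
    rw [← hasSum_nat_add_iff' 1]
    simp only [Finset.range_one, Finset.sum_singleton, Nat.cast_zero, zero_mul, neg_zero, sub_zero]
    refine ((hd t ht).mul_left (-t)).congr_fun ?_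
    intro n
    have := congrFun e1 (n+1)
    rw [this, iteratedDeriv_succ', Nat.factorial_succ]
    have h1 : ((n + 1 : ℕ) : ℂ) ≠ 0 := by exact_mod_cast (Nat.succ_ne_zero n)
    have h2 : ((n.factorial : ℕ) : ℂ) ≠ 0 := by exact_mod_cast (Nat.factorial_ne_zero n)
    rw [pow_succ]
    push_cast at h1 ⊢
    field_simp
  have hpr : ∀ t ∈ Metric.ball (0:ℂ) 1, HasSum (fun n => (∑ x ∈ Finset.HasAntidiagonal.antidiagonal n, b x.1 * c x.2) * t ^ n) (-t * deriv F t) := by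
    intro t ht
    have s1 := (hF.hs t ht).summable.norm
    have s2 := (h t ht).summable.norm
    have e := tsum_mul_tsum_eq_tsum_sum_antidiagonal_of_summable_norm s1 s2
    have s3 := (summable_norm_sum_mul_antidiagonal_of_summable_norm s1 s2).of_norm
    rw [(hF.hs t ht).tsum_eq, (h t ht).tsum_eq, logDeriv_apply] at e
    have e2 : -t * (deriv F t / F t) * F t = -t * deriv F t := by
      have := hF.ne t ht
      field_simp
    rw [← e2, e]
    refine s3.hasSum.congr_fun ?_
    intro n
    rw [Finset.sum_mul]
    apply Finset.sum_congr rfl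
    intro x hx
    rw [← Finset.HasAntidiagonal.mem_antidiagonal.mp hx, pow_add]; ring
  exact fun n => congrFun (psum_unique hd2 hpr) n

def th (b1 b2 τ : ℂ) : ℂ :=
  cexp (π * Complex.I * b1^2 * τ + 2 * π * Complex.I * b1 * b2) * jacobiTheta₂ (b1 * τ + b2) τ

lemma th_add1 (b1 b2 τ : ℂ) : th (b1 + 1) b2 τ = th b1 b2 τ := by
  unfold th
  rw [show (b1 + 1) * τ + b2 = (b1 * τ + b2) + τ by ring, jacobiTheta₂_add_left', ← mul_assoc,
    ← Complex.exp_add]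
  congr 2
  ring

lemma th_add2 (b1 b2 τ : ℂ) : th b1 (b2 + 1) τ = cexp (2 * π * Complex.I * b1) * th b1 b2 τ := by
  unfold th
  rw [show b1 * τ + (b2 + 1) = (b1 * τ + b2) + 1 by ring, jacobiTheta₂_add_left, ← mul_assoc,
    ← Complex.exp_add]
  congr 2
  ring

lemma theta_T (z τ : ℂ) : jacobiTheta₂ z (τ + 1) = jacobiTheta₂ (z + 1/2) τ := by
  unfold jacobiTheta₂
  refine tsum_congr fun n => ?_
  unfold jacobiTheta₂_term
  obtain ⟨k, hk⟩ : ∃ k : ℤ, n^2 - n = 2 * k := by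
    rcases Int.even_or_odd n with ⟨m, hm⟩ | ⟨m, hm⟩
    · exact ⟨2*m^2 - m, by subst hm; ring⟩
    · exact ⟨2*m^2 + m, by subst hm; ring⟩
  have hk' : (n:ℂ)^2 = n + 2 * k := by
    have : n^2 = n + 2 * k := by linarith
    exact_mod_cast congrArg (Int.cast : ℤ → ℂ) this
  rw [Complex.exp_eq_exp_iff_exists_int]
  refine ⟨k, ?_⟩
  rw [hk']; ring

lemma th_T (b1 b2 τ : ℂ) :
    th b1 b2 (τ + 1) = cexp (-(π * Complex.I * (b1 + b1^2))) * th b1 (b2 + b1 + 1/2) τ := by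
  unfold th
  rw [theta_T, show b1 * (τ + 1) + b2 + 1/2 = b1 * τ + (b2 + b1 + 1/2) by ring, ← mul_assoc,
    ← Complex.exp_add]
  congr 2
  ring

lemma th_S (b1 b2 : ℂ) {τ : ℂ} (hτ : τ ≠ 0) :
    th b1 b2 (-1 / τ) = (-Complex.I * τ) ^ (1/2 : ℂ) * cexp (2 * π * Complex.I * b1 * b2) * th b2 (-b1) τ := by
  unfold th
  have h := jacobiTheta₂_functional_equation (b2 * τ + (-b1)) τ
  have h0 : (-Complex.I * τ) ^ (1/2 : ℂ) ≠ 0 := by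
    rw [Complex.cpow_def_of_ne_zero (by simp [hτ])]
    exact Complex.exp_ne_zero _
  rw [h, show (b2 * τ + -b1) / τ = b1 * (-1/τ) + b2 by field_simp; ring]
  set X := jacobiTheta₂ (b1 * (-1/τ) + b2) (-1/τ)
  have : cexp (π * Complex.I * b1 ^ 2 * (-1/τ) + 2 * π * Complex.I * b1 * b2) =
    cexp (2 * π * Complex.I * b1 * b2) * cexp (π * Complex.I * b2^2 * τ + 2 * π * Complex.I * b2 * (-b1)) *
      cexp (-π * Complex.I * (b2 * τ + -b1)^2 / τ) := by
    rw [← Complex.exp_add, ← Complex.exp_add]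
    congr 1
    field_simp
    ring
  rw [this]
  field_simp

lemma exp_pow_one {x : ℂ} {M : ℕ} (k : ℤ) (h : M * x = k * (2 * π * Complex.I)) : cexp x ^ M = 1 := by
  rw [← Complex.exp_nat_mul, h]
  exact Complex.exp_int_mul_two_pi_mul_I k

def sg (N : ℕ) (u v : ℤ) (τ : ℍ) : ℂ :=
  (th (u / N - 1/2) (v / N + 1/2) τ) ^ (24 * N^2) / ModularForm.discriminant τ ^ (N^2)

lemma sg_add1 {N : ℕ} (hN : N ≠ 0) (u v : ℤ) (τ : ℍ) : sg N (u + N) v τ = sg N u v τ := by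
  unfold sg
  have hN' : (N:ℂ) ≠ 0 := by exact_mod_cast hN
  rw [show (((u + N : ℤ) : ℂ)) / N - 1/2 = (u / N - 1/2) + 1 by push_cast; field_simp; ring, th_add1]

lemma sg_add2 {N : ℕ} (hN : N ≠ 0) (u v : ℤ) (τ : ℍ) : sg N u (v + N) τ = sg N u v τ := by
  unfold sg
  have hN' : (N:ℂ) ≠ 0 := by exact_mod_cast hN
  rw [show (((v + N : ℤ) : ℂ)) / N + 1/2 = (v / N + 1/2) + 1 by push_cast; field_simp; ring, th_add2,
    mul_pow, exp_pow_one (24 * N * u - 12 * N^2), one_mul]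
  push_cast; field_simp; ring

lemma disc_T (τ : ℍ) : ModularForm.discriminant (ModularGroup.T • τ) = ModularForm.discriminant τ := by
  have := congrFun ModularForm.discriminant_T_invariant τ
  rw [ModularForm.SL_slash_apply] at this
  have h : UpperHalfPlane.denom ModularGroup.T τ = 1 := by
    rw [ModularGroup.denom_apply]
    simp [ModularGroup.coe_T]
  rw [h, _root_.one_zpow, mul_one] at this
  exact this

lemma disc_S (τ : ℍ) : ModularForm.discriminant (ModularGroup.S • τ) = (τ:ℂ)^12 * ModularForm.discriminant τ := by
  have := congrFun ModularForm.discriminant_S_invariant τ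
  rw [ModularForm.SL_slash_apply] at this
  have h : UpperHalfPlane.denom ModularGroup.S τ = τ := ModularGroup.denom_S τ
  rw [h] at this
  have h0 := τ.ne_zero
  have h12 : (τ:ℂ)^(-12:ℤ) * (τ:ℂ)^12 = 1 := by
    rw [← zpow_natCast, ← zpow_add₀ h0]; norm_num
  rw [← this]
  linear_combination (-ModularForm.discriminant (ModularGroup.S • τ)) * h12

lemma sg_T {N : ℕ} (hN : N ≠ 0) (u v : ℤ) (τ : ℍ) : sg N u v (ModularGroup.T • τ) = sg N u (u + v) τ := by
  have hN' : (N:ℂ) ≠ 0 := by exact_mod_cast hN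
  unfold sg
  rw [disc_T, show ((ModularGroup.T • τ : ℍ) : ℂ) = τ + 1 by
    rw [modular_T_smul]; simp [add_comm], th_T, mul_pow, exp_pow_one (3 * N^2 - 12 * u^2), one_mul]
  · congr 3
    push_cast; field_simp; ring
  · push_cast; field_simp; ring

lemma sg_S {N : ℕ} (hN : N ≠ 0) (u v : ℤ) (τ : ℍ) : sg N u v (ModularGroup.S • τ) = sg N v (-u) τ := by
  have hN' : (N:ℂ) ≠ 0 := by exact_mod_cast hN
  have h0 := τ.ne_zero
  unfold sg
  rw [disc_S, show ((ModularGroup.S • τ : ℍ) : ℂ) = -1/τ by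
    rw [modular_S_smul]; simp [neg_div], th_S _ _ h0, mul_pow, mul_pow,
    exp_pow_one (6 * (2*u-N) * (2*v+N)), mul_one]
  · rw [show ((v:ℂ)/N + 1/2) = (v / N - 1/2) + 1 by ring, th_add1,
      show (-((u:ℂ)/N - 1/2)) = ((-u:ℤ):ℂ)/N + 1/2 by push_cast; ring]
    have : ((-Complex.I * (τ:ℂ)) ^ (1/2:ℂ)) ^ (24 * N^2) = ((τ:ℂ)^12)^(N^2) := by
      rw [pow_mul]
      congr 1
      rw [← Complex.cpow_nat_mul]
      norm_num
      have : Complex.I ^ 12 = 1 := by rw [show 12 = 4 * 3 by norm_num, pow_mul, Complex.I_pow_four, one_pow]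
      rw [mul_pow, this, one_mul]
    rw [this]
    rw [mul_pow ((τ:ℂ)^12)]
    have : ((τ:ℂ)^12)^(N^2) ≠ 0 := by positivity
    rw [mul_div_mul_left _ _ this]
  · push_cast; field_simp; ring

lemma sg_A {N : ℕ} (hN : N ≠ 0) (A : SL(2, ℤ)) : ∀ (w : Fin 2 → ℤ) (τ : ℍ),
    sg N (w 0) (w 1) (A • τ) = sg N ((w ᵥ* A.1) 0) ((w ᵥ* A.1) 1) τ := by
  have : A ∈ Subgroup.closure {ModularGroup.S, ModularGroup.T} := by
    simp [SpecialLinearGroup.SL2Z_generators]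
  induction this using Subgroup.closure_induction with
  | one => intro w τ; simp
  | mem g hg =>
    intro w τ
    simp only [Set.mem_insert_iff, Set.mem_singleton_iff] at hg
    rcases hg with rfl | rfl
    · rw [sg_S hN]
      congr 1 <;> simp [ModularGroup.S, Matrix.vecMul, dotProduct, Fin.sum_univ_two]
    · rw [sg_T hN]
      congr 1 <;> simp [ModularGroup.T, Matrix.vecMul, dotProduct, Fin.sum_univ_two]
  | mul g h _ _ ig ih =>
    intro w τ
    rw [mul_smul, ig, ih]
    simp [Matrix.vecMul_vecMul]
  | inv g _ ig =>
    intro w τ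
    have := ig (w ᵥ* (g⁻¹).1) (g⁻¹ • τ)
    rw [smul_inv_smul, Matrix.vecMul_vecMul] at this
    rw [this]
    have h : (g⁻¹).1 * g.1 = 1 := by
      have : ((g⁻¹ * g : SL(2, ℤ))).1 = 1 := by rw [inv_mul_cancel]; rfl
      exact this
    rw [h]; simp

lemma sg_mod1 {N : ℕ} (hN : N ≠ 0) (u v k : ℤ) (τ : ℍ) : sg N (u + k * N) v τ = sg N u v τ := by
  induction k using Int.induction_on with
  | zero => simp
  | succ k ih => rw [← ih, ← sg_add1 hN (u + k * N)]; congr 1; ring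
  | pred k ih => rw [← ih, ← sg_add1 hN]; congr 1; ring

lemma sg_mod2 {N : ℕ} (hN : N ≠ 0) (u v k : ℤ) (τ : ℍ) : sg N u (v + k * N) τ = sg N u v τ := by
  induction k using Int.induction_on with
  | zero => simp
  | succ k ih => rw [← ih, ← sg_add2 hN u (v + k * N)]; congr 1; ring
  | pred k ih => rw [← ih, ← sg_add2 hN]; congr 1; ring

def SG (N : ℕ) (a : ZMod N × ZMod N) (τ : ℍ) : ℂ := sg N a.1.val a.2.val τ

lemma sg_eq_SG {N : ℕ} [NeZero N] (u v : ℤ) (τ : ℍ) : sg N u v τ = SG N ((u : ZMod N), (v : ZMod N)) τ := by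
  have hN : N ≠ 0 := NeZero.ne N
  unfold SG
  simp only [ZMod.val_intCast]
  conv_lhs => rw [← Int.emod_add_mul_ediv u N, ← Int.emod_add_mul_ediv v N, mul_comm, mul_comm (N:ℤ) (v / N)]
  rw [sg_mod1 hN, sg_mod2 hN]

def actA {N : ℕ} (A : SL(2, ℤ)) (a : ZMod N × ZMod N) : ZMod N × ZMod N :=
  (a.1 * (A 0 0 : ℤ) + a.2 * (A 1 0 : ℤ), a.1 * (A 0 1 : ℤ) + a.2 * (A 1 1 : ℤ))

lemma SG_A {N : ℕ} [NeZero N] (A : SL(2, ℤ)) (a : ZMod N × ZMod N) (τ : ℍ) :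
    SG N a (A • τ) = SG N (actA A a) τ := by
  have := sg_A (NeZero.ne N) A ![a.1.val, a.2.val] τ
  simp only [Matrix.cons_val_zero, Matrix.cons_val_one] at this
  rw [sg_eq_SG, sg_eq_SG] at this
  simp only [Matrix.vecMul, dotProduct, Fin.sum_univ_two] at this
  simp only [Matrix.cons_val_zero, Matrix.cons_val_one, Int.cast_add, Int.cast_mul, Int.cast_natCast,
    ZMod.natCast_zmod_val] at this
  exact this

def QA (N : ℕ) [NeZero N] (a : ZMod N × ZMod N) (t : ℂ) : ℂ :=
  QQ N (if a.1 = 0 then N else a.1.val) (ZMod.stdAddChar a.2) t * QQ N (N - a.1.val) (ZMod.stdAddChar (-a.2)) t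

lemma QA_LD {N : ℕ} [NeZero N] (a : ZMod N × ZMod N) :
    LD (QA N a) (fun k => qcoef N a.1 (ZMod.stdAddChar a.2) k + qcoef N (-a.1) (ZMod.stdAddChar (-a.2)) k) := by
  have hN : 0 < N := NeZero.pos N
  have hl := a.1.val_lt
  have h1 := QQ_LD (N := N) (ρ := if a.1 = 0 then N else a.1.val) (by
    split_ifs with h
    · exact hN
    · rw [Nat.pos_iff_ne_zero, ne_eq, ZMod.val_eq_zero]; exact h) (by split_ifs <;> omega) (ζ := ZMod.stdAddChar a.2)
    (stdAC_norm _).le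
  have h2 := QQ_LD (N := N) (ρ := N - a.1.val) (by omega) (by omega) (ζ := ZMod.stdAddChar (-a.2)) (stdAC_norm _).le
  have e1 : ((if a.1 = 0 then N else a.1.val : ℕ) : ZMod N) = a.1 := by
    split_ifs with h
    · simp [h]
    · simp
  have e2 : ((N - a.1.val : ℕ) : ZMod N) = - a.1 := by
    rw [Nat.cast_sub hl.le]; simp
  rw [e1] at h1
  rw [e2] at h2
  exact h1.mul h2

lemma stdAC_pow {N : ℕ} [NeZero N] (x : ZMod N) : (ZMod.stdAddChar x : ℂ) = cexp (2 * π * Complex.I * (x.val / N)) := by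
  have := ZMod.stdAddChar_coe (N := N) (x.val)
  simp only [Int.cast_natCast, ZMod.natCast_zmod_val] at this
  rw [this]
  congr 1; ring

lemma QQ_zero {N : ℕ} (hN : 0 < N) {ζ t : ℂ} (hζ : ‖ζ‖ ≤ 1) (ht : ‖t‖ < 1) : QQ N 0 ζ t = (1 - ζ) * QQ N N ζ t := by
  unfold QQ
  rw [tprod_eq_zero_mul']
  · congr 1
    · simp
    · refine tprod_congr fun n => ?_
      congr 3; ring
  · convert QQ_mult (ρ := N) hN hζ ht using 4
    ring

def tN (N : ℕ) (τ : ℍ) : ℂ := cexp (2 * π * Complex.I * τ / N)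

lemma tN_norm {N : ℕ} [NeZero N] (τ : ℍ) : ‖tN N τ‖ < 1 := by
  unfold tN
  rw [Complex.norm_exp, Real.exp_lt_one_iff, show (2 * π * Complex.I * (τ:ℂ) / N) = ((2 * π / N : ℝ):ℂ) * (Complex.I * τ) by push_cast; ring,
    Complex.re_ofReal_mul]
  have : 0 < τ.im := τ.im_pos
  have h2 : (0:ℝ) < 2 * π / N := by have := NeZero.pos N; positivity
  simp
  positivity

lemma th_prod {N : ℕ} [NeZero N] (a : ZMod N × ZMod N) (τ : ℍ) :
    jacobiTheta₂ (((a.1.val:ℂ) / N - 1/2) * τ + ((a.2.val:ℂ) / N + 1/2)) τ =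
    (∏' n : ℕ, (1 - cexp (2 * π * Complex.I * τ) ^ (n+1))) * (QQ N a.1.val (ZMod.stdAddChar a.2) (tN N τ) * QQ N (N - a.1.val) (ZMod.stdAddChar (-a.2)) (tN N τ)) := by
  have hN' : (N:ℂ) ≠ 0 := by exact_mod_cast NeZero.ne N
  have hl := a.1.val_lt
  set z : ℂ := (((a.1.val:ℂ) / N - 1/2) * τ + ((a.2.val:ℂ) / N + 1/2)) with hz
  set p : ℂ := cexp (π * Complex.I * τ) with hp
  set w : ℂ := cexp (2 * π * Complex.I * z) with hw
  have hpn : ‖p‖ < 1 := by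
    rw [hp, Complex.norm_exp, Real.exp_lt_one_iff, mul_assoc, Complex.re_ofReal_mul]
    have : 0 < τ.im := τ.im_pos
    simp
    positivity
  have := triple_product hpn (Complex.exp_ne_zero _) (w := w) (Complex.exp_ne_zero _)
  have e1 : jacobiTheta₂ z τ = ∑' j : ℤ, p ^ (j^2).toNat * w ^ j := by
    unfold jacobiTheta₂
    refine tsum_congr fun j => ?_
    unfold jacobiTheta₂_term
    rw [hp, hw, ← Complex.exp_nat_mul, ← Complex.exp_int_mul, ← Complex.exp_add]
    congr 1
    have : (((j^2).toNat : ℕ):ℂ) = (j:ℂ)^2 := by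
      have h : (((j^2).toNat : ℕ):ℤ) = j^2 := Int.toNat_of_nonneg (by positivity)
      exact_mod_cast congrArg (Int.cast : ℤ → ℂ) h
    rw [this]; ring
  rw [e1, ← this]
  have hm1 : cexp (π * Complex.I) = -1 := Complex.exp_pi_mul_I
  have e2 : p^2 = cexp (2 * π * Complex.I * τ) := by
    rw [hp, ← Complex.exp_nat_mul]; congr 1; push_cast; ring
  rw [e2]
  congr 2
  · unfold QQ
    refine tprod_congr fun i => ?_
    rw [sub_eq_add_neg, stdAC_pow, ← neg_one_mul, ← hm1, tN, hp, hw, ← Complex.exp_nat_mul, ← Complex.exp_nat_mul,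
      ← Complex.exp_add, ← Complex.exp_add, ← Complex.exp_add]
    congr 2
    rw [hz]; push_cast; field_simp; ring
  · unfold QQ
    refine tprod_congr fun i => ?_
    have : (ZMod.stdAddChar (-a.2) : ℂ) = cexp (-(2 * π * Complex.I * (a.2.val / N))) := by
      rw [AddChar.map_neg_eq_inv, stdAC_pow, Complex.exp_neg]
    have hm1 : cexp (-(π * Complex.I)) = -1 := by rw [Complex.exp_neg, hm1]; norm_num
    rw [sub_eq_add_neg, this, ← neg_one_mul, ← hm1, tN, hp, hw, ← Complex.exp_nat_mul, ← Complex.exp_nat_mul,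
      ← Complex.exp_neg, ← Complex.exp_add, ← Complex.exp_add, ← Complex.exp_add]
    congr 2
    rw [hz]; push_cast [Nat.cast_sub hl.le]; field_simp; ring

lemma disc_prod (τ : ℍ) : ModularForm.discriminant τ = cexp (2 * π * Complex.I * τ) * (∏' n : ℕ, (1 - cexp (2 * π * Complex.I * τ) ^ (n+1))) ^ 24 := by
  rw [ModularForm.discriminant_eq_q_prod]
  congr 1
  · simp [Function.Periodic.qParam]
  · simp only [ModularForm.eta_q_eq_pow]
    refine Multipliable.tprod_pow ?_ 24
    have h : ‖cexp (2 * π * Complex.I * τ)‖ < 1 := by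
      have := tN_norm (N := 1) τ
      simpa [tN] using this
    have := QQ_mult (N := 1) (ρ := 1) one_pos (ζ := 1) (by simp) h
    convert this using 3
    rw [one_mul]; congr 1; ring

lemma SG_prod {N : ℕ} [NeZero N] (a : ZMod N × ZMod N) (ha : a ≠ 0) : ∃ K : ℂ, K ≠ 0 ∧ ∀ τ : ℍ,
    SG N a τ = K * cexp (2 * π * Complex.I * (12 * N^2 * beta N a.1 : ℚ) * τ) * QA N a (tN N τ) ^ (24 * N^2) := by
  have hN : 0 < N := NeZero.pos N
  have hN' : (N:ℂ) ≠ 0 := by exact_mod_cast NeZero.ne N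
  set b1 : ℂ := ((a.1.val:ℂ) / N - 1/2) with hb1
  set b2 : ℂ := ((a.2.val:ℂ) / N + 1/2) with hb2
  obtain ⟨k, hk, hkk⟩ : ∃ k : ℂ, k ≠ 0 ∧ ∀ t : ℂ, ‖t‖ < 1 → QQ N a.1.val (ZMod.stdAddChar a.2) t = k * QQ N (if a.1 = 0 then N else a.1.val) (ZMod.stdAddChar a.2) t := by
    by_cases h : a.1 = 0
    · refine ⟨1 - ZMod.stdAddChar a.2, ?_, ?_⟩
      · intro h1
        apply ha
        have h2 : (ZMod.stdAddChar a.2 : ℂ) = ZMod.stdAddChar (0 : ZMod N) := by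
          rw [AddChar.map_zero_eq_one]; linear_combination -h1
        exact Prod.ext h (ZMod.injective_stdAddChar h2)
      · intro t ht
        simp only [h, ZMod.val_zero, if_true]
        exact QQ_zero hN (stdAC_norm _).le ht
    · refine ⟨1, one_ne_zero, fun t _ => by simp [h]⟩
  refine ⟨(cexp (2 * π * Complex.I * b1 * b2) * k) ^ (24 * N^2), by
    refine pow_ne_zero _ (mul_ne_zero (Complex.exp_ne_zero _) hk), fun τ => ?_⟩
  have hd := ModularForm.discriminant_ne_zero τ
  unfold SG sg th
  push_cast
  rw [← hb1, ← hb2, th_prod a τ, hkk _ (tN_norm τ)]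
  rw [disc_prod] at hd ⊢
  set P := ∏' n : ℕ, (1 - cexp (2 * π * Complex.I * τ) ^ (n+1))
  have hP : P ≠ 0 := by
    intro h; rw [h] at hd; simp at hd
  rw [div_eq_iff (pow_ne_zero _ hd)]
  unfold QA
  set X := QQ N (if a.1 = 0 then N else a.1.val) (ZMod.stdAddChar a.2) (tN N τ)
  set Y := QQ N (N - a.1.val) (ZMod.stdAddChar (-a.2)) (tN N τ)
  rw [Complex.exp_add]
  have key : cexp (π * Complex.I * b1^2 * τ) ^ (24 * N^2) = cexp (2 * π * Complex.I * (12 * N^2 * beta N a.1) * τ) * cexp (2 * π * Complex.I * τ) ^ (N^2) := by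
    rw [← Complex.exp_nat_mul, ← Complex.exp_nat_mul, ← Complex.exp_add]
    congr 1
    rw [hb1, beta]; push_cast; field_simp; ring
  simp only [mul_pow, key]
  rw [← pow_mul P]
  ring

lemma const_of_bdd {N : ℕ} [NeZero N] (G : ℍ → ℂ) (hd : MDifferentiable 𝓘(ℂ) 𝓘(ℂ) G)
    (hinv : ∀ A ∈ CongruenceSubgroup.Gamma N, ∀ z : ℍ, G (A • z) = G z)
    (hb : ∀ A : SL(2, ℤ), IsBoundedAtImInfty (fun z => G (A • z))) : ∃ c : ℂ, ∀ z, G z = c := by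
  have hsl : ∀ A : SL(2, ℤ), SlashAction.map (0:ℤ) A G = fun z => G (A • z) := by
    intro A; ext z
    rw [ModularForm.SL_slash_apply]
    simp
  let F : ModularForm (CongruenceSubgroup.Gamma N : Subgroup (GL (Fin 2) ℝ)) 0 :=
    { toFun := G
      slash_action_eq' := by
        intro A hA
        obtain ⟨A, hA, rfl⟩ := hA
        have := hsl A
        rw [funext (hinv A hA)] at this
        exact this
      holo' := hd
      bdd_at_cusps' := by
        intro c hc
        rw [Subgroup.IsArithmetic.isCusp_iff_isCusp_SL2Z] at hc
        rw [OnePoint.isBoundedAt_iff_forall_SL2Z hc]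
        intro γ _
        rw [hsl]
        exact hb γ }
  obtain ⟨c, hc⟩ := ModularForm.eq_const_of_weight_zero F
  exact ⟨c, fun z => congrFun hc z⟩

def HE (f : ℍ → ℂ) (α : ℝ) : Prop := ∃ κ : ℂ, κ ≠ 0 ∧
    Tendsto (fun z : ℍ => f z * cexp (-(2 * (π : ℂ) * Complex.I * (α : ℂ) * (z : ℂ)))) atImInfty (𝓝 κ)

instance : NeBot atImInfty := by
  unfold atImInfty
  refine Filter.comap_neBot fun s hs => ?_
  rw [Filter.mem_atTop_sets] at hs
  obtain ⟨a, ha⟩ := hs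
  refine ⟨⟨(max a 1 : ℝ) * Complex.I, by simp⟩, ha _ ?_⟩
  simp [UpperHalfPlane.im]

lemma HE.one : HE (fun _ => 1) 0 := ⟨1, one_ne_zero, by simp⟩

lemma HE.mul {f g : ℍ → ℂ} {α β : ℝ} (hf : HE f α) (hg : HE g β) : HE (fun z => f z * g z) (α + β) := by
  obtain ⟨κ, hκ, h⟩ := hf
  obtain ⟨κ', hκ', h'⟩ := hg
  refine ⟨κ * κ', mul_ne_zero hκ hκ', (h.mul h').congr fun z => ?_⟩
  rw [show cexp (-(2 * (π : ℂ) * Complex.I * ((α + β : ℝ) : ℂ) * (z : ℂ))) = cexp (-(2 * (π : ℂ) * Complex.I * (α : ℂ) * (z : ℂ))) * cexp (-(2 * (π : ℂ) * Complex.I * (β : ℂ) * (z : ℂ))) by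
    rw [← Complex.exp_add]; congr 1; push_cast; ring]
  ring

lemma HE.zpow {f : ℍ → ℂ} {α : ℝ} (hf : HE f α) (m : ℤ) : HE (fun z => f z ^ m) (m * α) := by
  obtain ⟨κ, hκ, h⟩ := hf
  refine ⟨κ ^ m, zpow_ne_zero _ hκ, (h.zpow₀ m (Or.inl hκ)).congr fun z => ?_⟩
  rw [mul_zpow, ← Complex.exp_int_mul]
  congr 2; push_cast; ring

lemma HE.prod {ι : Type*} (s : Finset ι) {f : ι → ℍ → ℂ} {α : ι → ℝ} (h : ∀ i ∈ s, HE (f i) (α i)) :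
    HE (fun z => ∏ i ∈ s, f i z) (∑ i ∈ s, α i) := by
  classical
  induction s using Finset.induction_on with
  | empty => simpa using HE.one
  | insert a s ha ih =>
    simp only [Finset.prod_insert ha, Finset.sum_insert ha]
    exact (h a (Finset.mem_insert_self _ _)).mul (ih fun i hi => h i (Finset.mem_insert_of_mem hi))

lemma exp_norm_im (α : ℝ) (z : ℍ) : ‖cexp (2 * (π : ℂ) * Complex.I * (α : ℂ) * (z : ℂ))‖ = Real.exp (-(2 * π * α * z.im)) := by
  rw [Complex.norm_exp]
  congr 1
  rw [show 2 * (π : ℂ) * Complex.I * (α : ℂ) * (z : ℂ) = ((2 * π * α : ℝ) : ℂ) * (Complex.I * z) by push_cast; ring,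
    Complex.re_ofReal_mul]
  simp

lemma tendsto_exp_zero {α : ℝ} (hα : 0 < α) : Tendsto (fun z : ℍ => cexp (2 * (π : ℂ) * Complex.I * (α : ℂ) * (z : ℂ))) atImInfty (𝓝 0) := by
  rw [tendsto_zero_iff_norm_tendsto_zero]
  simp only [exp_norm_im]
  refine Real.tendsto_exp_atBot.comp ?_
  refine tendsto_neg_atTop_atBot.comp ?_
  refine Tendsto.const_mul_atTop (by positivity) ?_
  exact tendsto_comap

lemma HE.unique {f : ℍ → ℂ} {α β : ℝ} (hf : HE f α) (hg : HE f β) : α = β := by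
  have main : ∀ {α β : ℝ}, HE f α → HE f β → ¬ α < β := by
    intro α β hf hg hlt
    obtain ⟨κ, hκ, h⟩ := hf
    obtain ⟨κ', hκ', h'⟩ := hg
    have := h'.mul (tendsto_exp_zero (sub_pos.2 hlt))
    rw [mul_zero] at this
    refine hκ (tendsto_nhds_unique h (this.congr fun z => ?_))
    rw [mul_assoc, ← Complex.exp_add]
    congr 2; push_cast; ring
  rcases lt_trichotomy α β with h | h | h
  · exact absurd h (main hf hg)
  · exact h
  · exact absurd h (main hg hf)

lemma HE.bdd {f : ℍ → ℂ} {α : ℝ} (hf : HE f α) (hα : 0 ≤ α) : IsBoundedAtImInfty f := by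
  obtain ⟨κ, hκ, h⟩ := hf
  have h1 := h.isBigO_one ℝ
  have h2 : (fun z : ℍ => cexp (2 * (π : ℂ) * Complex.I * (α : ℂ) * (z : ℂ))) =O[atImInfty] (1 : ℍ → ℝ) := by
    refine Asymptotics.IsBigO.of_bound 1 (Eventually.of_forall fun z => ?_)
    rw [exp_norm_im]
    simp only [Pi.one_apply, norm_one, mul_one, Real.exp_le_one_iff]
    have := z.im_pos
    have : 0 ≤ 2 * π * α * z.im := by positivity
    linarith
  have h3 := Asymptotics.IsBigO.mul h1 h2
  unfold IsBoundedAtImInfty BoundedAtFilter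
  refine (h3.congr (fun z => ?_) (fun z => ?_))
  · rw [mul_assoc, ← Complex.exp_add]; simp
  · simp

lemma im_T_zpow (k : ℤ) (z : ℍ) : ((ModularGroup.T ^ k • z : ℍ) : ℂ) = z + k := by
  rw [UpperHalfPlane.modular_T_zpow_smul]; simp [add_comm]

lemma tendsto_T_zpow (k : ℤ) : Tendsto (fun z : ℍ => ModularGroup.T ^ k • z) atImInfty atImInfty := by
  have h : ∀ z : ℍ, (ModularGroup.T ^ k • z).im = z.im := by
    intro z
    have := congrArg Complex.im (im_T_zpow k z)
    simpa using this
  refine tendsto_comap_iff.2 ?_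
  have : UpperHalfPlane.im ∘ (fun z : ℍ => ModularGroup.T ^ k • z) = UpperHalfPlane.im := funext h
  rw [this]
  exact tendsto_comap

lemma HE.T_aux {f : ℍ → ℂ} {α : ℝ} {κ : ℂ} (k : ℤ)
    (h : Tendsto (fun z : ℍ => f z * cexp (-(2 * (π : ℂ) * Complex.I * (α : ℂ) * (z : ℂ)))) atImInfty (𝓝 κ)) :
    Tendsto (fun z : ℍ => f (ModularGroup.T ^ k • z) * cexp (-(2 * (π : ℂ) * Complex.I * (α : ℂ) * (z : ℂ)))) atImInfty
     (𝓝 (κ * cexp (2 * π * Complex.I * α * k))) := by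
  refine ((h.comp (tendsto_T_zpow k)).mul_const (cexp (2 * π * Complex.I * α * k))).congr fun z => ?_
  simp only [Function.comp]
  rw [im_T_zpow, mul_assoc, ← Complex.exp_add]
  congr 2; ring

lemma HE.T {f : ℍ → ℂ} {α : ℝ} (hf : HE f α) (k : ℤ) : HE (fun z => f (ModularGroup.T ^ k • z)) α := by
  obtain ⟨κ, hκ, h⟩ := hf
  exact ⟨_, mul_ne_zero hκ (Complex.exp_ne_zero _), HE.T_aux k h⟩

lemma HE.rat {f : ℍ → ℂ} {α : ℝ} (hf : HE f α) {N : ℕ} (hN : 0 < N) (hT : ∀ z, f (ModularGroup.T ^ (N:ℤ) • z) = f z) : ∃ x : ℚ, (x : ℝ) = α := by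
  obtain ⟨κ, hκ, h⟩ := hf
  have h1 := HE.T_aux N h
  simp only [hT] at h1
  have h2 := tendsto_nhds_unique h h1
  have h3 : cexp (2 * π * Complex.I * α * (N:ℤ)) = 1 := by
    have : κ * (cexp (2 * π * Complex.I * α * (N:ℤ)) - 1) = 0 := by rw [mul_sub, ← h2]; ring
    rcases mul_eq_zero.1 this with h | h
    · exact absurd h hκ
    · linear_combination h
  rw [Complex.exp_eq_one_iff] at h3
  obtain ⟨n, hn⟩ := h3
  have h4 : (α:ℂ) * N = n := by
    have := Complex.two_pi_I_ne_zero
    apply mul_left_cancel₀ this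
    rw [mul_comm _ (n:ℂ), ← hn]; push_cast; ring
  have h5 : α * N = n := by exact_mod_cast h4
  refine ⟨(n:ℚ) / N, ?_⟩
  have hN' : (N:ℝ) ≠ 0 := by positivity
  push_cast
  rw [← h5]; field_simp

lemma tendsto_tN (N : ℕ) [NeZero N] : Tendsto (fun z : ℍ => tN N z) atImInfty (𝓝 0) := by
  have : (0:ℝ) < 1 / N := by have := NeZero.pos N; positivity
  refine (tendsto_exp_zero this).congr fun z => ?_
  unfold tN; congr 1; push_cast; ring

lemma tN_mem {N : ℕ} [NeZero N] (τ : ℍ) : tN N τ ∈ Metric.ball (0:ℂ) 1 := by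
  simpa using tN_norm τ

lemma SG_HE {N : ℕ} [NeZero N] (a : ZMod N × ZMod N) (ha : a ≠ 0) : HE (SG N a) ((12 * N^2 * beta N a.1 : ℚ) : ℝ) := by
  obtain ⟨K, hK, h⟩ := SG_prod a ha
  have hL := QA_LD (N := N) a
  have hc : ContinuousAt (QA N a) 0 := (hL.diffAt (by simp)).continuousAt
  have h1 : Tendsto (fun z : ℍ => K * QA N a (tN N z) ^ (24 * N^2)) atImInfty (𝓝 (K * QA N a 0 ^ (24 * N^2))) :=
    ((hc.tendsto.comp (tendsto_tN N)).pow _).const_mul _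
  refine ⟨K, hK, ?_⟩
  rw [hL.zero, one_pow, mul_one] at h1
  refine h1.congr fun z => ?_
  rw [h z, show ∀ A B C D : ℂ, A * B * C * D = (B * D) * (A * C) by intros; ring, ← Complex.exp_add]
  rw [show (((12 * N^2 * beta N a.1 : ℚ) : ℝ) : ℂ) = ((12 * N^2 * beta N a.1 : ℚ) : ℂ) by norm_cast]
  simp

lemma SG_ne {N : ℕ} [NeZero N] (a : ZMod N × ZMod N) (ha : a ≠ 0) (z : ℍ) : SG N a z ≠ 0 := by
  obtain ⟨K, hK, h⟩ := SG_prod a ha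
  rw [h]
  exact mul_ne_zero (mul_ne_zero hK (Complex.exp_ne_zero _)) (pow_ne_zero _ ((QA_LD a).ne _ (tN_mem z)))

lemma mdiff_of {f : ℍ → ℂ} {F : ℂ → ℂ} (h : ∀ z : ℍ, f z = F z) (hF : ∀ z : ℍ, DifferentiableAt ℂ F z) :
    MDifferentiable 𝓘(ℂ) 𝓘(ℂ) f := by
  rw [UpperHalfPlane.mdifferentiable_iff]
  refine DifferentiableOn.congr (f := F) (fun z hz => (hF ⟨z, hz⟩).differentiableWithinAt) fun z hz => ?_
  simp [h, ofComplex_apply_of_im_pos hz]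

lemma SG_diff {N : ℕ} [NeZero N] (a : ZMod N × ZMod N) (ha : a ≠ 0) : MDifferentiable 𝓘(ℂ) 𝓘(ℂ) (SG N a) := by
  obtain ⟨K, hK, h⟩ := SG_prod a ha
  refine mdiff_of (F := fun z : ℂ => K * cexp (2 * π * Complex.I * (12 * N^2 * beta N a.1 : ℚ) * z) * QA N a (cexp (2 * π * Complex.I * z / N)) ^ (24 * N^2)) h fun z => ?_
  have h1 : DifferentiableAt ℂ (QA N a) (cexp (2 * π * Complex.I * (z:ℂ) / N)) := (QA_LD a).diffAt (tN_mem z)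
  have h2 : DifferentiableAt ℂ (fun z : ℂ => QA N a (cexp (2 * π * Complex.I * z / N))) z :=
    DifferentiableAt.comp (z:ℂ) h1 (f := fun z : ℂ => cexp (2 * π * Complex.I * z / N)) (by fun_prop)
  exact DifferentiableAt.mul (by fun_prop) (h2.pow _)

def colN (N : ℕ) (A : SL(2, ℤ)) : ZMod N × ZMod N := (((A 0 0 : ℤ) : ZMod N), ((A 1 0 : ℤ) : ZMod N))

lemma colN_eq {N : ℕ} (A B : SL(2, ℤ)) (h : colN N A = colN N B) :
    ∃ γ ∈ CongruenceSubgroup.Gamma N, ∃ k : ℤ, B = γ * A * ModularGroup.T ^ k := by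
  set D := A⁻¹ * B with hD
  set k : ℤ := D 0 1 with hk
  have hc1 : ((A 0 0 : ℤ) : ZMod N) = (B 0 0 : ℤ) := congrArg Prod.fst h
  have hc2 : ((A 1 0 : ℤ) : ZMod N) = (B 1 0 : ℤ) := congrArg Prod.snd h
  have hdA : A 0 0 * A 1 1 - A 0 1 * A 1 0 = 1 := by
    have := A.2; rw [Matrix.det_fin_two] at this; exact this
  have hdA' : ((A 0 0 : ℤ) : ZMod N) * (A 1 1 : ℤ) - (A 0 1 : ℤ) * (A 1 0 : ℤ) = 1 := by
    exact_mod_cast congrArg (Int.cast : ℤ → ZMod N) hdA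
  have hdB : B 0 0 * B 1 1 - B 0 1 * B 1 0 = 1 := by
    have := B.2; rw [Matrix.det_fin_two] at this; exact this
  have hdB' : ((B 0 0 : ℤ) : ZMod N) * (B 1 1 : ℤ) - (B 0 1 : ℤ) * (B 1 0 : ℤ) = 1 := by
    exact_mod_cast congrArg (Int.cast : ℤ → ZMod N) hdB
  have hDm : D.1 = !![A 1 1, -A 0 1; -A 1 0, A 0 0] * B.1 := by
    rw [hD]
    rw [Matrix.SpecialLinearGroup.coe_mul, Matrix.SpecialLinearGroup.SL2_inv_expl]
    rfl
  have D00 : D 0 0 = A 1 1 * B 0 0 - A 0 1 * B 1 0 := by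
    have := congrFun (congrFun hDm 0) 0
    simp [Matrix.mul_apply, Fin.sum_univ_two] at this
    rw [this]; ring
  have D10 : D 1 0 = -A 1 0 * B 0 0 + A 0 0 * B 1 0 := by
    have := congrFun (congrFun hDm 1) 0
    simp [Matrix.mul_apply, Fin.sum_univ_two] at this
    rw [this]; ring
  have D11 : D 1 1 = -A 1 0 * B 0 1 + A 0 0 * B 1 1 := by
    have := congrFun (congrFun hDm 1) 1
    simp [Matrix.mul_apply, Fin.sum_univ_two] at this
    rw [this]; ring
  have hδ : D * ModularGroup.T ^ (-k) ∈ CongruenceSubgroup.Gamma N := by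
    rw [CongruenceSubgroup.Gamma_mem]
    have hT : (D * ModularGroup.T ^ (-k)).1 = D.1 * !![1, -k; 0, 1] := by
      rw [Matrix.SpecialLinearGroup.coe_mul, ModularGroup.coe_T_zpow]
    have e00 : (D * ModularGroup.T ^ (-k)) 0 0 = D 0 0 := by
      rw [show (D * ModularGroup.T ^ (-k)) 0 0 = _ from congrFun (congrFun hT 0) 0]
      simp [Matrix.mul_apply, Fin.sum_univ_two]
    have e01 : (D * ModularGroup.T ^ (-k)) 0 1 = - k * D 0 0 + D 0 1 := by
      rw [show (D * ModularGroup.T ^ (-k)) 0 1 = _ from congrFun (congrFun hT 0) 1]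
      simp [Matrix.mul_apply, Fin.sum_univ_two]; ring
    have e10 : (D * ModularGroup.T ^ (-k)) 1 0 = D 1 0 := by
      rw [show (D * ModularGroup.T ^ (-k)) 1 0 = _ from congrFun (congrFun hT 1) 0]
      simp [Matrix.mul_apply, Fin.sum_univ_two]
    have e11 : (D * ModularGroup.T ^ (-k)) 1 1 = - k * D 1 0 + D 1 1 := by
      rw [show (D * ModularGroup.T ^ (-k)) 1 1 = _ from congrFun (congrFun hT 1) 1]
      simp [Matrix.mul_apply, Fin.sum_univ_two]; ring
    have m00 : ((D 0 0 : ℤ) : ZMod N) = 1 := by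
      rw [D00]; push_cast; rw [← hc1, ← hc2, ← hdA']; ring
    have m10 : ((D 1 0 : ℤ) : ZMod N) = 0 := by
      rw [D10]; push_cast; rw [← hc1, ← hc2]; ring
    have m11 : ((D 1 1 : ℤ) : ZMod N) = 1 := by
      rw [D11]; push_cast; rw [hc1, hc2, ← hdB']; ring
    refine ⟨?_, ?_, ?_, ?_⟩
    · rw [e00, m00]
    · rw [e01, ← hk]; push_cast; rw [m00]; ring
    · rw [e10, m10]
    · rw [e11]; push_cast; rw [m10, m11]; ring
  refine ⟨A * (D * ModularGroup.T ^ (-k)) * A⁻¹, (CongruenceSubgroup.Gamma_normal N).conj_mem _ hδ A, k, ?_⟩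
  rw [hD]
  group

lemma actA_gamma {N : ℕ} {A : SL(2, ℤ)} (hA : A ∈ CongruenceSubgroup.Gamma N) (a : ZMod N × ZMod N) : actA A a = a := by
  rw [CongruenceSubgroup.Gamma_mem] at hA
  obtain ⟨h1, h2, h3, h4⟩ := hA
  unfold actA
  rw [h1, h2, h3, h4]; simp

lemma actA_ne {N : ℕ} (A : SL(2, ℤ)) {a : ZMod N × ZMod N} (ha : a ≠ 0) : actA A a ≠ 0 := by
  intro h
  apply ha
  have hd : A 0 0 * A 1 1 - A 0 1 * A 1 0 = 1 := by
    have := A.2; rw [Matrix.det_fin_two] at this; exact this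
  have hd' : ((A 0 0 : ℤ) : ZMod N) * (A 1 1 : ℤ) - (A 0 1 : ℤ) * (A 1 0 : ℤ) = 1 := by
    exact_mod_cast congrArg (Int.cast : ℤ → ZMod N) hd
  have h1 : a.1 * (A 0 0 : ℤ) + a.2 * (A 1 0 : ℤ) = 0 := congrArg Prod.fst h
  have h2 : a.1 * (A 0 1 : ℤ) + a.2 * (A 1 1 : ℤ) = 0 := congrArg Prod.snd h
  refine Prod.ext ?_ ?_
  · show a.1 = 0
    linear_combination (A 1 1 : ℤ) * h1 - (A 1 0 : ℤ) * h2 - a.1 * hd'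
  · show a.2 = 0
    linear_combination (A 0 0 : ℤ) * h2 - (A 0 1 : ℤ) * h1 - a.2 * hd'

lemma step1 (f : ℍ → ℂ) (hf : IsModularUnit f) : ∃ N : ℕ, ∃ _ : NeZero N,
    (∀ A ∈ CongruenceSubgroup.Gamma N, ∀ z : ℍ, f (A • z) = f z) ∧
    ∃ (M : ℕ) (μ : ZMod N × ZMod N → ℤ) (C : ℂ), 0 < M ∧ C ≠ 0 ∧
      ∀ z, f z ^ M = C * ∏ a ∈ Finset.univ.erase 0, SG N a z ^ μ a := by
  obtain ⟨hd, hne, ⟨N, hN, hinv⟩, hcusp⟩ := hf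
  have : NeZero N := ⟨hN.ne'⟩
  refine ⟨N, inferInstance, hinv, ?_⟩
  have h1 : ∀ A : SL(2, ℤ), ∃ x : ℚ, HE (fun z => f (A • z)) (x:ℝ) := by
    intro A
    obtain ⟨α, κ, hκ, h⟩ := hcusp A
    have hA : HE (fun z => f (A • z)) α := ⟨κ, hκ, h⟩
    obtain ⟨x, rfl⟩ := HE.rat hA hN (fun z => by
      have hT : ModularGroup.T ^ (N:ℤ) ∈ CongruenceSubgroup.Gamma N := by
        have := CongruenceSubgroup.ModularGroup_T_pow_mem_Gamma (N:ℤ) (N:ℤ) dvd_rfl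
        simpa using this
      have := hinv _ ((CongruenceSubgroup.Gamma_normal N).conj_mem _ hT A) (A • z)
      rw [← mul_smul] at this
      rw [← this, ← mul_smul]
      congr 2
      group)
    exact ⟨x, hA⟩
  choose α hα using h1
  have hcol : ∀ A B : SL(2, ℤ), colN N A = colN N B → α A = α B := by
    intro A B h
    obtain ⟨γ, hγ, k, rfl⟩ := colN_eq A B h
    have := (hα A).T k
    have h2 : HE (fun z => f ((γ * A * ModularGroup.T ^ k) • z)) (α A) := by
      convert this using 2 with z
      rw [mul_smul, mul_smul, hinv γ hγ]
    exact_mod_cast h2.unique (hα _)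
  have hneg : ∀ A : SL(2, ℤ), α (-A) = α A := by
    intro A
    have := hα (-A)
    simp only [ModularGroup.SL_neg_smul] at this
    exact_mod_cast this.unique (hα A)
  have hcneg : ∀ A : SL(2, ℤ), colN N (-A) = - colN N A := by
    intro A; unfold colN; simp
  classical
  let φ : ZMod N × ZMod N → ℚ := fun v => if h : ∃ A, colN N A = v then α h.choose else 0
  have hφ : ∀ A, φ (colN N A) = α A := by
    intro A
    have h : ∃ B, colN N B = colN N A := ⟨A, rfl⟩
    show (if h : ∃ B, colN N B = colN N A then α h.choose else 0) = α A
    rw [dif_pos h]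
    exact hcol _ _ h.choose_spec
  have hφe : ∀ v, φ (-v) = φ v := by
    intro v
    by_cases h : ∃ A, colN N A = v
    · obtain ⟨A, rfl⟩ := h
      rw [← hcneg, hφ, hφ, hneg]
    · have h' : ¬ ∃ A, colN N A = -v := by
        rintro ⟨A, hA⟩
        exact h ⟨-A, by rw [hcneg, hA, neg_neg]⟩
      show (if h : ∃ B, colN N B = -v then α h.choose else 0) = (if h : ∃ B, colN N B = v then α h.choose else 0)
      rw [dif_neg h, dif_neg h']
  obtain ⟨m, hm⟩ := LA φ hφe
  let M : ℕ := ∏ a, (m a).den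
  have hM : 0 < M := Finset.prod_pos fun a _ => (m a).pos
  have hn : ∀ a, ∃ n : ℤ, (n : ℚ) = M * m a := by
    intro a
    obtain ⟨k, hk⟩ : (m a).den ∣ M := Finset.dvd_prod_of_mem _ (Finset.mem_univ a)
    refine ⟨k * (m a).num, ?_⟩
    rw [hk]; push_cast
    have := Rat.mul_den_eq_num (m a)
    linear_combination (-(k:ℚ)) * this
  choose n hn using hn
  set c : ℚ := 12 * N^2 * M * m 0 * beta N 0 with hc
  let G : ℍ → ℂ := fun z => f z ^ ((12 * N^2 * M : ℕ) : ℤ) * ∏ a ∈ Finset.univ.erase 0, SG N a z ^ (- n a)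
  have hG : ∀ A : SL(2, ℤ), HE (fun z => G (A • z)) (c : ℝ) := by
    intro A
    have e1 := (hα A).zpow ((12 * N^2 * M : ℕ) : ℤ)
    have e2 := HE.prod (Finset.univ.erase (0 : ZMod N × ZMod N)) (f := fun a z => SG N a (A • z) ^ (- n a))
      (α := fun a => ((-n a : ℤ) : ℝ) * ((12 * N^2 * beta N (actA A a).1 : ℚ) : ℝ)) (fun a ha => by
        refine HE.zpow ?_ _
        simp only [SG_A]
        exact SG_HE _ (actA_ne A (Finset.ne_of_mem_erase ha)))
    have e3 := e1.mul e2
    convert e3 using 1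
    have hs := hm (colN N A)
    rw [hφ, ← Finset.add_sum_erase _ _ (Finset.mem_univ 0)] at hs
    have hb : ∀ a, beta N (dotp a (colN N A)) = beta N (actA A a).1 := fun a => rfl
    simp only [hb] at hs
    have h0 : (actA A (0 : ZMod N × ZMod N)).1 = 0 := by simp [actA]
    rw [h0] at hs
    have : c = ((12 * N^2 * M : ℕ) : ℤ) * α A + ∑ a ∈ Finset.univ.erase 0, ((-n a : ℤ) : ℚ) * (12 * N^2 * beta N (actA A a).1) := by
      rw [hs, hc]
      have : ∀ a, ((-n a : ℤ) : ℚ) * (12 * N^2 * beta N (actA A a).1) = - (12 * N^2 * M) * (m a * beta N (actA A a).1) := by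
        intro a; push_cast; rw [hn a]; ring
      simp only [this]
      rw [← Finset.mul_sum]
      push_cast; ring
    exact_mod_cast congrArg (Rat.cast : ℚ → ℝ) this
  have hprodne : ∀ z, ∀ μ : ZMod N × ZMod N → ℤ, ∏ a ∈ Finset.univ.erase 0, SG N a z ^ μ a ≠ 0 := by
    intro z μ
    exact Finset.prod_ne_zero_iff.2 fun a ha => zpow_ne_zero _ (SG_ne a (Finset.ne_of_mem_erase ha) z)
  have hGne : ∀ z, G z ≠ 0 := fun z => mul_ne_zero (zpow_ne_zero _ (hne z)) (hprodne z _)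
  have hGinv : ∀ A ∈ CongruenceSubgroup.Gamma N, ∀ z : ℍ, G (A • z) = G z := by
    intro A hA z
    simp only [G, hinv A hA, SG_A, actA_gamma hA]
  have mz : ∀ (g : ℍ → ℂ), MDifferentiable 𝓘(ℂ) 𝓘(ℂ) g → (∀ z, g z ≠ 0) → ∀ k : ℤ,
      MDifferentiable 𝓘(ℂ) 𝓘(ℂ) (fun z => g z ^ k) := by
    intro g hg hg0 k
    rw [UpperHalfPlane.mdifferentiable_iff] at hg ⊢
    exact fun z hz => (hg z hz).zpow (Or.inl (hg0 _))
  have hGd : MDifferentiable 𝓘(ℂ) 𝓘(ℂ) G := by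
    have h1 := mz f hd hne ((12 * N^2 * M : ℕ) : ℤ)
    have h2 : MDifferentiable 𝓘(ℂ) 𝓘(ℂ) (fun z => ∏ a ∈ Finset.univ.erase (0 : ZMod N × ZMod N), SG N a z ^ (- n a)) := by
      rw [UpperHalfPlane.mdifferentiable_iff]
      have : ∀ a ∈ Finset.univ.erase (0 : ZMod N × ZMod N), DifferentiableOn ℂ ((fun z => SG N a z ^ (-n a)) ∘ ofComplex) {z | 0 < z.im} := by
        intro a ha
        have ha := Finset.ne_of_mem_erase ha
        have := mz _ (SG_diff a ha) (SG_ne a ha) (-n a)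
        rwa [UpperHalfPlane.mdifferentiable_iff] at this
      have := DifferentiableOn.fun_finsetProd this
      exact this
    rw [UpperHalfPlane.mdifferentiable_iff] at h1 h2 ⊢
    exact h1.mul h2
  have hGc : ∃ C : ℂ, ∀ z, G z = C := by
    rcases le_total 0 c with hc0 | hc0
    · exact const_of_bdd G hGd hGinv fun A => (hG A).bdd (by exact_mod_cast hc0)
    · obtain ⟨C, hC⟩ := const_of_bdd (N := N) (fun z => G z ^ (-1 : ℤ)) (mz G hGd hGne _) (fun A hA z => by rw [hGinv A hA])
        fun A => ((hG A).zpow (-1)).bdd (by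
          have : (c:ℝ) ≤ 0 := by exact_mod_cast hc0
          push_cast; linarith)
      refine ⟨C⁻¹, fun z => ?_⟩
      rw [← hC z]; simp
  obtain ⟨C, hC⟩ := hGc
  refine ⟨12 * N^2 * M, n, C, by positivity, ?_, fun z => ?_⟩
  · rw [← hC UpperHalfPlane.I]; exact hGne _
  · rw [← hC z]
    simp only [G]
    rw [mul_assoc (f z ^ _), ← Finset.prod_mul_distrib, Finset.prod_eq_one, mul_one]
    · rw [zpow_natCast]
    · intro a ha
      rw [← zpow_add₀ (SG_ne a (Finset.ne_of_mem_erase ha) z)]; simp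

lemma psum_diff {c : ℕ → ℂ} (h : ∀ t ∈ Metric.ball (0:ℂ) 1, Summable (fun n => c n * t ^ n)) :
    DifferentiableOn ℂ (fun t => ∑' n, c n * t ^ n) (Metric.ball 0 1) := by
  intro t ht
  have ht' : ‖t‖ < 1 := by simpa using ht
  obtain ⟨r, hr1, hr2⟩ := exists_between ht'
  have hr0 : 0 ≤ r := (norm_nonneg t).trans hr1.le
  have hs := (h (r:ℂ) (by simpa [abs_of_nonneg hr0] using hr2)).norm
  have := differentiableOn_tsum_of_summable_norm (F := fun n (t:ℂ) => c n * t ^ n) (U := Metric.ball 0 r) hs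
    (fun n => by fun_prop) Metric.isOpen_ball (fun n w hw => by
      have hw' : ‖w‖ < r := by simpa using hw
      rw [norm_mul, norm_mul, norm_pow, norm_pow]
      have : ‖(r:ℂ)‖ = r := by simp [abs_of_nonneg hr0]
      rw [this]
      gcongr)
  have hm : t ∈ Metric.ball (0:ℂ) r := by simpa using hr1
  exact ((this t hm).differentiableAt (Metric.isOpen_ball.mem_nhds hm)).differentiableWithinAt

lemma exists_tN (N : ℕ) [NeZero N] {t : ℂ} (ht0 : t ≠ 0) (ht : ‖t‖ < 1) : ∃ z : ℍ, tN N z = t := by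
  have hN : (0:ℝ) < N := by exact_mod_cast NeZero.pos N
  have hNc : (N:ℂ) ≠ 0 := by exact_mod_cast NeZero.ne N
  have hlog : Real.log ‖t‖ < 0 := Real.log_neg (norm_pos_iff.2 ht0) ht
  set w : ℂ := -Complex.I * ((N / (2 * π) : ℝ) : ℂ) * Complex.log t with hw
  have him : 0 < w.im := by
    have : w = ((N / (2 * π) : ℝ) : ℂ) * (-Complex.I * Complex.log t) := by rw [hw]; ring
    rw [this, Complex.im_ofReal_mul]
    have h2 : (-Complex.I * Complex.log t).im = - Real.log ‖t‖ := by simp [Complex.log_re]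
    rw [h2]
    have : 0 < - Real.log ‖t‖ := by linarith
    have := Real.pi_pos
    positivity
  refine ⟨⟨w, him⟩, ?_⟩
  unfold tN
  have hpi : (π:ℂ) ≠ 0 := by exact_mod_cast Real.pi_ne_zero
  have : 2 * π * Complex.I * w / N = Complex.log t := by
    rw [hw]; push_cast
    field_simp
    linear_combination (-Complex.log t) * Complex.I_sq
  show cexp (2 * π * Complex.I * w / N) = t
  rw [this, Complex.exp_log ht0]

lemma tN_pow (N : ℕ) [NeZero N] (z : ℍ) : tN N z ^ N = tN 1 z := by
  have hNc : (N:ℂ) ≠ 0 := by exact_mod_cast NeZero.ne N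
  unfold tN
  rw [← Complex.exp_nat_mul]; congr 1; push_cast; field_simp

lemma eq_one_of_exp {R : ℍ → ℂ} {C : ℂ} {y : ℝ} (hC : C ≠ 0) (hR : Tendsto R atImInfty (𝓝 1))
    (h : ∀ z : ℍ, R z = C * cexp (2 * (π : ℂ) * Complex.I * (y : ℂ) * (z : ℂ))) : ∀ z, R z = 1 := by
  have h0 : HE R 0 := ⟨1, one_ne_zero, by simpa using hR⟩
  have h1 : HE R y := ⟨C, hC, by
    refine tendsto_const_nhds.congr fun z => ?_
    rw [h, mul_assoc, ← Complex.exp_add]; simp⟩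
  have hy := h0.unique h1
  subst hy
  have h2 : ∀ z, R z = C := fun z => by rw [h]; simp
  have : C = 1 := tendsto_nhds_unique (tendsto_const_nhds.congr fun z => (h2 z).symm) hR
  intro z; rw [h2, this]

lemma step2a {N : ℕ} [NeZero N] {f : ℍ → ℂ} {M : ℕ} {μ : ZMod N × ZMod N → ℤ} {C : ℂ} (hC : C ≠ 0)
    (h : ∀ z, f z ^ M = C * ∏ a ∈ Finset.univ.erase 0, SG N a z ^ μ a)
    {s : ℝ} {φ : ℂ → ℂ} {b : ℕ → ℂ} (hφ : LD φ b)
    (hf : ∀ z : ℍ, f z = cexp (2 * π * Complex.I * s * z) * φ (tN 1 z)) :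
    ∀ t ∈ Metric.ball (0:ℂ) 1, φ (t ^ N) ^ M = ∏ a ∈ Finset.univ.erase 0, QA N a t ^ (24 * N^2 * μ a) := by
  have hK : ∀ a : ZMod N × ZMod N, ∃ K : ℂ, K ≠ 0 ∧ (a ≠ 0 → ∀ τ : ℍ,
    SG N a τ = K * cexp (2 * π * Complex.I * (12 * N^2 * beta N a.1 : ℚ) * τ) * QA N a (tN N τ) ^ (24 * N^2)) := by
    intro a
    by_cases ha : a = 0
    · exact ⟨1, one_ne_zero, fun h => absurd ha h⟩
    · obtain ⟨K, hK, hh⟩ := SG_prod a ha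
      exact ⟨K, hK, fun _ => hh⟩
  choose K hK hKK using hK
  have L1 := (hφ.comp_pow (NeZero.pos N)).zpow (M:ℤ)
  have L2 := LD.prod (Finset.univ.erase (0 : ZMod N × ZMod N)) (F := fun a t => QA N a t ^ (24 * N^2 * μ a)) (fun a _ => (QA_LD a).zpow (24 * N^2 * μ a))
  have L3 := L1.mul (L2.zpow (-1))
  set W : ℂ → ℂ := fun t => φ (t ^ N) ^ (M:ℤ) * (∏ a ∈ Finset.univ.erase (0 : ZMod N × ZMod N), QA N a t ^ (24 * N^2 * μ a)) ^ (-1:ℤ) with hW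
  have hWt : Tendsto (fun z : ℍ => W (tN N z)) atImInfty (𝓝 1) := by
    have hc : ContinuousAt W 0 := (L3.diffAt (by simp)).continuousAt
    have := hc.tendsto.comp (tendsto_tN N)
    have h0 : W 0 = 1 := L3.zero
    rw [h0] at this
    exact this
  set C' : ℂ := C * ∏ a ∈ Finset.univ.erase (0 : ZMod N × ZMod N), K a ^ μ a with hC'
  set y : ℚ := ∑ a ∈ Finset.univ.erase (0 : ZMod N × ZMod N), μ a * (12 * N^2 * beta N a.1) with hy
  have hR : ∀ z : ℍ, W (tN N z) = C' * cexp (2 * (π : ℂ) * Complex.I * ((y - M * s : ℝ) : ℂ) * (z : ℂ)) := by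
    intro z
    have hz := h z
    rw [hf, ← tN_pow N] at hz
    have e1 : ∏ a ∈ Finset.univ.erase (0 : ZMod N × ZMod N), SG N a z ^ μ a =
      (∏ a ∈ Finset.univ.erase (0 : ZMod N × ZMod N), K a ^ μ a) * cexp (2 * π * Complex.I * y * z) * ∏ a ∈ Finset.univ.erase (0 : ZMod N × ZMod N), QA N a (tN N z) ^ (24 * N^2 * μ a) := by
      have : cexp (2 * π * Complex.I * y * z) = ∏ a ∈ Finset.univ.erase (0 : ZMod N × ZMod N), cexp (2 * π * Complex.I * (12 * N^2 * beta N a.1 : ℚ) * z) ^ μ a := by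
        rw [hy]; push_cast
        rw [Finset.mul_sum, Finset.sum_mul, Complex.exp_sum]
        refine Finset.prod_congr rfl fun a _ => ?_
        rw [← Complex.exp_int_mul]; congr 1; ring
      rw [this, ← Finset.prod_mul_distrib, ← Finset.prod_mul_distrib]
      refine Finset.prod_congr rfl fun a ha => ?_
      rw [hKK a (Finset.ne_of_mem_erase ha), mul_zpow, mul_zpow]
      congr 1
      rw [← zpow_natCast, ← _root_.zpow_mul]
      push_cast; rfl
    have hP := L2.ne (tN N z) (tN_mem (N := N) z)
    rw [e1] at hz
    simp only [hW]
    set P := ∏ a ∈ Finset.univ.erase (0 : ZMod N × ZMod N), QA N a (tN N z) ^ (24 * N^2 * μ a)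
    rw [mul_pow, ← Complex.exp_nat_mul] at hz
    have e2 : cexp (2 * (π : ℂ) * Complex.I * ((y - M * s : ℝ) : ℂ) * (z : ℂ)) = cexp (2 * π * Complex.I * y * z) * cexp (-(M * (2 * π * Complex.I * s * z))) := by
      rw [← Complex.exp_add]; congr 1; push_cast; ring
    have e3 : cexp (M * (2 * π * Complex.I * s * z)) * cexp (-(M * (2 * π * Complex.I * s * z))) = 1 := by
      rw [← Complex.exp_add]; simp
    rw [e2, zpow_natCast, _root_.zpow_neg_one, ← div_eq_mul_inv, div_eq_iff hP, hC']
    linear_combination cexp (-(M * (2 * π * Complex.I * s * z))) * hz - φ (tN N z ^ N) ^ M * e3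
  have hC'0 : C' ≠ 0 := mul_ne_zero hC (Finset.prod_ne_zero_iff.2 fun a _ => zpow_ne_zero _ (hK a))
  have hW1 := eq_one_of_exp hC'0 hWt hR
  have hfin : ∀ t ∈ Metric.ball (0:ℂ) 1, W t = 1 := by
    intro t ht
    by_cases ht0 : t = 0
    · rw [ht0]; exact L3.zero
    · obtain ⟨z, rfl⟩ := exists_tN N ht0 (by simpa using ht)
      exact hW1 z
  intro t ht
  have := hfin t ht
  simp only [hW] at this
  have hP := L2.ne _ ht
  rw [zpow_natCast, _root_.zpow_neg_one, ← div_eq_mul_inv, div_eq_iff hP, one_mul] at this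
  exact this

lemma LD.b0 {F b} (h : LD F b) : b 0 = 0 := by
  have h1 := h.hs 0 (by simp)
  have h2 := hasSum_single (f := fun n => b n * (0:ℂ) ^ n) 0 (fun n hn => by simp [hn])
  have := h1.unique h2
  simpa using this.symm

lemma qcoef_eq {N : ℕ} [NeZero N] (u v : ZMod N) (n : ℕ) : qcoef N u (ZMod.stdAddChar v) n =
    ∑ d ∈ n.divisors, (d:ℂ) * (if (d : ZMod N) = u then (ZMod.stdAddChar (v * ((n / d : ℕ) : ZMod N)) : ℂ) else 0) := by
  unfold qcoef
  rw [Nat.sum_divisorsAntidiagonal (f := fun x y => if (x : ZMod N) = u then (x : ℂ) * (ZMod.stdAddChar v : ℂ) ^ y else 0)]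
  refine Finset.sum_congr rfl fun d _ => ?_
  have : (ZMod.stdAddChar (v * ((n / d : ℕ) : ZMod N)) : ℂ) = (ZMod.stdAddChar v : ℂ) ^ (n / d) := by
    rw [← AddChar.map_nsmul_eq_pow]; congr 1; simp [mul_comm]
  rw [this]
  split_ifs <;> simp

lemma step2b {N : ℕ} [NeZero N] {M : ℕ} (hM : 0 < M) {μ : ZMod N × ZMod N → ℤ} {φ : ℂ → ℂ} {b : ℕ → ℂ} (hφ : LD φ b)
    (h : ∀ t ∈ Metric.ball (0:ℂ) 1, φ (t ^ N) ^ M = ∏ a ∈ Finset.univ.erase 0, QA N a t ^ (24 * N^2 * μ a))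
    {a : ℕ → ℤ} (ha : ∀ n : ℕ, 0 < n → b n = ∑ d ∈ n.divisors, (d:ℂ) * a d) :
    (∀ n : ℕ, n > 0 → ∀ n' : ℕ, n' > 0 → N ∣ n + n' → a n = a n') ∧ (∀ n : ℕ, n > 0 → N ∣ n → a n = 0) := by
  have hN : 0 < N := NeZero.pos N
  have L1 := (hφ.comp_pow (NeZero.pos N)).zpow (M:ℤ)
  have L2 := LD.prod (Finset.univ.erase (0 : ZMod N × ZMod N)) (F := fun a t => QA N a t ^ (24 * N^2 * μ a)) (fun a _ => (QA_LD a).zpow (24 * N^2 * μ a))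
  have L3 := L2.congr (G := fun t => φ (t ^ N) ^ (M:ℤ)) (fun t ht => by rw [zpow_natCast]; exact (h t ht).symm)
  have hcoef := L1.unique L3
  let A : ℕ → ℤ := fun d => if N ∣ d then M * a (d / N) else 0
  let c : ZMod N → ZMod N → ℂ := fun d e => ∑ w ∈ Finset.univ.erase (0 : ZMod N × ZMod N), ((24 * N^2 * μ w : ℤ) : ℂ) *
    ((if d = w.1 then (ZMod.stdAddChar (w.2 * e) : ℂ) else 0) + (if d = -w.1 then (ZMod.stdAddChar ((-w.2) * e) : ℂ) else 0))
  have key := NT_main c A ?_ ?_ ?_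
  · obtain ⟨k1, k2⟩ := key
    have hMz : (M:ℤ) ≠ 0 := by exact_mod_cast hM.ne'
    have hA : ∀ n, A (N * n) = M * a n := by
      intro n; simp [A, Nat.mul_div_cancel_left n hN]
    refine ⟨fun n hn n' hn' hd => ?_, fun n hn hd => ?_⟩
    · have := k1 (N * n) (by positivity) (N * n') (by positivity) (by
        rw [← mul_add, pow_two]; exact mul_dvd_mul_left _ hd)
      rw [hA, hA] at this
      exact mul_left_cancel₀ hMz this
    · have := k2 (N * n) (by positivity) (by rw [pow_two]; exact mul_dvd_mul_left _ hd)
      rw [hA] at this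
      exact (mul_eq_zero.1 this).resolve_left hMz
  · intro n hn
    have e := congrFun hcoef n
    simp only [qcoef_eq] at e
    have e2 : ∑ d ∈ n.divisors, (d:ℂ) * c d ((n / d : ℕ) : ZMod N) = ∑ i ∈ Finset.univ.erase (0 : ZMod N × ZMod N), ((24 * N^2 * μ i : ℤ) : ℂ) *
      (∑ d ∈ n.divisors, (d:ℂ) * (if (d : ZMod N) = i.1 then (ZMod.stdAddChar (i.2 * ((n / d : ℕ) : ZMod N)) : ℂ) else 0) +
       ∑ d ∈ n.divisors, (d:ℂ) * (if (d : ZMod N) = -i.1 then (ZMod.stdAddChar (-i.2 * ((n / d : ℕ) : ZMod N)) : ℂ) else 0)) := by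
      simp only [c, Finset.mul_sum, ← Finset.sum_add_distrib]
      rw [Finset.sum_comm]
      refine Finset.sum_congr rfl fun w _ => Finset.sum_congr rfl fun d _ => ?_
      ring
    rw [e2, ← e]
    by_cases hd : N ∣ n
    · obtain ⟨k, rfl⟩ := hd
      have hk : 0 < k := Nat.pos_of_mul_pos_left hn
      rw [if_pos (dvd_mul_right _ _), Nat.mul_div_cancel_left k hN, ha k hk]
      have hsub : (k.divisors.image (fun d => N * d)) ⊆ (N * k).divisors := by
        intro x hx
        rw [Finset.mem_image] at hx
        obtain ⟨d, hd, rfl⟩ := hx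
        rw [Nat.mem_divisors] at hd ⊢
        exact ⟨mul_dvd_mul_left _ hd.1, hn.ne'⟩
      rw [← Finset.sum_subset hsub]
      · rw [Finset.sum_image (fun x _ y _ hxy => Nat.eq_of_mul_eq_mul_left hN hxy), Finset.mul_sum, Finset.mul_sum]
        refine Finset.sum_congr rfl fun d _ => ?_
        simp [A, Nat.mul_div_cancel_left d hN]; ring
      · intro d hd1 hd2
        have : ¬ N ∣ d := by
          rintro ⟨d', rfl⟩
          apply hd2
          rw [Finset.mem_image]
          refine ⟨d', ?_, rfl⟩
          rw [Nat.mem_divisors] at hd1 ⊢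
          exact ⟨Nat.dvd_of_mul_dvd_mul_left hN hd1.1, hk.ne'⟩
        simp [A, this]
    · rw [if_neg hd, mul_zero]
      refine Finset.sum_eq_zero fun d hd1 => ?_
      have : ¬ N ∣ d := fun h => hd (h.trans (Nat.dvd_of_mem_divisors hd1))
      simp [A, this]
  · intro d e
    simp only [c]
    refine Finset.sum_congr rfl fun w _ => ?_
    congr 1
    rw [add_comm]
    simp only [neg_inj, neg_mul_neg, mul_neg, neg_mul, neg_neg, neg_eq_iff_eq_neg]
  · simp only [c]
    rw [Finset.sum_comm]
    refine Finset.sum_eq_zero fun w hw => ?_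
    rw [← Finset.mul_sum, Finset.sum_add_distrib]
    by_cases h1 : w.1 = 0
    · have h2 : w.2 ≠ 0 := fun h2 => Finset.ne_of_mem_erase hw (Prod.ext h1 h2)
      have s1 : ∀ v : ZMod N, v ≠ 0 → ∑ e : ZMod N, (ZMod.stdAddChar (v * e) : ℂ) = 0 := by
        intro v hv
        have := AddChar.sum_mulShift v (ZMod.isPrimitive_stdAddChar N)
        rw [if_neg hv] at this
        simp only [mul_comm v]
        simpa using this
      simp only [h1, neg_zero, if_true]
      rw [s1 _ h2, s1 _ (neg_ne_zero.2 h2)]; simp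
    · simp [Ne.symm h1, h1]

lemma sub_tprod {l ρ : ℕ} (h0 : 0 < ρ) (hl : ρ < l) {r : ℤ} (hr : r ≡ ρ [ZMOD l]) (z : ℍ) :
    ∏' n : {n : ℤ // 0 < n ∧ n ≡ r [ZMOD (l:ℤ)]},
      (1 - Complex.exp (2 * (π : ℂ) * Complex.I * ((n : ℤ) : ℂ) * (z : ℂ)))⁻¹ = (QQ l ρ 1 (tN 1 z))⁻¹ := by
  have hl0 : 0 < l := h0.trans hl
  let e : ℕ → {n : ℤ // 0 < n ∧ n ≡ r [ZMOD (l:ℤ)]} := fun k => ⟨ρ + l * k, by positivity, by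
    refine Int.ModEq.trans ?_ hr.symm
    simp [Int.ModEq]⟩
  have hb : Function.Bijective e := by
    constructor
    · intro x y hxy
      have := congrArg Subtype.val hxy
      simp only [e] at this
      have h2 : (l:ℤ) * x = l * y := by linarith
      have h3 := mul_left_cancel₀ (by positivity : (l:ℤ) ≠ 0) h2
      exact_mod_cast h3
    · rintro ⟨n, hn, hm⟩
      have h1 : (ρ:ℤ) ≡ n [ZMOD l] := (hm.trans hr).symm
      obtain ⟨k, hk⟩ := h1.dvd
      have hk0 : 0 ≤ k := by
        by_contra hneg
        have : k ≤ -1 := by omega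
        have : (l:ℤ) * k ≤ l * (-1) := by gcongr
        have : (ρ:ℤ) < l := by exact_mod_cast hl
        linarith
      lift k to ℕ using hk0
      exact ⟨k, Subtype.ext (by simp only [e]; linarith)⟩
  rw [← (Equiv.ofBijective e hb).tprod_eq]
  have hm := QQ_mult (N := l) (ρ := ρ) hl0 (ζ := 1) (t := tN 1 z) (by simp) (tN_norm z)
  have hne : QQ l ρ 1 (tN 1 z) ≠ 0 := (QQ_LD h0 hl.le (by simp)).ne _ (tN_mem z)
  have hp : HasProd (fun n : ℕ => (1 - 1 * tN 1 z ^ (ρ + l * n))) (QQ l ρ 1 (tN 1 z)) := hm.hasProd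
  have hp2 := HasProd.inv₀ hp hne
  rw [← hp2.tprod_eq]
  refine tprod_congr fun k => ?_
  simp only [Equiv.ofBijective_apply, e, Pi.inv_apply, one_mul]
  congr 2
  unfold tN
  rw [← Complex.exp_nat_mul]; congr 1; push_cast; ring

lemma rl_eq {l r : ℕ} [NeZero l] (h0 : 0 < r) (hl : r < l) (z : ℍ) :
    rl l r z = cexp (2 * π * Complex.I * ((-(l * beta l (r : ZMod l) / 2) : ℚ) : ℝ) * z) * (QA l ((r : ZMod l), 0) (tN 1 z))⁻¹ := by
  have hv : (r : ZMod l).val = r := ZMod.val_cast_of_lt hl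
  have hne : (r : ZMod l) ≠ 0 := by
    intro h; rw [h] at hv; simp at hv; omega
  unfold rl QA
  rw [sub_tprod (ρ := r) h0 hl (Int.ModEq.refl _), sub_tprod (ρ := l - r) (by omega) (by omega) (by
    rw [Nat.cast_sub hl.le]; simp [Int.modEq_iff_dvd])]
  rw [if_neg hne]
  simp only [hv, neg_zero, AddChar.map_zero_eq_one, mul_inv, mul_assoc]
  have hf : Int.fract ((r:ℝ) / l) = r / l := by
    rw [Int.fract_eq_self]
    have : (0:ℝ) < l := by exact_mod_cast h0.trans hl
    refine ⟨by positivity, ?_⟩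
    rw [div_lt_one this]; exact_mod_cast hl
  congr 5
  unfold bern beta
  rw [hv]
  simp only [Int.cast_natCast]
  rw [hf]; push_cast; rfl

lemma phi_prod {N : ℕ} [NeZero N] {φ : ℂ → ℂ} {b : ℕ → ℂ} (hφ : LD φ b)
    {a : ℕ → ℤ} (ha : ∀ n : ℕ, 0 < n → b n = ∑ d ∈ n.divisors, (d:ℂ) * a d)
    (h1 : ∀ n : ℕ, n > 0 → ∀ n' : ℕ, n' > 0 → N ∣ n + n' → a n = a n') (h2 : ∀ n : ℕ, n > 0 → N ∣ n → a n = 0) :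
    ∀ t ∈ Metric.ball (0:ℂ) 1, φ t = ∏ i : Fin (N - 1), QA (2 * N) (((i + 1 : ℕ) : ZMod (2 * N)), 0) t ^ a (i + 1) := by
  have hN : 0 < N := NeZero.pos N
  have L := LD.prod (Finset.univ : Finset (Fin (N-1))) (fun i _ => (QA_LD (N := 2 * N) (((i + 1 : ℕ) : ZMod (2 * N)), 0)).zpow (a (i+1)))
  refine hφ.eq (G := fun t => ∏ i : Fin (N - 1), QA (2 * N) (((i + 1 : ℕ) : ZMod (2 * N)), 0) t ^ a (i + 1)) ?_
  convert L using 1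
  funext k
  rcases Nat.eq_zero_or_pos k with rfl | hk
  · rw [hφ.b0]; simp [qcoef]
  rw [ha k hk]
  simp only [qcoef_eq, Finset.mul_sum, ← Finset.sum_add_distrib]
  rw [Finset.sum_comm]
  refine Finset.sum_congr rfl fun d hd => ?_
  have hd0 : 0 < d := Nat.pos_of_mem_divisors hd
  have key : (a d : ℂ) = ∑ i : Fin (N-1), (a (i+1) : ℂ) * ((if (d : ZMod (2*N)) = ((i+1:ℕ) : ZMod (2*N)) then 1 else 0) + (if (d : ZMod (2*N)) = -((i+1:ℕ) : ZMod (2*N)) then 1 else 0)) := by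
    have hc1 : ∀ i : Fin (N-1), ((d : ZMod (2*N)) = ((i+1:ℕ) : ZMod (2*N))) ↔ d % (2*N) = i + 1 := by
      intro i
      rw [ZMod.natCast_eq_natCast_iff, Nat.ModEq, Nat.mod_eq_of_lt (b := 2*N) (a := i+1) (by omega)]
    have hc2 : ∀ i : Fin (N-1), ((d : ZMod (2*N)) = -((i+1:ℕ) : ZMod (2*N))) ↔ d % (2*N) = 2*N - (i + 1) := by
      intro i
      have : -((i+1:ℕ) : ZMod (2*N)) = ((2*N - (i+1) : ℕ) : ZMod (2*N)) := by
        rw [Nat.cast_sub (by omega)]; simp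
      rw [this, ZMod.natCast_eq_natCast_iff, Nat.ModEq, Nat.mod_eq_of_lt (b := 2*N) (a := 2*N-(i+1)) (by omega)]
    simp only [hc1, hc2]
    have hdm := Nat.div_add_mod d (2*N)
    have hlt := Nat.mod_lt d (show 2*N > 0 by omega)
    generalize d / (2*N) = qq at hdm
    generalize hw : d % (2*N) = w at hdm hlt ⊢
    have hdd : d = N * (2 * qq) + w := by rw [← hdm]; ring
    by_cases hw0 : w = 0 ∨ w = N
    · have : N ∣ d := by
        rw [hdd]; refine dvd_add (dvd_mul_right _ _) ?_
        rcases hw0 with rfl | rfl <;> simp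
      rw [h2 d hd0 this, Finset.sum_eq_zero]
      · simp
      · intro i _
        rw [if_neg (by omega), if_neg (by omega)]; simp
    · by_cases hwN : w < N
      · rw [Finset.sum_eq_single ⟨w - 1, by omega⟩]
        · simp only
          rw [if_pos (by omega), if_neg (by omega), show w - 1 + 1 = w by omega]
          have e1 : a d = a (N * 2 - w) := h1 d hd0 _ (by omega) (by
            rw [hdd, show N * (2*qq) + w + (N*2 - w) = N * (2 * qq) + N * 2 by omega, ← mul_add]; exact dvd_mul_right _ _)
          have e2 : a (N * 2 - w) = a w := h1 _ (by omega) _ (by omega) (by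
            rw [show N * 2 - w + w = N * 2 by omega]; exact dvd_mul_right _ _)
          rw [e1, e2]; simp
        · intro i _ hi
          have : (i:ℕ) ≠ w - 1 := fun h => hi (Fin.ext h)
          rw [if_neg (by omega), if_neg (by omega)]; simp
        · simp
      · rw [Finset.sum_eq_single ⟨2 * N - w - 1, by omega⟩]
        · simp only
          rw [if_neg (by omega), if_pos (by omega), show 2 * N - w - 1 + 1 = 2 * N - w by omega]
          have e1 : a d = a (2 * N - w) := h1 d hd0 _ (by omega) (by
            rw [hdd, show N * (2*qq) + w + (2*N - w) = N * (2 * qq) + N * 2 by omega, ← mul_add]; exact dvd_mul_right _ _)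
          rw [e1]; simp
        · intro i _ hi
          have : (i:ℕ) ≠ 2 * N - w - 1 := fun h => hi (Fin.ext h)
          rw [if_neg (by omega), if_neg (by omega)]; simp
        · simp
  rw [key, Finset.mul_sum]
  refine Finset.sum_congr rfl fun i _ => ?_
  simp only [neg_zero, zero_mul, AddChar.map_zero_eq_one]
  ring

def low (c : ℤ) : SL(2, ℤ) := ⟨!![1, 0; c, 1], by simp⟩

lemma coe_low (c : ℤ) (z : ℍ) : ((low c • z : ℍ) : ℂ) = z / (c * z + 1) := by
  rw [UpperHalfPlane.specialLinearGroup_apply]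
  simp [low]

lemma low_mem {N : ℕ} {c : ℤ} (h : (N:ℤ) ∣ c) : low c ∈ CongruenceSubgroup.Gamma N := by
  rw [CongruenceSubgroup.Gamma_mem]
  have : ((c : ℤ) : ZMod N) = 0 := (ZMod.intCast_zmod_eq_zero_iff_dvd c N).2 h
  simp [low, this]

lemma exp_rigid {y : ℝ} {c : ℤ} (hc : c ≠ 0)
    (h : ∀ z : ℍ, ‖cexp (2 * (π : ℂ) * Complex.I * (y : ℂ) * ((low c • z : ℍ) : ℂ))‖ = ‖cexp (2 * (π : ℂ) * Complex.I * (y : ℂ) * (z : ℂ))‖) : y = 0 := by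
  have h1 := h UpperHalfPlane.I
  rw [exp_norm_im, exp_norm_im] at h1
  have h2 := Real.exp_injective h1
  have h3 : (low c • UpperHalfPlane.I : ℍ).im = 1 / (c^2 + 1) := by
    rw [← UpperHalfPlane.coe_im, coe_low]
    simp [Complex.div_im, Complex.normSq_apply, pow_two]
    ring
  rw [h3] at h2
  have h4 : UpperHalfPlane.I.im = 1 := UpperHalfPlane.I_im
  rw [h4] at h2
  have hc' : (0:ℝ) < (c:ℝ)^2 := by positivity
  field_simp at h2
  by_contra hy
  have : (c:ℝ)^2 + 1 = 1 := by
    exact mul_left_cancel₀ hy (by linarith)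
  linarith

lemma rl_inv {l r : ℕ} [NeZero l] (h0 : 0 < r) (hl : r < l) (z : ℍ) :
    rl l r (low (l^2) • z) ^ (24 * l^2) = rl l r z ^ (24 * l^2) := by
  have hv : (r : ZMod l).val = r := ZMod.val_cast_of_lt hl
  have hlr : (0:ℝ) < l := by exact_mod_cast h0.trans hl
  have hlc : (l:ℂ) ≠ 0 := by exact_mod_cast hlr.ne'
  have hne : ((r : ZMod l), (0 : ZMod l)) ≠ 0 := by
    intro h
    have := congrArg Prod.fst h
    simp only [Prod.fst_zero] at this
    rw [this] at hv; simp at hv; omega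
  obtain ⟨K, hK, hS⟩ := SG_prod _ hne
  let ml : ℍ → ℍ := fun z => ⟨l * z, by
    have := z.im_pos
    rw [show ((l:ℂ) * (z:ℂ)).im = l * z.im by simp]; positivity⟩
  have hml : ∀ z, ((ml z : ℍ) : ℂ) = l * z := fun z => rfl
  have e1 : ∀ z, rl l r z ^ (24 * l^2) = K * (SG l ((r : ZMod l), 0) (ml z))⁻¹ := by
    intro z
    have ht : tN l (ml z) = tN 1 z := by
      unfold tN; rw [hml]; congr 1; push_cast; field_simp
    rw [hS, rl_eq h0 hl, ht, mul_pow, ← Complex.exp_nat_mul, hml, mul_inv, mul_inv, mul_assoc K⁻¹, mul_inv_cancel_left₀ hK, ← Complex.exp_neg, inv_pow]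
    congr 2
    push_cast; ring
  rw [e1, e1]
  have e2 : ml (low (l^2) • z) = low l • ml z := by
    apply UpperHalfPlane.ext
    rw [hml, coe_low, coe_low, hml]; push_cast
    rw [mul_div_assoc]; congr 2; ring
  rw [e2, SG_A, actA_gamma (low_mem dvd_rfl)]

lemma final_main (f : ℍ → ℂ) (hf : IsModularUnit f) {s : ℝ} {φ : ℂ → ℂ} {c : ℕ → ℤ}
    (hc0 : c 0 = 1)
    (hφ : ∀ t ∈ Metric.ball (0:ℂ) 1, HasSum (fun n => (c n:ℂ) * t ^ n) (φ t))
    (hfφ : ∀ z : ℍ, f z = cexp (2 * π * Complex.I * s * z) * φ (tN 1 z)) :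
    ∃ (k : ℕ) (r L m : Fin k → ℤ),
      (∀ i, 1 ≤ L i ∧ ¬ L i ∣ r i) ∧
      ∀ z, f z = ∏ i, rl (L i) (r i) z ^ m i := by
  have hφ0 : φ 0 = 1 := by
    have h1 := hφ 0 (by simp)
    have h2 := hasSum_single (f := fun n => (c n : ℂ) * (0:ℂ) ^ n) 0 (fun n hn => by simp [hn])
    have := h1.unique h2
    simpa [hc0] using this
  have hd : DifferentiableOn ℂ φ (Metric.ball 0 1) := by
    refine (psum_diff (c := fun n => (c n : ℂ)) (fun t ht => (hφ t ht).summable)).congr ?_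
    intro t ht
    exact (hφ t ht).tsum_eq.symm
  have hne : ∀ t ∈ Metric.ball (0:ℂ) 1, φ t ≠ 0 := by
    intro t ht
    by_cases ht0 : t = 0
    · rw [ht0, hφ0]; exact one_ne_zero
    · obtain ⟨z, rfl⟩ := exists_tN 1 ht0 (by simpa using ht)
      intro h
      apply hf.2.1 z
      rw [hfφ, h, mul_zero]
  obtain ⟨b, hb⟩ := LD.exists hd hne hφ0
  obtain ⟨a, ha⟩ := hb.int_exp c hφ
  obtain ⟨N, hN, hinv, M, μ, C, hM, hC, hfM⟩ := step1 f hf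
  have h2a := step2a hC hfM hb hfφ
  obtain ⟨ha1, ha2⟩ := step2b hM hb h2a ha
  have hprod := phi_prod hb ha ha1 ha2
  have hN0 : 0 < N := NeZero.pos N
  set l := 2 * N with hl
  let β : Fin (N-1) → ℝ := fun i => (((-(l * beta l ((i + 1 : ℕ) : ZMod l) / 2) : ℚ)) : ℝ)
  let x : ℝ := s + ∑ i, β i * a (i+1)
  have hF : ∀ z : ℍ, f z = cexp (2 * π * Complex.I * x * z) * ∏ i : Fin (N-1), rl (l:ℕ) ((i + 1 : ℕ) : ℤ) z ^ (-a (i+1)) := by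
    intro z
    rw [hfφ, hprod _ (tN_mem z)]
    have e1 : ∀ i : Fin (N-1), rl (l:ℕ) ((i + 1 : ℕ) : ℤ) z ^ (-a (i+1)) =
        cexp (-(2 * π * Complex.I * (β i * a (i+1)) * z)) * QA l (((i + 1 : ℕ) : ZMod l), 0) (tN 1 z) ^ a (i+1) := by
      intro i
      rw [rl_eq (by omega) (by omega), mul_zpow, _root_.inv_zpow', neg_neg, ← Complex.exp_int_mul]
      congr 2
      push_cast
      simp only [β]; push_cast; ring
    rw [Finset.prod_congr rfl (fun i _ => e1 i), Finset.prod_mul_distrib, ← mul_assoc, ← Complex.exp_sum, ← Complex.exp_add]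
    congr 2
    simp only [x]
    push_cast
    rw [Finset.sum_neg_distrib, ← Finset.sum_mul, ← Finset.mul_sum]
    ring
  have hrlne : ∀ z : ℍ, ∏ i : Fin (N-1), rl (l:ℕ) ((i + 1 : ℕ) : ℤ) z ^ (-a (i+1)) ≠ 0 := by
    intro z h
    apply hf.2.1 z
    rw [hF, h, mul_zero]
  have hx : x = 0 := by
    have hnn : ∀ z : ℍ, ‖∏ i : Fin (N-1), rl (l:ℕ) ((i + 1 : ℕ) : ℤ) (low (l^2) • z) ^ (-a (i+1))‖ = ‖∏ i : Fin (N-1), rl (l:ℕ) ((i + 1 : ℕ) : ℤ) z ^ (-a (i+1))‖ := by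
      intro z
      rw [norm_prod, norm_prod]
      refine Finset.prod_congr rfl fun i _ => ?_
      rw [norm_zpow, norm_zpow]
      congr 1
      have := congrArg norm (rl_inv (l := l) (r := i+1) (by omega) (by omega) z)
      rw [norm_pow, norm_pow] at this
      exact (pow_left_inj₀ (norm_nonneg _) (norm_nonneg _) (by positivity)).1 this
    refine exp_rigid (c := (l:ℤ)^2) (by positivity) fun z => ?_
    have h1 := hinv (low ((l:ℤ)^2)) (low_mem (by
      rw [hl]; push_cast; exact Dvd.intro (4 * N) (by ring))) z
    rw [hF, hF] at h1
    have h2 := congrArg norm h1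
    rw [norm_mul, norm_mul, hnn] at h2
    exact mul_right_cancel₀ (norm_ne_zero_iff.2 (hrlne z)) h2
  refine ⟨N - 1, fun i => ((i + 1 : ℕ) : ℤ), fun _ => (l : ℕ), fun i => -a (i+1), fun i => ⟨?_, ?_⟩, fun z => ?_⟩
  · show (1:ℤ) ≤ (l:ℕ)
    omega
  · intro h
    have h' := Int.natCast_dvd_natCast.1 h
    have := Nat.le_of_dvd (by omega) h'
    omega
  · rw [hF, hx]; simp

lemma final_triv (f : ℍ → ℂ) (hf : IsModularUnit f) {s : ℝ} (y : ℝ) (hy : 0 < y)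
    (h : ∀ z : ℍ, z.im < y → f z = cexp (2 * π * Complex.I * s * z)) : ∀ z, f z = 1 := by
  have hall : ∀ z : ℍ, f z = cexp (2 * π * Complex.I * s * z) := by
    have hdf := UpperHalfPlane.mdifferentiable_iff.1 hf.1
    have ho : IsOpen {z : ℂ | 0 < z.im} := isOpen_lt continuous_const Complex.continuous_im
    have hc : IsPreconnected {z : ℂ | 0 < z.im} := (convex_halfSpace_im_gt 0).isPreconnected
    have h1 : AnalyticOnNhd ℂ (f ∘ ↑ofComplex) {z : ℂ | 0 < z.im} := hdf.analyticOnNhd ho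
    have h2 : AnalyticOnNhd ℂ (fun z : ℂ => cexp (2 * π * Complex.I * s * z)) {z : ℂ | 0 < z.im} :=
      DifferentiableOn.analyticOnNhd (by fun_prop) ho
    have hm : (Complex.I * (y/2 : ℝ)) ∈ {z : ℂ | 0 < z.im} := by
      simp; positivity
    have := h1.eqOn_of_preconnected_of_eventuallyEq h2 hc hm (by
      have : {z : ℂ | 0 < z.im ∧ z.im < y} ∈ 𝓝 (Complex.I * (y/2 : ℝ)) := by
        refine (IsOpen.inter ho (isOpen_lt Complex.continuous_im continuous_const)).mem_nhds ⟨hm, ?_⟩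
        simp; linarith
      filter_upwards [this] with w hw
      have := h ⟨w, hw.1⟩ hw.2
      simp only [Function.comp]
      rw [UpperHalfPlane.ofComplex_apply_of_im_pos hw.1]
      exact this)
    intro z
    have := this z.im_pos
    simpa using this
  obtain ⟨N, hN, hinv⟩ := hf.2.2.1
  have hs : s = 0 := by
    refine exp_rigid (c := N) (by positivity) fun z => ?_
    rw [← hall, ← hall, hinv _ (low_mem dvd_rfl)]
  intro z
  rw [hall, hs]; simp

theorem sl2z_invariant_units_stmt2 (f : UpperHalfPlane → ℂ) (hf : IsModularUnit f)
    (hexp : ∃ (s : ℚ) (c : ℕ → ℕ), ∀ z : UpperHalfPlane,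
      f z * Complex.exp (-(2 * (π : ℂ) * Complex.I * (s : ℂ) * (z : ℂ))) =
        1 + ∑' n : ℕ, (c n : ℂ) *
          Complex.exp (2 * (π : ℂ) * Complex.I * ((n : ℂ) + 1) * (z : ℂ))) :
    ∃ (k : ℕ) (r L m : Fin k → ℤ),
      (∀ i, 1 ≤ L i ∧ ¬ L i ∣ r i) ∧
      ∀ z, f z = ∏ i, rl (L i) (r i) z ^ m i := by
  obtain ⟨s, c, hc⟩ := hexp
  have hE : ∀ (n : ℕ) (z : ℍ), Complex.exp (2 * (π : ℂ) * Complex.I * ((n : ℂ) + 1) * (z : ℂ)) = tN 1 z ^ (n+1) := by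
    intro n z
    unfold tN
    rw [← Complex.exp_nat_mul]; congr 1; push_cast; ring
  have hf' : ∀ z : ℍ, f z = cexp (2 * π * Complex.I * (s:ℝ) * z) * (1 + ∑' n : ℕ, (c n : ℂ) * tN 1 z ^ (n+1)) := by
    intro z
    have := hc z
    simp only [hE] at this
    rw [← this, mul_comm, mul_assoc, ← Complex.exp_add]
    simp
  by_cases hS : ∀ z : ℍ, Summable (fun n : ℕ => (c n : ℂ) * tN 1 z ^ (n+1))
  · let c' : ℕ → ℤ := fun n => if n = 0 then 1 else (c (n-1) : ℤ)
    refine final_main f hf (s := (s:ℝ)) (φ := fun t => 1 + ∑' n : ℕ, (c n : ℂ) * t ^ (n+1)) (c := c') rfl ?_ hf'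
    intro t ht
    have hsum : Summable (fun n : ℕ => (c n : ℂ) * t ^ (n+1)) := by
      by_cases ht0 : t = 0
      · simpa [ht0] using summable_zero
      · obtain ⟨z, rfl⟩ := exists_tN 1 ht0 (by simpa using ht)
        exact hS z
    have hs1 : HasSum (fun n : ℕ => (c' (n+1) : ℂ) * t ^ (n+1)) (∑' n : ℕ, (c n : ℂ) * t ^ (n+1)) := by
      have e : (fun n : ℕ => (c' (n+1) : ℂ) * t ^ (n+1)) = fun n : ℕ => (c n : ℂ) * t ^ (n+1) := by
        funext n; simp [c']
      rw [e]; exact hsum.hasSum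
    have hs2 := hs1.zero_add (f := fun n : ℕ => (c' n : ℂ) * t ^ n)
    have e0 : (c' 0 : ℂ) * t ^ 0 = 1 := by simp [c']
    simp only [e0] at hs2
    exact hs2
  · push Not at hS
    obtain ⟨z₀, hz₀⟩ := hS
    have h1 := final_triv f hf (s := (s:ℝ)) z₀.im z₀.im_pos (fun z hz => by
      rw [hf']
      have hns : ¬ Summable (fun n : ℕ => (c n : ℂ) * tN 1 z ^ (n+1)) := by
        intro hs
        apply hz₀
        refine Summable.of_norm_bounded hs.norm fun n => ?_
        rw [norm_mul, norm_mul, norm_pow, norm_pow]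
        have : ‖tN 1 z₀‖ ≤ ‖tN 1 z‖ := by
          have hh : ∀ w : ℍ, ‖tN 1 w‖ = Real.exp (-(2 * π * 1 * w.im)) := by
            intro w
            rw [← exp_norm_im]; unfold tN; simp
          rw [hh, hh]
          apply Real.exp_le_exp.2
          have := Real.pi_pos
          nlinarith
        gcongr
      rw [tsum_eq_zero_of_not_summable hns]; simp)
    exact ⟨0, Fin.elim0, Fin.elim0, Fin.elim0, fun i => i.elim0, fun z => by simpa using h1 z⟩
end
end

section
/- Let A = (a b; c d) ∈ SL(2,ℤ). Then for all z in the upper half plane ℍ and all x ∈ ℂ: φ(Az, x/(cz+d)) · exp(−πi·c·x²/(cz+d)) = ( η(Az)² / ((cz+d)·η(z)²) ) · φ(z, x), where Az = (az+b)/(cz+d). -/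
open Complex Filter Topology UpperHalfPlane Matrix MatrixGroups
open scoped Real

noncomputable section

/-- The function `φ(z,x) = q^{1/12}(ζ^{1/2} − ζ^{−1/2}) ∏_{n≥1}(1 − q^n ζ)(1 − q^n ζ^{−1})`,
with `q = e^{2πiz}` and `ζ = e^{2πix}`; up to elementary factors, the Weierstrass
σ-function. -/
def weierPhi (z : UpperHalfPlane) (x : ℂ) : ℂ :=
  Complex.exp (2 * (π : ℂ) * Complex.I * (z : ℂ) / 12) *
    (Complex.exp ((π : ℂ) * Complex.I * x) - Complex.exp (-((π : ℂ) * Complex.I * x))) *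
    ∏' n : ℕ,
      ((1 - Complex.exp (2 * (π : ℂ) * Complex.I * ((n : ℂ) + 1) * (z : ℂ)) *
          Complex.exp (2 * (π : ℂ) * Complex.I * x)) *
       (1 - Complex.exp (2 * (π : ℂ) * Complex.I * ((n : ℂ) + 1) * (z : ℂ)) *
          Complex.exp (-(2 * (π : ℂ) * Complex.I * x))))

/-- The Dedekind eta function `η(z) = q^{1/24} ∏_{n≥1}(1 − q^n)`. -/
def dedekindEta (z : UpperHalfPlane) : ℂ :=
  Complex.exp (2 * (π : ℂ) * Complex.I * (z : ℂ) / 24) *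
    ∏' n : ℕ, (1 - Complex.exp (2 * (π : ℂ) * Complex.I * ((n : ℂ) + 1) * (z : ℂ)))

/-- The product `∏_{n ≥ 1} (1 - q^n w)`. -/
def EP (q w : ℂ) : ℂ := ∏' n : ℕ, (1 - q ^ (n + 1) * w)

lemma EP_summable {q : ℂ} (hq : ‖q‖ < 1) (w : ℂ) :
    Summable fun n : ℕ => ‖-(q ^ (n + 1) * w)‖ := by
  have h := ((summable_nat_add_iff 1).mpr
    (summable_geometric_of_lt_one (norm_nonneg q) hq)).mul_right ‖w‖
  simpa using h

lemma EP_multipliable {q : ℂ} (hq : ‖q‖ < 1) (w : ℂ) :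
    Multipliable fun n : ℕ => 1 - q ^ (n + 1) * w := by
  simpa [sub_eq_add_neg] using multipliable_one_add_of_summable (EP_summable hq w)

lemma EP_ne_zero {q : ℂ} (hq : ‖q‖ < 1) (w : ℂ) (h : ∀ n : ℕ, q ^ (n + 1) * w ≠ 1) :
    EP q w ≠ 0 := by
  have := tprod_one_add_ne_zero_of_summable (f := fun n : ℕ => -(q ^ (n + 1) * w))
    (fun n hn => h n (by linear_combination -hn)) (EP_summable hq w)
  simpa [EP, sub_eq_add_neg] using this

lemma EP_step {q : ℂ} (hq : ‖q‖ < 1) (w : ℂ) : EP q w = (1 - q * w) * EP q (q * w) := by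
  unfold EP
  rw [tprod_eq_zero_mul']
  · simp [pow_succ, mul_assoc]
  · refine (EP_multipliable hq (q * w)).congr fun n => ?_
    ring

lemma EP_differentiable {q : ℂ} (hq : ‖q‖ < 1) : Differentiable ℂ (EP q) := by
  have : HasProdLocallyUniformlyOn (fun (n : ℕ) w => 1 + -(q ^ (n + 1) * w))
      (fun w => ∏' n : ℕ, (1 + -(q ^ (n + 1) * w))) Set.univ := by
    apply hasProdLocallyUniformlyOn_of_forall_compact isOpen_univ
    intro K _ hcK
    obtain ⟨M, hM⟩ := hcK.isBounded.exists_norm_le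
    refine (((summable_nat_add_iff 1).mpr
      (summable_geometric_of_lt_one (norm_nonneg q) hq)).mul_right M).hasProdUniformlyOn_nat_one_add
      hcK (.of_forall fun n x hx => ?_) (fun _ => by fun_prop)
    simp only [norm_neg, norm_mul, norm_pow]
    exact mul_le_mul_of_nonneg_left (hM x hx) (by positivity)
  have h2 := this.differentiableOn
    (.of_forall fun _ => by
      simpa [Finset.prod_fn] using DifferentiableOn.finsetProd (fun _ _ => by fun_prop)) isOpen_univ
  rw [differentiableOn_univ] at h2
  simpa [EP, sub_eq_add_neg] using! h2

/-- The nome. -/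
def nome (z : ℂ) : ℂ := Complex.exp (2 * π * Complex.I * z)

lemma nome_lt (z : ℍ) : ‖nome z‖ < 1 := norm_exp_two_pi_I_lt_one z

lemma nome_pow (z : ℂ) (n : ℕ) :
    Complex.exp (2 * (π : ℂ) * Complex.I * ((n : ℂ) + 1) * z) = nome z ^ (n + 1) := by
  rw [nome, ← Complex.exp_nat_mul]
  congr 1; push_cast; ring

lemma phi_eq (z : ℍ) (x : ℂ) : weierPhi z x =
    Complex.exp (2 * (π : ℂ) * Complex.I * (z : ℂ) / 12) *
    (Complex.exp ((π : ℂ) * Complex.I * x) - Complex.exp (-((π : ℂ) * Complex.I * x))) *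
    (EP (nome z) (nome x) * EP (nome z) (nome (-x))) := by
  unfold weierPhi EP
  rw [← (EP_multipliable (nome_lt z) _).tprod_mul (EP_multipliable (nome_lt z) _)]
  simp only [nome_pow]
  simp [nome]

lemma eta_eq (z : ℍ) : dedekindEta z ^ 2 =
    Complex.exp (2 * (π : ℂ) * Complex.I * (z : ℂ) / 12) * (EP (nome z) 1 * EP (nome z) 1) := by
  unfold dedekindEta EP
  simp only [nome_pow, mul_one]
  rw [mul_pow, ← Complex.exp_nat_mul, sq (∏' _, _)]
  congr 2; push_cast; ring

lemma nome_add (x y : ℂ) : nome (x + y) = nome x * nome y := by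
  simp [nome, mul_add, Complex.exp_add]

lemma nome_eq_one {x : ℂ} (h : nome x = 1) : ∃ n : ℤ, x = n := by
  rw [nome, Complex.exp_eq_one_iff] at h
  obtain ⟨n, hn⟩ := h
  exact ⟨n, mul_left_cancel₀ Complex.two_pi_I_ne_zero (by linear_combination hn)⟩

lemma nome_one : nome 1 = 1 := by simp [nome]
lemma nome_zero : nome 0 = 1 := by simp [nome]
lemma nome_neg_one : nome (-1) = 1 := by simp [nome, Complex.exp_neg]

lemma pow_nome_mul (z x : ℂ) (n : ℕ) : nome z ^ (n + 1) * nome x = nome ((n + 1) * z + x) := by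
  rw [nome_add]; congr 1
  rw [← nome_pow, nome]; congr 1; ring

lemma nome_differentiable : Differentiable ℂ nome := by unfold nome; fun_prop

lemma phi_differentiable (z : ℍ) : Differentiable ℂ (weierPhi z) := by
  have h1 := (EP_differentiable (nome_lt z)).comp nome_differentiable
  have h2 := h1.comp (differentiable_id.neg (𝕜 := ℂ) (f := fun x : ℂ => x))
  have : weierPhi z = fun x => _ := funext (phi_eq z)
  rw [this]
  refine Differentiable.mul (by fun_prop) (h1.mul h2)

lemma phi_zero (z : ℍ) : weierPhi z 0 = 0 := by simp [phi_eq]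

lemma phi_deriv (z : ℍ) :
    HasDerivAt (weierPhi z) (2 * π * Complex.I * dedekindEta z ^ 2) 0 := by
  have h1 := (EP_differentiable (nome_lt z)).comp nome_differentiable
  have h2 := h1.comp (differentiable_id.neg (𝕜 := ℂ) (f := fun x : ℂ => x))
  have h3 := ((h1.mul h2) 0).hasDerivAt
  have : weierPhi z = fun x => _ := funext (phi_eq z)
  rw [this, eta_eq]
  have e1 : HasDerivAt (fun x : ℂ => (π : ℂ) * Complex.I * x) (π * Complex.I) 0 := by
    simpa using (hasDerivAt_id (0 : ℂ)).const_mul ((π : ℂ) * Complex.I)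
  have h4 := ((e1.cexp.sub e1.neg.cexp).const_mul
    (Complex.exp (2 * (π : ℂ) * Complex.I * (z : ℂ) / 12))).mul h3
  refine h4.congr_deriv ?_
  simp [nome_zero]
  ring

lemma eta_ne_zero' (z : ℍ) : dedekindEta z ^ 2 ≠ 0 := by
  rw [eta_eq]
  have : EP (nome z) 1 ≠ 0 := by
    refine EP_ne_zero (nome_lt z) _ fun n hn => ?_
    have h1 : ‖nome z ^ (n + 1)‖ < 1 := by
      rw [norm_pow]; exact pow_lt_one₀ (norm_nonneg _) (nome_lt z) (by simp)
    rw [mul_one] at hn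
    rw [hn] at h1
    simp at h1
  exact mul_ne_zero (Complex.exp_ne_zero _) (mul_ne_zero this this)

lemma phi_zeros (z : ℍ) (x : ℂ) (h : weierPhi z x = 0) : ∃ m n : ℤ, x = m + n * z := by
  rw [phi_eq] at h
  by_contra! hx
  refine absurd h (mul_ne_zero (mul_ne_zero (Complex.exp_ne_zero _) ?_) (mul_ne_zero ?_ ?_))
  · intro h0
    have h1 : nome x = 1 := by
      have : nome x = Complex.exp (π * Complex.I * x) * Complex.exp (π * Complex.I * x) := by
        rw [nome, ← Complex.exp_add]; congr 1; ring
      rw [this]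
      nth_rewrite 1 [sub_eq_zero.mp h0]
      rw [← Complex.exp_add]; simp
    obtain ⟨m, hm⟩ := nome_eq_one h1
    exact hx m 0 (by simp [hm])
  · refine EP_ne_zero (nome_lt z) _ fun n hn => ?_
    rw [pow_nome_mul] at hn
    obtain ⟨m, hm⟩ := nome_eq_one hn
    exact hx m (-(n + 1)) (by push_cast; linear_combination hm)
  · refine EP_ne_zero (nome_lt z) _ fun n hn => ?_
    rw [pow_nome_mul] at hn
    obtain ⟨m, hm⟩ := nome_eq_one hn
    exact hx (-m) (n + 1) (by push_cast; linear_combination -hm)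

lemma phi_add_one (z : ℍ) (x : ℂ) : weierPhi z (x + 1) = Complex.exp (π * Complex.I) * weierPhi z x := by
  simp only [phi_eq, neg_add, nome_add, nome_one, nome_neg_one, mul_add, Complex.exp_add, mul_one,
    Complex.exp_neg, Complex.exp_pi_mul_I]
  norm_num
  ring

lemma phi_add_tau (z : ℍ) (x : ℂ) :
    weierPhi z (x + z) = Complex.exp (π * Complex.I * (1 - z - 2 * x)) * weierPhi z x := by
  have h1 : EP (nome z) (nome x) = (1 - nome (x + z)) * EP (nome z) (nome (x + z)) := by
    rw [EP_step (nome_lt z), nome_add, mul_comm (nome x)]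
  have h2 : EP (nome z) (nome (-(x + z))) = (1 - nome (-x)) * EP (nome z) (nome (-x)) := by
    rw [EP_step (nome_lt z), ← nome_add]
    congr <;> ring
  rw [phi_eq, phi_eq, h1, h2]
  have k1 : Complex.exp (π * Complex.I * (x + z)) - Complex.exp (-(π * Complex.I * (x + z))) =
      - Complex.exp (-(π * Complex.I * (x + z))) * (1 - nome (x + z)) := by
    rw [mul_sub, nome, neg_mul, neg_mul, ← Complex.exp_add]
    ring_nf
  have k2 : 1 - nome (-x) = Complex.exp (-(π * Complex.I * x)) *
      (Complex.exp (π * Complex.I * x) - Complex.exp (-(π * Complex.I * x))) := by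
    rw [mul_sub, nome, ← Complex.exp_add, ← Complex.exp_add]
    ring_nf
    simp
    ring
  have k3 : Complex.exp (π * Complex.I * (1 - z - 2 * x)) =
      - Complex.exp (-(π * Complex.I * (x + z))) * Complex.exp (-(π * Complex.I * x)) := by
    rw [neg_mul, ← Complex.exp_add, ← neg_one_mul, ← Complex.exp_pi_mul_I, ← Complex.exp_add]
    ring_nf
  rw [k1, k2, k3]
  ring

lemma phi_add (z : ℍ) (m n : ℤ) (x : ℂ) : weierPhi z (x + m + n * z) =
    Complex.exp (π * Complex.I * (m + n - n ^ 2 * z - 2 * n * x)) * weierPhi z x := by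
  have hz : (z : ℂ) ≠ 0 := z.ne_zero
  have p1 : Function.Periodic (fun x => weierPhi z x * Complex.exp (-(π * Complex.I * x))) 1 := by
    intro x
    simp only [phi_add_one]
    rw [mul_comm (Complex.exp (π * Complex.I)), mul_assoc, ← Complex.exp_add]
    ring_nf
  have p2 : Function.Periodic
      (fun x => weierPhi z x * Complex.exp (π * Complex.I * (x ^ 2 - x) / z)) z := by
    intro x
    simp only [phi_add_tau]
    rw [mul_comm (Complex.exp _) (weierPhi z x), mul_assoc, ← Complex.exp_add]
    congr 2
    field_simp
    ring
  have q1 := p1.int_mul m x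
  have q2 := p2.int_mul n (x + m)
  simp only [mul_one] at q1 q2
  have r1 : weierPhi z (x + m) = weierPhi z x * Complex.exp (π * Complex.I * m) := by
    rw [← mul_left_inj' (Complex.exp_ne_zero (-(π * Complex.I * (x + m)))), q1,
      mul_assoc (weierPhi z x), ← Complex.exp_add]
    congr 2; ring
  have r2 : weierPhi z (x + m + n * z) =
      weierPhi z (x + m) * Complex.exp (π * Complex.I * (n - n ^ 2 * z - 2 * n * (x + m))) := by
    rw [← mul_left_inj' (Complex.exp_ne_zero (π * Complex.I * ((x + m + n * z) ^ 2 - (x + m + n * z)) / z)),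
      q2, mul_assoc (weierPhi z (x + m)), ← Complex.exp_add]
    congr 2
    field_simp
    ring
  rw [r2, r1, mul_assoc, ← Complex.exp_add, mul_comm]
  congr 1
  rw [Complex.exp_eq_exp_iff_exists_int]
  exact ⟨-(n * m), by push_cast; ring⟩

lemma parity_aux {p q r s : ℤ} (h : p * s - q * r = 1) : Odd (p + r + p * r) := by
  rcases Int.even_or_odd p with hp | hp <;> rcases Int.even_or_odd r with hr | hr
  · have h2 : Even (p * s - q * r) := (hp.mul_right s).sub (hr.mul_left q)
    rw [h] at h2
    simp at h2
  · exact (hp.add_odd hr).add_even (hp.mul_right r)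
  · exact (hp.add_even hr).add_even (hr.mul_left p)
  · exact (hp.add_odd hr).add_odd (hp.mul hr)

lemma liouville_key (τ : ℂ) (hτ : 0 < τ.im) (D F c1 c2 : ℂ → ℂ) (hD : Differentiable ℂ D)
    (hF : Differentiable ℂ F) (hD0 : D 0 = 0) (hD1 : deriv D 0 = 0) (hF0 : F 0 = 0)
    (hF1 : deriv F 0 ≠ 0) (hz : ∀ x, F x = 0 → ∃ m n : ℤ, x = m + n * τ)
    (hc1 : ∀ x, c1 x ≠ 0) (hc2 : ∀ x, c2 x ≠ 0)
    (D1 : ∀ x, D (x + 1) = c1 x * D x) (D2 : ∀ x, D (x + τ) = c2 x * D x)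
    (F1 : ∀ x, F (x + 1) = c1 x * F x) (F2 : ∀ x, F (x + τ) = c2 x * F x) (x : ℂ) : D x = 0 := by
  set H : ℂ → ℂ := fun x => D x / F x with hH
  have P1 : Function.Periodic H 1 := fun x => by
    simp only [hH, D1, F1, mul_div_mul_left _ _ (hc1 x)]
  have P2 : Function.Periodic H τ := fun x => by
    simp only [hH, D2, F2, mul_div_mul_left _ _ (hc2 x)]
  have P : ∀ (m n : ℤ) x, H (x + (m + n * τ)) = H x := fun m n x => by
    rw [← add_assoc, P2.int_mul n]
    simpa using P1.int_mul m x
  have hdiff0 : DifferentiableAt ℂ H 0 := by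
    have e : H = fun x => dslope D 0 x / dslope F 0 x := by
      funext x
      by_cases hx : x = 0
      · simp [hH, hx, hD0, hD1]
      · simp only [hH, dslope_of_ne _ hx, slope_def_field, hD0, hF0, sub_zero]
        rw [div_div_div_cancel_right₀ hx]
    have d1 : ∀ f : ℂ → ℂ, Differentiable ℂ f → DifferentiableAt ℂ (dslope f 0) 0 := by
      intro f hf
      have := (Complex.differentiableOn_dslope (f := f) (c := 0) (s := Set.univ)
        Filter.univ_mem).mpr hf.differentiableOn
      exact this.differentiableAt Filter.univ_mem
    rw [e]
    exact (d1 D hD).div (d1 F hF) (by simpa using hF1)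
  have hdiff : Differentiable ℂ H := by
    intro x
    by_cases hx : F x = 0
    · obtain ⟨m, n, rfl⟩ := hz x hx
      have e : H = fun y => H (y - (m + n * τ)) := by
        funext y
        rw [← P m n (y - _), sub_add_cancel]
      rw [e]
      have : DifferentiableAt ℂ H ((m + n * τ : ℂ) - (m + n * τ)) := by rwa [sub_self]
      exact this.comp (m + n * τ : ℂ) (f := fun y => y - (m + n * τ)) (by fun_prop)
    · exact (hD x).div (hF x) hx
  have hb : Bornology.IsBounded (Set.range H) := by
    have hc : IsCompact ((fun p : ℝ × ℝ => H (p.1 + p.2 * τ)) ''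
        (Set.Icc 0 1 ×ˢ Set.Icc 0 1)) := by
      refine (isCompact_Icc.prod isCompact_Icc).image ?_
      have := hdiff.continuous
      fun_prop
    refine hc.isBounded.subset ?_
    rintro _ ⟨x, rfl⟩
    set t := x.im / τ.im
    set s := x.re - t * τ.re
    have hx : x = s + t * τ := by
      apply Complex.ext
      · simp [s]
      · simp [t, hτ.ne']
    refine ⟨(Int.fract s, Int.fract t), ⟨⟨Int.fract_nonneg _, (Int.fract_lt_one _).le⟩,
      ⟨Int.fract_nonneg _, (Int.fract_lt_one _).le⟩⟩, ?_⟩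
    show H _ = H x
    rw [← P ⌊s⌋ ⌊t⌋, hx]
    congr 1
    have h1 : (s : ℂ) = ⌊s⌋ + Int.fract s := by exact_mod_cast (Int.floor_add_fract s).symm
    have h2 : (t : ℂ) = ⌊t⌋ + Int.fract t := by exact_mod_cast (Int.floor_add_fract t).symm
    linear_combination -h1 - τ * h2
  have hH0 : H x = 0 := by
    rw [hdiff.apply_eq_apply_of_bounded hb x 0]
    simp [hH, hD0]
  by_cases hx : F x = 0
  · obtain ⟨m, n, rfl⟩ := hz x hx
    have Q1 : Function.Periodic (fun x => D x = 0) 1 := fun x => by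
      simp [D1, hc1]
    have Q2 : Function.Periodic (fun x => D x = 0) τ := fun x => by
      simp [D2, hc2]
    have := Q2.int_mul n m
    change (D (m + n * τ) = 0) = (D m = 0) at this
    rw [this]
    have := Q1.int_mul m 0
    simp only [mul_one, zero_add] at this
    rw [this, hD0]
  · exact (div_eq_zero_iff.mp hH0).resolve_right hx

/-- Transformation of `φ` under `SL(2,ℤ)`:
`φ(Az, x/(cz+d))·e^{−πicx²/(cz+d)} = (η(Az)²/((cz+d)η(z)²))·φ(z,x)`. -/
theorem sl2z_invariant_units_stmt17 (A : SL(2, ℤ)) :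
    ∀ (z : UpperHalfPlane) (x : ℂ),
      weierPhi (A • z) (x / ((A.1 1 0 : ℂ) * (z : ℂ) + (A.1 1 1 : ℂ))) *
        Complex.exp (-((π : ℂ) * Complex.I * (A.1 1 0 : ℂ) * x ^ 2 /
          ((A.1 1 0 : ℂ) * (z : ℂ) + (A.1 1 1 : ℂ)))) =
      (dedekindEta (A • z) ^ 2 /
          (((A.1 1 0 : ℂ) * (z : ℂ) + (A.1 1 1 : ℂ)) * dedekindEta z ^ 2)) *
        weierPhi z x := by
  intro z x
  obtain ⟨a, b, c, d, hdet, ha, hb, hc, hd⟩ : ∃ a b c d : ℤ, a * d - b * c = 1 ∧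
      A.1 0 0 = a ∧ A.1 0 1 = b ∧ A.1 1 0 = c ∧ A.1 1 1 = d :=
    ⟨_, _, _, _, by have := A.2; rwa [Matrix.det_fin_two] at this, rfl, rfl, rfl, rfl⟩
  have hz' : ((A • z : ℍ) : ℂ) = (a * z + b) / (c * z + d) := by
    rw [UpperHalfPlane.coe_specialLinearGroup_apply]
    simp [ha, hb, hc, hd]
  have hj : (c * z + d : ℂ) ≠ 0 := by
    have := UpperHalfPlane.denom_ne_zero A z
    simpa [UpperHalfPlane.denom, hc, hd] using this
  rw [hc, hd]
  have hdetC : (a * d - b * c : ℂ) = 1 := by exact_mod_cast hdet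
  generalize (A • z : ℍ) = w at *
  have hw : (w : ℂ) * (c * z + d) = a * z + b := by rw [hz', div_mul_cancel₀ _ hj]
  set j : ℂ := c * z + d with hjdef
  have hη := eta_ne_zero' z
  have hη' := eta_ne_zero' w
  set G : ℂ → ℂ := fun x =>
    weierPhi w (x / j) * Complex.exp (-(π * Complex.I * c * x ^ 2 / j)) with hG
  set D : ℂ → ℂ := fun x => j * dedekindEta z ^ 2 * G x - dedekindEta w ^ 2 * weierPhi z x with hD
  have hGdiff : Differentiable ℂ G := by
    have h1 := phi_differentiable w
    have h2 : Differentiable ℂ fun x : ℂ => weierPhi w (x / j) :=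
      h1.comp (g := weierPhi w) (f := fun x => x / j) (by fun_prop)
    exact h2.mul (by fun_prop)
  have hDdiff : Differentiable ℂ D :=
    (hGdiff.const_mul _).sub ((phi_differentiable z).const_mul _)
  have hGder : HasDerivAt G (2 * π * Complex.I * dedekindEta w ^ 2 / j) 0 := by
    have h0 : HasDerivAt (fun x : ℂ => x / j) (1 / j) 0 := (hasDerivAt_id 0).div_const j
    have h1 : HasDerivAt (weierPhi w) (2 * π * Complex.I * dedekindEta w ^ 2) ((0 : ℂ) / j) := by
      rw [zero_div]; exact phi_deriv w
    have h2 := h1.comp 0 h0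
    have h3 : DifferentiableAt ℂ (fun x : ℂ => Complex.exp (-(π * Complex.I * c * x ^ 2 / j))) 0 := by
      fun_prop
    refine (h2.mul h3.hasDerivAt).congr_deriv ?_
    simp [phi_zero]
    ring
  have hodd : ∀ k : ℤ, Odd k → Complex.exp (π * Complex.I * k) = -1 := by
    rintro _ ⟨k, rfl⟩
    rw [← Complex.exp_pi_mul_I, Complex.exp_eq_exp_iff_exists_int]
    exact ⟨k, by push_cast; ring⟩
  have hinv : j⁻¹ = a - c * w := by
    rw [← one_div, div_eq_iff hj]
    linear_combination c * hw - hdetC - a * hjdef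
  have h3 : z * j⁻¹ = d * w - b := by
    rw [← div_eq_mul_inv, div_eq_iff hj]
    linear_combination -d * hw - z * hdetC + b * hjdef
  have h1 : (d + c * z : ℂ) * j⁻¹ = 1 := by
    rw [← div_eq_mul_inv, div_eq_iff hj, hjdef]; ring
  have h2 : (d : ℂ) ^ 2 * w + c * (z : ℂ) ^ 2 * j⁻¹ = z + b * d := by
    linear_combination c * z * h3 + d * hw + z * hdetC - d * w * hjdef
  have G1 : ∀ x, G (x + 1) = Complex.exp (π * Complex.I) * G x := by
    intro x
    have hx : (x + 1) / j = x / j + (a : ℤ) + ((-c : ℤ) : ℂ) * w := by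
      push_cast
      linear_combination hinv
    have ho : Odd (a + c + a * c) := parity_aux hdet
    simp only [hG]
    rw [hx, phi_add, Complex.exp_pi_mul_I, ← hodd _ ho, ← mul_assoc,
      mul_comm _ (weierPhi w (x / j)), mul_comm _ (weierPhi w (x / j)), mul_assoc (weierPhi w (x / j)),
      mul_assoc (weierPhi w (x / j)),
      ← Complex.exp_add, ← Complex.exp_add]
    congr 1
    rw [Complex.exp_eq_exp_iff_exists_int]
    refine ⟨-c - a * c, ?_⟩
    push_cast
    linear_combination (-π * Complex.I * c) * hinv
  have G2 : ∀ x, G (x + z) = Complex.exp (π * Complex.I * (1 - z - 2 * x)) * G x := by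
    intro x
    have hx : (x + z) / j = x / j + ((-b : ℤ) : ℂ) + (d : ℤ) * w := by
      push_cast
      linear_combination h3
    have ho : Odd (b + d + b * d) := by
      have := parity_aux (p := d) (q := c) (r := b) (s := a) (by linear_combination hdet)
      convert this using 1
      ring
    simp only [hG]
    have e1 : Complex.exp (π * Complex.I * (1 - z - 2 * x)) =
        Complex.exp (π * Complex.I * ((b + d + b * d) - z - 2 * x)) := by
      obtain ⟨k, hk⟩ := ho
      have hkC : (b + d + b * d : ℂ) = 2 * k + 1 := by exact_mod_cast hk
      rw [hkC, Complex.exp_eq_exp_iff_exists_int]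
      exact ⟨-k, by push_cast; ring⟩
    rw [hx, phi_add, e1, ← mul_assoc,
      mul_comm _ (weierPhi w (x / j)), mul_comm _ (weierPhi w (x / j)), mul_assoc (weierPhi w (x / j)),
      mul_assoc (weierPhi w (x / j)),
      ← Complex.exp_add, ← Complex.exp_add]
    congr 1
    rw [Complex.exp_eq_exp_iff_exists_int]
    refine ⟨-b - b * d, ?_⟩
    push_cast
    linear_combination (-2 * x * π * Complex.I) * h1 - π * Complex.I * h2
  have key := liouville_key z z.im_pos D (weierPhi z) (fun _ => Complex.exp (π * Complex.I))
    (fun x => Complex.exp (π * Complex.I * (1 - z - 2 * x))) hDdiff (phi_differentiable z)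
    (by simp [hD, hG, phi_zero])
    (by
      have := (hGder.const_mul (j * dedekindEta z ^ 2)).sub
        ((phi_deriv z).const_mul (dedekindEta w ^ 2))
      have h2 : HasDerivAt D _ 0 := this
      rw [h2.deriv]
      field_simp
      ring)
    (phi_zero z)
    (by
      rw [(phi_deriv z).deriv]
      exact mul_ne_zero Complex.two_pi_I_ne_zero hη)
    (phi_zeros z) (fun _ => Complex.exp_ne_zero _) (fun _ => Complex.exp_ne_zero _)
    (fun x => by simp only [hD, G1, phi_add_one]; ring)
    (fun x => by simp only [hD, G2, phi_add_tau]; ring)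
    (phi_add_one z) (phi_add_tau z) x
  change G x = _
  have k2 : j * dedekindEta z ^ 2 * G x = dedekindEta w ^ 2 * weierPhi z x := sub_eq_zero.mp key
  rw [div_mul_eq_mul_div, eq_div_iff (mul_ne_zero hj hη), ← k2]
  ring
end
end
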